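/- (Upper bounds on the slightly subcritical two-point function.) Suppose d ≥ 1, 0 < α < d and α < 1. Then there is a constant C₁ < ∞ (depending only on d, α, c, C) such that for every 0 < β ≤ β_c and every x ∈ ℤ^d \ {0}: ℙ_β(0 ↔ x) ≤ C₁ ‖x‖^{−d+α} if ‖x‖ ≤ ξ(β), and ℙ_β(0 ↔ x) ≤ C₁ χ(β)² ‖x‖^{−d−α} if ‖x‖ > ξ(β). -/

import Mathlib

open MeasureTheory ENNReal

namespace LRP

/-- The vertex set `ℤ^d`. -/
abbrev V (d : ℕ) : Type := Fin d → ℤ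

/-- The `ℓ^∞` norm of a lattice point, as a natural number. -/
def normInf {d : ℕ} (x : V d) : ℕ := Finset.univ.sup fun i => (x i).natAbs

/-- A percolation configuration: each (unordered) pair of vertices is open or closed. -/
abbrev Config (d : ℕ) : Type := Sym2 (V d) → Bool

/-- The probability `1 - exp (-β J(x,y))` that the edge `e = {x,y}` is open
(the symmetrization `(J x y + J y x)/2` equals `J x y` for symmetric `J`). -/
noncomputable def edgeProb {d : ℕ} (J : V d → V d → ℝ) (β : ℝ) (e : Sym2 (V d)) : ℝ≥0∞ :=
  ENNReal.ofReal (1 - Real.exp (-β *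
    Sym2.lift ⟨fun x y => (J x y + J y x) / 2, fun x y => by dsimp only; rw [add_comm]⟩ e))

/-- `IsLRP J P` asserts that for each `β`, `P β` is the law of long-range percolation on `ℤ^d`
with kernel `J` at inverse temperature `β`: distinct edges are open independently, edge `{x,y}`
being open with probability `1 - exp (-β J(x,y))`.  This is expressed by prescribing the
probability of every finite cylinder event, which characterizes the measure uniquely. -/
def IsLRP {d : ℕ} (J : V d → V d → ℝ) (P : ℝ → Measure (Config d)) : Prop :=
  ∀ (β : ℝ) (s : Finset (Sym2 (V d))) (f : Sym2 (V d) → Bool),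
    P β {ω | ∀ e ∈ s, ω e = f e} =
      ∏ e ∈ s, (if f e then edgeProb J β e else 1 - edgeProb J β e)

/-- Two vertices are adjacent if they are distinct and the edge between them is open. -/
def adj {d : ℕ} (ω : Config d) (x y : V d) : Prop := x ≠ y ∧ ω s(x, y) = true

/-- `x ↔ y`: the vertices are connected by a path of open edges. -/
def conn {d : ℕ} (ω : Config d) (x y : V d) : Prop := Relation.ReflTransGen (adj ω) x y

/-- `x ↔ y` inside `A`: connected by an open path all of whose vertices lie in `A`. -/
def connIn {d : ℕ} (ω : Config d) (A : Set (V d)) (x y : V d) : Prop :=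
  x ∈ A ∧ y ∈ A ∧ Relation.ReflTransGen (fun a b => a ∈ A ∧ b ∈ A ∧ adj ω a b) x y

/-- The cluster of `x`. -/
def cluster {d : ℕ} (ω : Config d) (x : V d) : Set (V d) := {y | conn ω x y}

/-- The critical point `β_c`. -/
noncomputable def betaC {d : ℕ} (P : ℝ → Measure (Config d)) : ℝ :=
  sInf {β : ℝ | 0 ≤ β ∧ 0 < P β {ω | ∃ x, (cluster ω x).Infinite}}

/-- The two-point function `ℙ_β(x ↔ y)`. -/
noncomputable def twoPoint {d : ℕ} (P : ℝ → Measure (Config d)) (β : ℝ) (x y : V d) : ℝ≥0∞ :=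
  P β {ω | conn ω x y}

/-- The susceptibility `χ(β) = Σ_x ℙ_β(0 ↔ x)`. -/
noncomputable def chi {d : ℕ} (P : ℝ → Measure (Config d)) (β : ℝ) : ℝ≥0∞ :=
  ∑' x : V d, twoPoint P β 0 x

/-- `Σ_{x ∈ [-n,n]^d} ℙ_β(0 ↔ x)`. -/
noncomputable def boxSum {d : ℕ} (P : ℝ → Measure (Config d)) (β : ℝ) (n : ℕ) : ℝ≥0∞ :=
  ∑' x : V d, if normInf x ≤ n then twoPoint P β 0 x else 0

/-- The correlation length `ξ(β) = inf {r ≥ 1 : Σ_{x ∈ [-r,r]^d} ℙ_β(0↔x) ≥ χ(β)/2}`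
(`= ∞` if no such `r` exists). -/
noncomputable def xi {d : ℕ} (P : ℝ → Measure (Config d)) (β : ℝ) : ℝ≥0∞ :=
  sInf {r : ℝ≥0∞ | ∃ n : ℕ, r = (n : ℝ≥0∞) ∧ 1 ≤ n ∧ chi P β ≤ 2 * boxSum P β n}

/-- The triangle diagram `∇_β`. -/
noncomputable def triangle {d : ℕ} (P : ℝ → Measure (Config d)) (β : ℝ) : ℝ≥0∞ :=
  ∑' x : V d, ∑' y : V d, twoPoint P β 0 x * twoPoint P β x y * twoPoint P β y 0

/-- The standing assumptions on the kernel `J`: symmetric, integrable, translation-invariant,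
with `c ‖x-y‖^{-d-α} ≤ J(x,y) ≤ C ‖x-y‖^{-d-α}` for distinct `x, y`, where `0 < α < d`. -/
structure KernelHyp (d : ℕ) (J : V d → V d → ℝ) (α c C : ℝ) : Prop where
  d_pos : 1 ≤ d
  symm : ∀ x y, J x y = J y x
  transInv : ∀ x y z : V d, J (x + z) (y + z) = J x y
  nonneg : ∀ x y, 0 ≤ J x y
  integrable : Summable fun x : V d => J 0 x
  alpha_pos : 0 < α
  alpha_lt_d : α < (d : ℝ)
  c_pos : 0 < c
  c_le_C : c ≤ C
  lower : ∀ x y : V d, x ≠ y → c * (normInf (x - y) : ℝ) ^ (-(d : ℝ) - α) ≤ J x y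
  upper : ∀ x y : V d, x ≠ y → J x y ≤ C * (normInf (x - y) : ℝ) ^ (-(d : ℝ) - α)


end LRP

open MeasureTheory ENNReal
namespace LRP

section prob
variable {E : Type} [DecidableEq E]

/-- cylinder formula -/
def IsCyl (p : E → ℝ≥0∞) (μ : Measure (E → Bool)) : Prop :=
  ∀ (s : Finset E) (f : E → Bool), μ {ω | ∀ e ∈ s, ω e = f e} =
    ∏ e ∈ s, (if f e then p e else 1 - p e)

/-- the event `A` depends only on the coordinates in `s` -/
def Dep (A : Set (E → Bool)) (s : Set E) : Prop :=
  ∀ ω ω' : E → Bool, (∀ e ∈ s, ω e = ω' e) → ω ∈ A → ω' ∈ A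

variable {p : E → ℝ≥0∞} {μ : Measure (E → Bool)}

theorem IsCyl.prob (h : IsCyl p μ) : IsProbabilityMeasure μ := by
  constructor
  have := h ∅ (fun _ => true)
  simpa using this

/-- Bernoulli measure -/
noncomputable def bern (q : ℝ≥0∞) : Measure Bool :=
  q • Measure.dirac true + (1 - q) • Measure.dirac false

theorem bern_prob {q : ℝ≥0∞} (hq : q ≤ 1) : IsProbabilityMeasure (bern q) := by
  constructor
  simp [bern, add_tsub_cancel_of_le hq]

theorem bern_single (q : ℝ≥0∞) (b : Bool) : bern q {b} = if b then q else 1 - q := by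
  cases b <;> simp [bern]

theorem IsCyl.eq_pi (h : IsCyl p μ) (hp : ∀ e, p e ≤ 1) :
    haveI : ∀ e, IsProbabilityMeasure (bern (p e)) := fun e => bern_prob (hp e)
    μ = Measure.infinitePi (fun e => bern (p e)) := by
  haveI : ∀ e, IsProbabilityMeasure (bern (p e)) := fun e => bern_prob (hp e)
  refine IsProjectiveLimit.unique ?_ (Measure.isProjectiveLimit_infinitePi _)
  intro I
  apply Measure.ext_of_singleton
  intro g
  rw [Measure.map_apply (by fun_prop) (measurableSet_singleton _)]
  have h1 : (I.restrict (π := fun _ : E => Bool)) ⁻¹' {g} =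
      {ω : E → Bool | ∀ e ∈ I, ω e = (fun e => if he : e ∈ I then g ⟨e, he⟩ else true) e} := by
    ext ω
    simp only [Set.mem_preimage, Set.mem_singleton_iff, Set.mem_setOf_eq]
    constructor
    · intro hh e he
      rw [← hh]; simp [he]
    · intro hh
      funext e
      have := hh e e.2
      simpa using this
  rw [h1, h, ← Set.univ_pi_singleton, Measure.pi_pi]
  rw [← Finset.prod_coe_sort]
  apply Finset.prod_congr rfl
  intro e _
  simp [bern_single]

theorem IsCyl.unique {μ' : Measure (E → Bool)} (h : IsCyl p μ) (h' : IsCyl p μ')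
    (hp : ∀ e, p e ≤ 1) : μ = μ' := by
  rw [h.eq_pi hp, h'.eq_pi hp]

theorem IsCyl.iIndep (h : IsCyl p μ) (hp : ∀ e, p e ≤ 1) :
    ProbabilityTheory.iIndepFun (fun (e : E) (ω : E → Bool) => ω e) μ := by
  haveI : ∀ e, IsProbabilityMeasure (bern (p e)) := fun e => bern_prob (hp e)
  rw [h.eq_pi hp]
  exact ProbabilityTheory.iIndepFun_infinitePi (X := fun e b => b) (fun e => measurable_id)

theorem Dep.mono {A : Set (E → Bool)} {s t : Set E} (h : Dep A s) (hst : s ⊆ t) : Dep A t :=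
  fun ω ω' hh => h ω ω' (fun e he => hh e (hst he))

theorem Dep.inter {A B : Set (E → Bool)} {s t : Set E} (h : Dep A s) (h' : Dep B t) :
    Dep (A ∩ B) (s ∪ t) :=
  fun ω ω' hh hA => ⟨h ω ω' (fun e he => hh e (Or.inl he)) hA.1,
    h' ω ω' (fun e he => hh e (Or.inr he)) hA.2⟩

theorem Dep.compl {A : Set (E → Bool)} {s : Set E} (h : Dep A s) : Dep Aᶜ s :=
  fun ω ω' hh hA hA' => hA (h ω' ω (fun e he => (hh e he).symm) hA')

theorem Dep.repr {A : Set (E → Bool)} {s : Finset E} (h : Dep A (s : Set E)) :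
    A = (fun (ω : E → Bool) (e : s) => ω e) ⁻¹' ((fun (ω : E → Bool) (e : s) => ω e) '' A) := by
  ext ω
  constructor
  · intro hω; exact ⟨ω, hω, rfl⟩
  · rintro ⟨ω', hω', hh⟩
    exact h ω' ω (fun e he => congrFun hh ⟨e, he⟩) hω'

theorem Dep.meas {A : Set (E → Bool)} {s : Set E} (h : Dep A s) (hs : s.Finite) :
    MeasurableSet A := by
  lift s to Finset E using hs
  rw [h.repr]
  apply MeasurableSet.preimage
  · exact (Set.toFinite _).measurableSet
  · fun_prop

theorem IsCyl.indep (h : IsCyl p μ) (hp : ∀ e, p e ≤ 1) {A B : Set (E → Bool)} {s t : Set E}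
    (hA : Dep A s) (hB : Dep B t) (hs : s.Finite) (ht : t.Finite) (hst : Disjoint s t) :
    μ (A ∩ B) = μ A * μ B := by
  lift s to Finset E using hs
  lift t to Finset E using ht
  have h1 := (h.iIndep hp).indepFun_finset s t (by exact_mod_cast hst) (by fun_prop)
  rw [hA.repr, hB.repr]
  exact h1.measure_inter_preimage_eq_mul _ _ (Set.toFinite _).measurableSet
    (Set.toFinite _).measurableSet

theorem IsCyl.open_edge (h : IsCyl p μ) (e : E) : μ {ω | ω e = true} = p e := by
  have := h {e} (fun _ => true)
  simpa using this

theorem Dep.edge (e : E) (b : Bool) : Dep {ω : E → Bool | ω e = b} {e} := by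
  intro ω ω' hh hA
  have := hh e rfl
  simp_all

/-! ### BK -/

/-- open edges in `s` -/
def op (s : Finset E) (ω : E → Bool) : Finset E := s.filter (fun e => ω e = true)

/-- upward closed -/
def Up (A : Set (Finset E)) : Prop := ∀ I J : Finset E, I ⊆ J → I ∈ A → J ∈ A

/-- disjoint occurrence -/
def dj (A B : Set (Finset E)) : Set (Finset E) := {I | ∃ K, K ⊆ I ∧ K ∈ A ∧ I \ K ∈ B}

/-- section of an event -/
def sec (e : E) (A : Set (Finset E)) : Set (Finset E) := {I | insert e I ∈ A}

theorem Up.sec {A : Set (Finset E)} (h : Up A) (e : E) : Up (sec e A) :=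
  fun I J hIJ hI => h _ _ (Finset.insert_subset_insert e hIJ) hI

theorem Up.dj {A B : Set (Finset E)} (hB : Up B) : Up (dj A B) := by
  rintro I J hIJ ⟨K, hK, hKA, hKB⟩
  exact ⟨K, hK.trans hIJ, hKA, hB _ _ (Finset.sdiff_subset_sdiff hIJ (le_refl _)) hKB⟩

theorem dep_op (s : Finset E) (A : Set (Finset E)) : Dep {ω | op s ω ∈ A} (s : Set E) := by
  intro ω ω' hh hA
  have : op s ω = op s ω' := by
    unfold op
    apply Finset.filter_congr
    intro e he
    rw [hh e he]
  simpa [this] using hA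

theorem op_insert_true {s : Finset E} {e : E} {ω : E → Bool} (hω : ω e = true) :
    op (insert e s) ω = insert e (op s ω) := by
  simp [op, Finset.filter_insert, hω]

theorem op_insert_false {s : Finset E} {e : E} {ω : E → Bool} (hω : ω e = false) :
    op (insert e s) ω = op s ω := by
  simp [op, Finset.filter_insert, hω]

theorem IsCyl.split (h : IsCyl p μ) (hp : ∀ e, p e ≤ 1) {s : Finset E} {e : E} (he : e ∉ s)
    (A : Set (Finset E)) :
    μ.real {ω | op (insert e s) ω ∈ A} =
      (1 - (p e).toReal) * μ.real {ω | op s ω ∈ A} +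
        (p e).toReal * μ.real {ω | op s ω ∈ sec e A} := by
  haveI := h.prob
  have h1 : {ω : E → Bool | op (insert e s) ω ∈ A} =
      ({ω | ω e = true} ∩ {ω | op s ω ∈ sec e A}) ∪ ({ω | ω e = true}ᶜ ∩ {ω | op s ω ∈ A}) := by
    ext ω
    by_cases hω : ω e = true
    · simp [op_insert_true hω, hω, sec]
    · have hω' : ω e = false := by simpa using hω
      simp [op_insert_false hω', hω']
  have hd : Disjoint ({e} : Set E) (s : Set E) := by simpa using he
  have i1 := h.indep hp (Dep.edge e true) (dep_op s (sec e A)) (Set.finite_singleton e)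
    s.finite_toSet hd
  have i2 := h.indep hp (Dep.edge e true).compl (dep_op s A) (Set.finite_singleton e)
    s.finite_toSet hd
  have m1 : MeasurableSet {ω : E → Bool | ω e = true} :=
    (Dep.edge e true).meas (Set.finite_singleton e)
  rw [h1, measureReal_union]
  · simp only [measureReal_def, i1, i2, ENNReal.toReal_mul, h.open_edge]
    rw [prob_compl_eq_one_sub m1, h.open_edge, ENNReal.toReal_sub_of_le (hp e) (by simp)]
    simp; ring
  · exact Set.disjoint_left.2 (fun ω h1 h2 => h2.1 h1.1)
  · exact m1.compl.inter ((dep_op s A).meas s.finite_toSet)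

theorem IsCyl.bk (h : IsCyl p μ) (hp : ∀ e, p e ≤ 1) (s : Finset E) :
    ∀ (A B : Set (Finset E)), Up A → Up B →
    μ.real {ω | op s ω ∈ dj A B} ≤ μ.real {ω | op s ω ∈ A} * μ.real {ω | op s ω ∈ B} := by
  haveI := h.prob
  induction s using Finset.induction_on with
  | empty =>
    intro A B hA hB
    classical
    have : ∀ A : Set (Finset E), μ.real {ω | op ∅ ω ∈ A} = if ∅ ∈ A then 1 else 0 := by
      intro A
      by_cases hh : ∅ ∈ A <;> simp [op, hh]
    rw [this, this, this]
    by_cases h1 : (∅ : Finset E) ∈ dj A B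
    · obtain ⟨K, hK, hKA, hKB⟩ := h1
      have : K = ∅ := Finset.subset_empty.1 hK
      subst this
      have : (∅ : Finset E) ∈ B := by simpa using hKB
      simp [hKA, this]
      split_ifs <;> norm_num
    · simp only [h1, if_false]; split_ifs <;> norm_num
  | insert e s he ih =>
    intro A B hA hB
    rw [h.split hp he, h.split hp he, h.split hp he]
    have x00 := ih A B hA hB
    have x10 := ih (sec e A) B (hA.sec e) hB
    have x01 := ih A (sec e B) hA (hB.sec e)
    have x11 := ih (sec e A) (sec e B) (hA.sec e) (hB.sec e)
    set q := (p e).toReal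
    have hq0 : 0 ≤ q := ENNReal.toReal_nonneg
    have hq1 : q ≤ 1 := ENNReal.toReal_le_of_le_ofReal (by norm_num) (by simpa using hp e)
    have enot : ∀ ω : E → Bool, e ∉ op s ω := fun ω hω => he (Finset.mem_of_mem_filter e hω)
    have y1 : μ.real {ω | op s ω ∈ sec e (dj A B)} + μ.real {ω | op s ω ∈ dj A B} ≤
        μ.real {ω | op s ω ∈ dj (sec e A) B} + μ.real {ω | op s ω ∈ dj A (sec e B)} := by
      rw [← measureReal_union_add_inter
        (s := {ω | op s ω ∈ dj (sec e A) B}) ((dep_op s (dj A (sec e B))).meas s.finite_toSet)]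
      apply add_le_add
      · refine measureReal_mono ?_
        rintro ω ⟨K, hK, hKA, hKB⟩
        by_cases heK : e ∈ K
        · left
          refine ⟨K.erase e, ?_, ?_, ?_⟩
          · intro a ha
            rw [Finset.mem_erase] at ha
            exact (Finset.mem_insert.1 (hK ha.2)).resolve_left ha.1
          · simpa [sec, Finset.insert_erase heK] using hKA
          · convert hKB using 1
            ext a
            have := enot ω
            by_cases hae : a = e
            · subst hae; simp [heK, this]
            · simp [hae]
        · right
          refine ⟨K, ?_, hKA, ?_⟩
          · intro a ha
            exact (Finset.mem_insert.1 (hK ha)).resolve_left (fun h => heK (h ▸ ha))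
          · simp only [sec, Set.mem_setOf_eq]
            convert hKB using 1
            rw [Finset.insert_sdiff_of_notMem _ heK]
      · refine measureReal_mono ?_
        rintro ω ⟨K, hK, hKA, hKB⟩
        exact ⟨⟨K, hK, hA _ _ (Finset.subset_insert _ _) hKA, hKB⟩,
          ⟨K, hK, hKA, hB _ _ (Finset.subset_insert _ _) hKB⟩⟩
    have y2 : μ.real {ω | op s ω ∈ sec e (dj A B)} ≤
        μ.real {ω | op s ω ∈ dj (sec e A) (sec e B)} := by
      refine measureReal_mono ?_
      rintro ω ⟨K, hK, hKA, hKB⟩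
      refine ⟨K.erase e, ?_, ?_, ?_⟩
      · intro a ha
        rw [Finset.mem_erase] at ha
        exact (Finset.mem_insert.1 (hK ha.2)).resolve_left ha.1
      · refine hA _ _ ?_ hKA
        intro a ha
        by_cases hae : a = e <;> simp [hae, ha]
      · refine hB _ _ ?_ hKB
        intro a ha
        by_cases hae : a = e
        · simp [hae]
        · simp only [Finset.mem_sdiff, Finset.mem_insert, hae, false_or, Finset.mem_erase] at ha ⊢
          exact ⟨ha.1, fun h => ha.2 h.2⟩
    set a0 := μ.real {ω | op s ω ∈ A}
    set a1 := μ.real {ω | op s ω ∈ sec e A}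
    set b0 := μ.real {ω | op s ω ∈ B}
    set b1 := μ.real {ω | op s ω ∈ sec e B}
    set m0 := μ.real {ω | op s ω ∈ dj A B}
    set m1 := μ.real {ω | op s ω ∈ sec e (dj A B)}
    have z1 : m1 ≤ (1 - q) * (a1 * b0 + a0 * b1 - m0) + q * (a1 * b1) := by
      have t1 : m1 ≤ a1 * b0 + a0 * b1 - m0 := by linarith
      have t2 : m1 ≤ a1 * b1 := y2.trans x11
      nlinarith
    have z2 : q * m1 ≤ q * ((1 - q) * (a1 * b0 + a0 * b1 - m0) + q * (a1 * b1)) :=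
      mul_le_mul_of_nonneg_left z1 hq0
    have z3 : (1 - q) ^ 2 * m0 ≤ (1 - q) ^ 2 * (a0 * b0) :=
      mul_le_mul_of_nonneg_left x00 (sq_nonneg _)
    nlinarith

/-- `k`-fold disjoint occurrence -/
def djn (A : Set (Finset E)) : ℕ → Set (Finset E)
  | 0 => Set.univ
  | k + 1 => dj A (djn A k)

theorem Up.djn {A : Set (Finset E)} (k : ℕ) : Up (djn A k) := by
  induction k with
  | zero => intro I J _ _; exact Set.mem_univ _
  | succ k ih => exact Up.dj ih

theorem IsCyl.bkn (h : IsCyl p μ) (hp : ∀ e, p e ≤ 1) (s : Finset E) (A : Set (Finset E))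
    (hA : Up A) (k : ℕ) :
    μ.real {ω | op s ω ∈ djn A k} ≤ μ.real {ω | op s ω ∈ A} ^ k := by
  haveI := h.prob
  induction k with
  | zero => simp [djn]
  | succ k ih =>
    calc _ ≤ μ.real {ω | op s ω ∈ A} * μ.real {ω | op s ω ∈ djn A k} :=
          h.bk hp s A (djn A k) hA (Up.djn k)
      _ ≤ _ := by
          rw [pow_succ']
          exact mul_le_mul_of_nonneg_left ih measureReal_nonneg

theorem djn_add {A : Set (Finset E)} : ∀ (k l : ℕ) (I J : Finset E), Disjoint I J →
    I ∈ djn A k → J ∈ djn A l → I ∪ J ∈ djn A (k + l) := by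
  intro k
  induction k with
  | zero =>
    intro l I J _ _ hJ
    rw [zero_add]
    exact Up.djn l _ _ Finset.subset_union_right hJ
  | succ k ih =>
    rintro l I J hd ⟨K, hK, hKA, hKB⟩ hJ
    have := ih l (I \ K) J (Finset.disjoint_of_subset_left Finset.sdiff_subset hd) hKB hJ
    rw [show k + 1 + l = (k + l) + 1 by ring]
    refine ⟨K, hK.trans Finset.subset_union_left, hKA, Up.djn _ _ _ ?_ this⟩
    intro a ha
    simp only [Finset.mem_union, Finset.mem_sdiff] at ha ⊢
    rcases ha with ha | ha
    · exact ⟨Or.inl ha.1, ha.2⟩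
    · exact ⟨Or.inr ha, fun hh => Finset.disjoint_left.1 hd (hK hh) ha⟩

end prob
end LRP

open MeasureTheory ENNReal
namespace LRP

theorem rtg_mono {X : Type} {r r' : X → X → Prop} {x y : X} (h : Relation.ReflTransGen r x y)
    (hr : ∀ a b, r a b → r' a b) : Relation.ReflTransGen r' x y := by
  induction h with
  | refl => exact Relation.ReflTransGen.refl
  | tail _ hab ih => exact ih.tail (hr _ _ hab)

section basics
variable {d : ℕ} {p : Sym2 (V d) → ℝ≥0∞} {μ : Measure (Config d)}

/-- edges between `A` and `B` -/
def ed (A B : Finset (V d)) : Finset (Sym2 (V d)) := (A ×ˢ B).image (fun q => s(q.1, q.2))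

theorem mem_ed {A B : Finset (V d)} {e : Sym2 (V d)} :
    e ∈ ed A B ↔ ∃ u ∈ A, ∃ v ∈ B, e = s(u, v) := by
  simp only [ed, Finset.mem_image, Finset.mem_product, Prod.exists]
  constructor
  · rintro ⟨u, v, ⟨hu, hv⟩, rfl⟩; exact ⟨u, hu, v, hv, rfl⟩
  · rintro ⟨u, hu, v, hv, rfl⟩; exact ⟨u, v, ⟨hu, hv⟩, rfl⟩

theorem mem_ed_of {A B : Finset (V d)} {u v : V d} (hu : u ∈ A) (hv : v ∈ B) :
    s(u, v) ∈ ed A B := mem_ed.2 ⟨u, hu, v, hv, rfl⟩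

theorem mem_ed_self {A : Finset (V d)} {u v : V d} : s(u, v) ∈ ed A A ↔ u ∈ A ∧ v ∈ A := by
  rw [mem_ed]
  constructor
  · rintro ⟨a, ha, b, hb, hh⟩
    rw [Sym2.eq_iff] at hh
    rcases hh with ⟨rfl, rfl⟩ | ⟨rfl, rfl⟩
    · exact ⟨ha, hb⟩
    · exact ⟨hb, ha⟩
  · rintro ⟨hu, hv⟩; exact ⟨u, hu, v, hv, rfl⟩

theorem adj_symm {ω : Config d} {x y : V d} (h : adj ω x y) : adj ω y x :=
  ⟨h.1.symm, by rw [Sym2.eq_swap]; exact h.2⟩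

theorem connIn_refl {ω : Config d} {A : Set (V d)} {x : V d} (hx : x ∈ A) : connIn ω A x x :=
  ⟨hx, hx, Relation.ReflTransGen.refl⟩

theorem connIn_symm {ω : Config d} {A : Set (V d)} {x y : V d} (h : connIn ω A x y) :
    connIn ω A y x := by
  refine ⟨h.2.1, h.1, ?_⟩
  have := Relation.reflTransGen_swap.2 h.2.2
  refine rtg_mono this ?_
  rintro a b ⟨h1, h2, h3⟩
  exact ⟨h2, h1, adj_symm h3⟩

theorem connIn_trans {ω : Config d} {A : Set (V d)} {x y z : V d} (h : connIn ω A x y)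
    (h' : connIn ω A y z) : connIn ω A x z :=
  ⟨h.1, h'.2.1, h.2.2.trans h'.2.2⟩

theorem connIn_mono {ω : Config d} {A B : Set (V d)} (hAB : A ⊆ B) {x y : V d}
    (h : connIn ω A x y) : connIn ω B x y :=
  ⟨hAB h.1, hAB h.2.1, rtg_mono h.2.2 fun _ _ hh => ⟨hAB hh.1, hAB hh.2.1, hh.2.2⟩⟩

theorem connIn_adj {ω : Config d} {A : Set (V d)} {x y : V d} (hx : x ∈ A) (hy : y ∈ A)
    (h : adj ω x y) : connIn ω A x y :=
  ⟨hx, hy, Relation.ReflTransGen.single ⟨hx, hy, h⟩⟩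

theorem connIn_conn {ω : Config d} {A : Set (V d)} {x y : V d} (h : connIn ω A x y) :
    conn ω x y := rtg_mono h.2.2 fun _ _ hh => hh.2.2

theorem connIn_congr {ω ω' : Config d} {A : Finset (V d)} (hh : ∀ e ∈ ed A A, ω e = ω' e)
    {x y : V d} (h : connIn ω A x y) : connIn ω' A x y := by
  refine ⟨h.1, h.2.1, rtg_mono h.2.2 ?_⟩
  rintro a b ⟨ha, hb, hab⟩
  exact ⟨ha, hb, hab.1, by rw [← hh _ (mem_ed_of (by simpa using ha) (by simpa using hb))]; exact hab.2⟩

theorem dep_connIn (A : Finset (V d)) (x y : V d) :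
    Dep {ω : Config d | connIn ω A x y} (ed A A : Set (Sym2 (V d))) :=
  fun _ _ hh h => connIn_congr (fun e he => hh e he) h

theorem meas_connIn (A : Finset (V d)) (x y : V d) :
    MeasurableSet {ω : Config d | connIn ω A x y} :=
  (dep_connIn A x y).meas (Finset.finite_toSet _)

/-- in-set two-point function -/
noncomputable def tau (μ : Measure (Config d)) (D : Finset (V d)) (x y : V d) : ℝ :=
  μ.real {ω | connIn ω (D : Set (V d)) x y}

theorem tau_nonneg {D : Finset (V d)} {x y : V d} : 0 ≤ tau μ D x y := measureReal_nonneg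

theorem tau_le_one [IsProbabilityMeasure μ] {D : Finset (V d)} {x y : V d} : tau μ D x y ≤ 1 :=
  measureReal_le_one

theorem tau_mono [IsProbabilityMeasure μ] {D D' : Finset (V d)} (hD : D ⊆ D') {x y : V d} :
    tau μ D x y ≤ tau μ D' x y :=
  measureReal_mono (fun _ h => connIn_mono (by exact_mod_cast hD) h)

theorem tau_symm {D : Finset (V d)} (x y : V d) : tau μ D x y = tau μ D y x := by
  unfold tau
  congr 1
  ext ω
  exact ⟨connIn_symm, connIn_symm⟩

theorem tau_eq_zero_left {D : Finset (V d)} {x y : V d} (hx : x ∉ D) : tau μ D x y = 0 := by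
  have : {ω : Config d | connIn ω (D : Set (V d)) x y} = ∅ := by
    ext ω
    simp only [Set.mem_setOf_eq, Set.mem_empty_iff_false, iff_false]
    intro hh; exact hx (by simpa using hh.1)
  simp [tau, this]

theorem tau_eq_zero_right {D : Finset (V d)} {x y : V d} (hy : y ∉ D) : tau μ D x y = 0 := by
  rw [tau_symm]; exact tau_eq_zero_left hy

theorem tau_self [IsProbabilityMeasure μ] {D : Finset (V d)} {x : V d} (hx : x ∈ D) :
    tau μ D x x = 1 := by
  have : {ω : Config d | connIn ω (D : Set (V d)) x x} = Set.univ := by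
    ext ω
    simp only [Set.mem_setOf_eq, Set.mem_univ, iff_true]
    exact connIn_refl (by simpa using hx)
  simp [tau, this]

open Classical in
/-- the cluster of `z` inside `T` -/
noncomputable def cl (ω : Config d) (T : Finset (V d)) (z : V d) : Finset (V d) :=
  T.filter (fun y => connIn ω T z y)

theorem mem_cl {ω : Config d} {T : Finset (V d)} {z y : V d} :
    y ∈ cl ω T z ↔ connIn ω T z y := by
  simp only [cl, Finset.mem_filter]
  exact ⟨fun h => h.2, fun h => ⟨by simpa using h.2.1, h⟩⟩

theorem cl_subset {ω : Config d} {T : Finset (V d)} {z : V d} : cl ω T z ⊆ T :=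
  fun y hy => by simpa using (mem_cl.1 hy).2.1

theorem dep_cl (T C : Finset (V d)) (z : V d) :
    Dep {ω : Config d | cl ω T z = C} (ed C T : Set (Sym2 (V d))) := by
  intro ω ω' hh hC
  simp only [Set.mem_setOf_eq] at hC ⊢
  by_cases hz : z ∈ T
  swap
  · rw [← hC]
    have : ∀ ω : Config d, cl ω T z = ∅ := by
      intro ω
      ext y; simp only [mem_cl, Finset.notMem_empty, iff_false]
      intro h; exact hz (by simpa using h.1)
    rw [this, this]
  have hC' : ∀ y, y ∈ C ↔ connIn ω T z y := fun y => by rw [← hC, mem_cl]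
  ext y
  rw [mem_cl]
  constructor
  · rintro ⟨h1, h2, h3⟩
    clear h2
    induction h3 with
    | refl => rw [hC']; exact connIn_refl h1
    | tail _ hab ih =>
      rename_i a b _
      have ha := ih
      rw [hC'] at ih ⊢
      refine connIn_trans ih (connIn_adj hab.1 hab.2.1 ⟨hab.2.2.1, ?_⟩)
      rw [hh _ (mem_ed_of ha (by simpa using hab.2.1))]
      exact hab.2.2.2
  · intro hy
    rw [hC'] at hy
    obtain ⟨h1, h2, h3⟩ := hy
    clear h2
    induction h3 with
    | refl => exact connIn_refl h1
    | tail hza hab ih =>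
      rename_i a b
      refine connIn_trans ih (connIn_adj hab.1 hab.2.1 ⟨hab.2.2.1, ?_⟩)
      rw [← hh _ (mem_ed_of ((hC' a).2 ⟨h1, hab.1, hza⟩) (by simpa using hab.2.1))]
      exact hab.2.2.2

theorem last_exit {X : Type} {r : X → X → Prop} {C : Set X} {z x : X}
    (h : Relation.ReflTransGen r z x) (hz : z ∈ C) (hx : x ∉ C) :
    ∃ a ∈ C, ∃ b, b ∉ C ∧ r a b ∧
      Relation.ReflTransGen (fun u v => u ∉ C ∧ v ∉ C ∧ r u v) b x := by
  induction h with
  | refl => exact absurd hz hx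
  | tail hzy hyw ih =>
    rename_i y w
    by_cases hy : y ∈ C
    · exact ⟨y, hy, w, hx, hyw, Relation.ReflTransGen.refl⟩
    · obtain ⟨a, ha, b, hb, hab, hby⟩ := ih hy
      exact ⟨a, ha, b, hb, hab, hby.tail ⟨hy, hx, hyw⟩⟩

theorem exit_ineq (h : IsCyl p μ) (hp : ∀ e, p e ≤ 1) (D S : Finset (V d)) {z : V d} (hz : z ∈ S)
    (x : V d) :
    tau μ D z x ≤ tau μ S z x +
      ∑ a ∈ S, ∑ b ∈ D \ S, tau μ S z a * (p s(a, b)).toReal * tau μ D b x := by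
  haveI := h.prob
  by_cases hzD : z ∈ D
  swap
  · rw [tau_eq_zero_left hzD]
    refine add_nonneg tau_nonneg (Finset.sum_nonneg fun a _ => Finset.sum_nonneg fun b _ => ?_)
    exact mul_nonneg (mul_nonneg tau_nonneg ENNReal.toReal_nonneg) tau_nonneg
  classical
  set T := S ∩ D with hT
  have hzT : z ∈ T := Finset.mem_inter.2 ⟨hz, hzD⟩
  have hsub : {ω : Config d | connIn ω (D : Set (V d)) z x} ⊆
      {ω | connIn ω (S : Set (V d)) z x} ∪ ⋃ C ∈ T.powerset, ⋃ a ∈ C, ⋃ b ∈ D \ S,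
        ({ω | cl ω T z = C} ∩ ({ω | ω s(a, b) = true} ∩
          {ω | connIn ω ((D \ C : Finset (V d)) : Set (V d)) b x})) := by
    intro ω hω
    by_cases hSx : connIn ω (S : Set (V d)) z x
    · exact Or.inl hSx
    right
    simp only [Set.mem_iUnion, Set.mem_inter_iff, Set.mem_setOf_eq]
    obtain ⟨_, hxD, hpath⟩ := hω
    have hx : x ∉ ((cl ω T z : Finset (V d)) : Set (V d)) := by
      intro hx
      rw [Finset.mem_coe, mem_cl] at hx
      exact hSx (connIn_mono (by simp [hT]) hx)
    have hz' : z ∈ ((cl ω T z : Finset (V d)) : Set (V d)) := by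
      rw [Finset.mem_coe, mem_cl]; exact connIn_refl (by simpa using hzT)
    obtain ⟨a, ha, b, hb, hab, hbx⟩ := last_exit hpath hz' hx
    have ha' : connIn ω T z a := mem_cl.1 (by simpa using ha)
    have hbS : b ∉ S := by
      intro hbS
      apply hb
      rw [Finset.mem_coe, mem_cl]
      have hbT : b ∈ T := Finset.mem_inter.2 ⟨hbS, by simpa using hab.2.1⟩
      exact connIn_trans ha' (connIn_adj ha'.2.1 (by simpa using hbT) hab.2.2)
    refine ⟨cl ω T z, Finset.mem_powerset.2 cl_subset, a, by simpa using ha, b,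
      Finset.mem_sdiff.2 ⟨by simpa using hab.2.1, hbS⟩, rfl, hab.2.2.2, ?_⟩
    refine ⟨?_, ?_, rtg_mono hbx ?_⟩
    · simp only [Finset.coe_sdiff, Set.mem_sdiff]; exact ⟨hab.2.1, hb⟩
    · simp only [Finset.coe_sdiff, Set.mem_sdiff]; exact ⟨hxD, hx⟩
    · rintro u v ⟨hu, hv, huv⟩
      simp only [Finset.coe_sdiff, Set.mem_sdiff]
      exact ⟨⟨huv.1, hu⟩, ⟨huv.2.1, hv⟩, huv.2.2⟩
  have hind : ∀ C ∈ T.powerset, ∀ a ∈ C, ∀ b ∈ D \ S,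
      μ.real ({ω | cl ω T z = C} ∩ ({ω | ω s(a, b) = true} ∩
          {ω | connIn ω ((D \ C : Finset (V d)) : Set (V d)) b x})) ≤
        μ.real {ω | cl ω T z = C} * ((p s(a, b)).toReal * tau μ D b x) := by
    intro C hC a ha b hb
    have hCT := Finset.mem_powerset.1 hC
    have hbS := (Finset.mem_sdiff.1 hb).2
    have hCS : C ⊆ S := hCT.trans Finset.inter_subset_left
    have d1 : Disjoint ({s(a, b)} : Set (Sym2 (V d))) (ed (D \ C) (D \ C) : Set (Sym2 (V d))) := by
      rw [Set.disjoint_singleton_left, Finset.mem_coe, mem_ed_self]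
      rintro ⟨h1, _⟩
      exact (Finset.mem_sdiff.1 h1).2 ha
    have d2 : Disjoint (ed C T : Set (Sym2 (V d)))
        ({s(a, b)} ∪ (ed (D \ C) (D \ C) : Set (Sym2 (V d)))) := by
      rw [Set.disjoint_left]
      intro e he he'
      rw [Finset.mem_coe, mem_ed] at he
      obtain ⟨u, hu, v, hv, rfl⟩ := he
      rcases he' with he' | he'
      · rw [Set.mem_singleton_iff, Sym2.eq_iff] at he'
        rcases he' with ⟨rfl, rfl⟩ | ⟨rfl, rfl⟩
        · exact hbS (Finset.mem_inter.1 hv).1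
        · exact hbS (hCS hu)
      · rw [Finset.mem_coe, mem_ed_self] at he'
        exact (Finset.mem_sdiff.1 he'.1).2 hu
    have i1 := h.indep hp (Dep.edge s(a, b) true) (dep_connIn (D \ C) b x)
      (Set.finite_singleton _) (Finset.finite_toSet _) d1
    have i2 := h.indep hp (dep_cl T C z)
      ((Dep.edge s(a, b) true).inter (dep_connIn (D \ C) b x)) (Finset.finite_toSet _)
      ((Set.finite_singleton _).union (Finset.finite_toSet _)) d2
    rw [measureReal_def, i2, i1, ENNReal.toReal_mul, ENNReal.toReal_mul, h.open_edge]
    refine mul_le_mul_of_nonneg_left (mul_le_mul_of_nonneg_left ?_ ENNReal.toReal_nonneg)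
      ENNReal.toReal_nonneg
    exact tau_mono (μ := μ) Finset.sdiff_subset
  have hsum : ∀ a ∈ S, ∑ C ∈ T.powerset, (if a ∈ C then μ.real {ω | cl ω T z = C} else 0) ≤
      tau μ S z a := by
    intro a _
    rw [← Finset.sum_filter, ← measureReal_biUnion_finset]
    · refine measureReal_mono ?_
      intro ω hω
      simp only [Set.mem_iUnion, Finset.mem_filter, Set.mem_setOf_eq] at hω
      obtain ⟨C, ⟨_, haC⟩, rfl⟩ := hω
      exact connIn_mono (by simp [hT]) (mem_cl.1 haC)
    · intro C _ C' _ hne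
      rw [Function.onFun, Set.disjoint_left]
      intro ω h1 h2
      exact hne (h1.symm.trans h2)
    · intro C _
      exact (dep_cl T C z).meas (Finset.finite_toSet _)
  calc tau μ D z x ≤ μ.real ({ω | connIn ω (S : Set (V d)) z x} ∪
        ⋃ C ∈ T.powerset, ⋃ a ∈ C, ⋃ b ∈ D \ S,
        ({ω | cl ω T z = C} ∩ ({ω | ω s(a, b) = true} ∩
          {ω | connIn ω ((D \ C : Finset (V d)) : Set (V d)) b x}))) := measureReal_mono hsub
    _ ≤ tau μ S z x + ∑ C ∈ T.powerset, ∑ a ∈ C, ∑ b ∈ D \ S,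
        μ.real {ω | cl ω T z = C} * ((p s(a, b)).toReal * tau μ D b x) := by
      refine (measureReal_union_le _ _).trans (add_le_add le_rfl ?_)
      refine (measureReal_biUnion_finset_le _ _).trans (Finset.sum_le_sum fun C hC => ?_)
      refine (measureReal_biUnion_finset_le _ _).trans (Finset.sum_le_sum fun a ha => ?_)
      refine (measureReal_biUnion_finset_le _ _).trans (Finset.sum_le_sum fun b hb => ?_)
      exact hind C hC a ha b hb
    _ = tau μ S z x + ∑ a ∈ S, ∑ b ∈ D \ S,
        (∑ C ∈ T.powerset, (if a ∈ C then μ.real {ω | cl ω T z = C} else 0)) *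
          ((p s(a, b)).toReal * tau μ D b x) := by
      congr 1
      have : ∀ C ∈ T.powerset, ∑ a ∈ C, ∑ b ∈ D \ S,
          μ.real {ω | cl ω T z = C} * ((p s(a, b)).toReal * tau μ D b x) =
          ∑ a ∈ S, ∑ b ∈ D \ S, (if a ∈ C then μ.real {ω | cl ω T z = C} else 0) *
            ((p s(a, b)).toReal * tau μ D b x) := by
        intro C hC
        have hCS : C ⊆ S := (Finset.mem_powerset.1 hC).trans Finset.inter_subset_left
        rw [← Finset.sum_subset hCS]
        · refine Finset.sum_congr rfl fun a ha => ?_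
          simp [ha]
        · intro a _ ha
          simp [ha]
      rw [Finset.sum_congr rfl this, Finset.sum_comm]
      refine Finset.sum_congr rfl fun a _ => ?_
      rw [Finset.sum_comm]
      refine Finset.sum_congr rfl fun b _ => ?_
      rw [Finset.sum_mul]
    _ ≤ _ := by
      refine add_le_add le_rfl (Finset.sum_le_sum fun a ha => Finset.sum_le_sum fun b _ => ?_)
      rw [mul_assoc]
      exact mul_le_mul_of_nonneg_right (hsum a ha)
        (mul_nonneg ENNReal.toReal_nonneg tau_nonneg)

end basics
end LRP

open MeasureTheory ENNReal
namespace LRP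

section trees
variable {d : ℕ} {p : Sym2 (V d) → ℝ≥0∞} {μ : Measure (Config d)}

/-- rooted trees -/
inductive Tr : V d → Finset (V d) → Finset (Sym2 (V d)) → Prop
  | single (v : V d) : Tr v {v} ∅
  | join {v c : V d} {A B : Finset (V d)} {F G : Finset (Sym2 (V d))} :
      Tr v A F → Tr c B G → Disjoint A B → Tr v (A ∪ B) (insert s(v, c) (F ∪ G))

theorem Tr.root {v : V d} {A F} (h : Tr v A F) : v ∈ A := by
  induction h with
  | single v => simp
  | join _ _ _ ih _ => exact Finset.mem_union_left _ ih

theorem Tr.edges {v : V d} {A F} (h : Tr v A F) : F ⊆ ed A A := by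
  induction h with
  | single v => simp
  | join h1 h2 hd ih1 ih2 =>
    rename_i v c A B F G
    intro e he
    rw [Finset.mem_insert, Finset.mem_union] at he
    rcases he with rfl | he | he
    · exact mem_ed_of (Finset.mem_union_left _ h1.root) (Finset.mem_union_right _ h2.root)
    · obtain ⟨u, hu, w, hw, rfl⟩ := mem_ed.1 (ih1 he)
      exact mem_ed_of (Finset.mem_union_left _ hu) (Finset.mem_union_left _ hw)
    · obtain ⟨u, hu, w, hw, rfl⟩ := mem_ed.1 (ih2 he)
      exact mem_ed_of (Finset.mem_union_right _ hu) (Finset.mem_union_right _ hw)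

theorem ed_disjoint {A B : Finset (V d)} (h : Disjoint A B) : Disjoint (ed A A) (ed B B) := by
  rw [Finset.disjoint_left]
  intro e he he'
  obtain ⟨u, hu, w, hw, rfl⟩ := mem_ed.1 he
  exact Finset.disjoint_left.1 h hu (mem_ed_self.1 he').1

theorem Tr.leaf {v : V d} {A F} (h : Tr v A F) {a b : V d} (ha : a ∈ A) (hb : b ∉ A) :
    Tr v (insert b A) (insert s(a, b) F) := by
  induction h with
  | single v =>
    have := Finset.mem_singleton.1 ha
    subst this
    have := Tr.join (Tr.single a) (Tr.single b) (by simpa [eq_comm] using hb)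
    convert this using 1
    · ext u; simp [or_comm]
    · simp
  | join h1 h2 hd ih1 ih2 =>
    rename_i v c A B F G
    simp only [Finset.mem_union, not_or] at hb ha
    rcases ha with ha | ha
    · have := Tr.join (ih1 ha hb.1) h2 (Finset.disjoint_insert_left.2 ⟨hb.2, hd⟩)
      convert this using 1
      · ext u; simp only [Finset.mem_insert, Finset.mem_union]; tauto
      · ext u; simp only [Finset.mem_insert, Finset.mem_union]; tauto
    · have := Tr.join h1 (ih2 ha hb.2) (Finset.disjoint_insert_right.2 ⟨hb.1, hd⟩)
      convert this using 1
      · ext u; simp only [Finset.mem_insert, Finset.mem_union]; tauto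
      · ext u; simp only [Finset.mem_insert, Finset.mem_union]; tauto

/-- there is an open tree with more than `N` vertices -/
def bigT (N : ℕ) : Set (Finset (Sym2 (V d))) :=
  {I | ∃ (v : V d) (A : Finset (V d)) (F : Finset (Sym2 (V d))), Tr v A F ∧ F ⊆ I ∧ N + 1 ≤ A.card}

theorem up_bigT (N : ℕ) : Up (bigT (d := d) N) := by
  rintro I J hIJ ⟨v, A, F, h1, h2, h3⟩
  exact ⟨v, A, F, h1, h2.trans hIJ, h3⟩

theorem Tr.greedy {N : ℕ} (hN : 1 ≤ N) {v : V d} {A F} (h : Tr v A F) :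
    ∃ (k : ℕ) (I : Finset (Sym2 (V d))) (A' : Finset (V d)) (F' : Finset (Sym2 (V d))),
      I ⊆ F ∧ I ∈ djn (bigT N) k ∧ F' ⊆ F ∧ Disjoint I F' ∧ Tr v A' F' ∧ A'.card ≤ N ∧ A' ⊆ A ∧
      A.card ≤ 2 * N * k + A'.card := by
  induction h with
  | single v =>
    exact ⟨0, ∅, {v}, ∅, by simp, Set.mem_univ _, by simp, by simp, Tr.single v, by simpa using hN,
      le_rfl, by simp⟩
  | join h1 h2 hd ih1 ih2 =>
    rename_i v c A B F G
    obtain ⟨k1, I1, A1, F1, a1, a2, a3, a4, a5, a6, a7, a8⟩ := ih1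
    obtain ⟨k2, I2, A2, F2, b1, b2, b3, b4, b5, b6, b7, b8⟩ := ih2
    have hFG : Disjoint F G :=
      Finset.disjoint_of_subset_left h1.edges
        (Finset.disjoint_of_subset_right h2.edges (ed_disjoint hd))
    have hI : I1 ∪ I2 ∈ djn (bigT (d := d) N) (k1 + k2) :=
      djn_add k1 k2 I1 I2 (Finset.disjoint_of_subset_left a1
        (Finset.disjoint_of_subset_right b1 hFG)) a2 b2
    have hA12 : Disjoint A1 A2 := Finset.disjoint_of_subset_left a7
        (Finset.disjoint_of_subset_right b7 hd)
    have hT := Tr.join a5 b5 hA12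
    have hvF : s(v, c) ∉ F := fun hh =>
      Finset.disjoint_left.1 hd (mem_ed_self.1 (h1.edges hh)).2 h2.root
    have hvG : s(v, c) ∉ G := fun hh =>
      Finset.disjoint_left.1 hd h1.root (mem_ed_self.1 (h2.edges hh)).1
    have hdis : Disjoint (I1 ∪ I2) (insert s(v, c) (F1 ∪ F2)) := by
      rw [Finset.disjoint_left]
      intro e he he'
      rw [Finset.mem_union] at he
      rw [Finset.mem_insert, Finset.mem_union] at he'
      rcases he with he | he
      · rcases he' with rfl | he' | he'
        · exact hvF (a1 he)
        · exact Finset.disjoint_left.1 a4 he he'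
        · exact Finset.disjoint_left.1 hFG (a1 he) (b3 he')
      · rcases he' with rfl | he' | he'
        · exact hvG (b1 he)
        · exact Finset.disjoint_left.1 hFG (a3 he') (b1 he)
        · exact Finset.disjoint_left.1 b4 he he'
    have hcard : (A ∪ B).card ≤ 2 * N * (k1 + k2) + (A1.card + A2.card) := by
      rw [Finset.card_union_of_disjoint hd, mul_add]; omega
    have hc12 : (A1 ∪ A2).card = A1.card + A2.card := Finset.card_union_of_disjoint hA12
    have hIF : I1 ∪ I2 ⊆ insert s(v, c) (F ∪ G) :=
      (Finset.union_subset_union a1 b1).trans (Finset.subset_insert _ _)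
    have hTF : insert s(v, c) (F1 ∪ F2) ⊆ insert s(v, c) (F ∪ G) :=
      Finset.insert_subset_insert _ (Finset.union_subset_union a3 b3)
    by_cases hsz : A1.card + A2.card ≤ N
    · exact ⟨k1 + k2, I1 ∪ I2, A1 ∪ A2, insert s(v, c) (F1 ∪ F2), hIF, hI, hTF, hdis, hT,
        by omega, Finset.union_subset_union a7 b7, by omega⟩
    · have hone : insert s(v, c) (F1 ∪ F2) ∈ djn (bigT (d := d) N) 1 :=
        ⟨insert s(v, c) (F1 ∪ F2), le_rfl, ⟨v, _, _, hT, le_rfl, by omega⟩, Set.mem_univ _⟩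
      refine ⟨k1 + k2 + 1, (I1 ∪ I2) ∪ insert s(v, c) (F1 ∪ F2), {v}, ∅,
        Finset.union_subset hIF hTF, djn_add _ _ _ _ hdis hI hone, by simp, by simp, Tr.single v,
        by simpa using hN, ?_, ?_⟩
      · simpa using Or.inl h1.root
      · rw [mul_add (2 * N)]; omega

theorem Tr.count {N : ℕ} (hN : 1 ≤ N) {v : V d} {A F} (h : Tr v A F) (hA : N + 1 ≤ A.card) :
    ∃ k : ℕ, F ∈ djn (bigT N) k ∧ A.card ≤ 3 * N * k := by
  obtain ⟨k, I, A', F', h1, h2, h3, h4, h5, h6, h7, h8⟩ := h.greedy hN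
  refine ⟨k, Up.djn k _ _ h1 h2, ?_⟩
  have hk : 1 ≤ k := by
    rcases Nat.eq_zero_or_pos k with rfl | hk
    · simp at h8; omega
    · exact hk
  nlinarith

theorem Tr.conn {ω : Config d} {D : Finset (V d)} {v : V d} {A F} (h : Tr v A F)
    (hF : F ⊆ op (ed D D) ω) : A = {v} ∨ ∀ a ∈ A, connIn ω D v a := by
  induction h with
  | single v => left; rfl
  | join h1 h2 hd ih1 ih2 =>
    rename_i v c A B F G
    right
    have hvc := hF (Finset.mem_insert_self _ _)
    simp only [op, Finset.mem_filter, mem_ed_self] at hvc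
    have hvD : v ∈ (D : Set (V d)) := by simpa using hvc.1.1
    have hcD : c ∈ (D : Set (V d)) := by simpa using hvc.1.2
    have hne : v ≠ c := fun hh => Finset.disjoint_left.1 hd h1.root (hh ▸ h2.root)
    have hadj : connIn ω D v c := connIn_adj hvD hcD ⟨hne, hvc.2⟩
    have hFF : F ∪ G ⊆ op (ed D D) ω := (Finset.subset_insert _ _).trans hF
    have i1 := ih1 (Finset.subset_union_left.trans hFF)
    have i2 := ih2 (Finset.subset_union_right.trans hFF)
    intro a ha
    rw [Finset.mem_union] at ha
    rcases ha with ha | ha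
    · rcases i1 with i1 | i1
      · rw [i1, Finset.mem_singleton] at ha; subst ha; exact connIn_refl hvD
      · exact i1 a ha
    · rcases i2 with i2 | i2
      · rw [i2, Finset.mem_singleton] at ha; subst ha; exact hadj
      · exact connIn_trans hadj (i2 a ha)

theorem span_tree (ω : Config d) (D : Finset (V d)) {x : V d} (hx : x ∈ D) :
    ∃ F, F ⊆ op (ed D D) ω ∧ Tr x (cl ω D x) F := by
  have key : ∀ n : ℕ, ∃ A F, Tr x A F ∧ A ⊆ cl ω D x ∧ F ⊆ op (ed D D) ω ∧
      (n ≤ A.card ∨ A = cl ω D x) := by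
    intro n
    induction n with
    | zero =>
      refine ⟨{x}, ∅, Tr.single x, ?_, by simp, Or.inl (by simp)⟩
      rw [Finset.singleton_subset_iff, mem_cl]; exact connIn_refl (by simpa using hx)
    | succ n ih =>
      obtain ⟨A, F, h1, h2, h3, h4⟩ := ih
      by_cases hA : A = cl ω D x
      · exact ⟨A, F, h1, h2, h3, Or.inr hA⟩
      obtain ⟨y, hy, hyA⟩ : ∃ y ∈ cl ω D x, y ∉ A := by
        by_contra hcon
        push Not at hcon
        exact hA (Finset.Subset.antisymm h2 hcon)
      obtain ⟨a, ha, b, hb, hab, _⟩ := last_exit (C := (A : Set (V d))) (mem_cl.1 hy).2.2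
        (by simpa using h1.root) (by simpa using hyA)
      have ha' : a ∈ A := by simpa using ha
      have hb' : b ∉ A := by simpa using hb
      refine ⟨insert b A, insert s(a, b) F, h1.leaf ha' hb', ?_, ?_, Or.inl ?_⟩
      · refine Finset.insert_subset ?_ h2
        rw [mem_cl]
        exact connIn_trans (mem_cl.1 (h2 ha')) (connIn_adj hab.1 hab.2.1 hab.2.2)
      · refine Finset.insert_subset ?_ h3
        simp only [op, Finset.mem_filter, mem_ed_self]
        exact ⟨⟨by simpa using hab.1, by simpa using hab.2.1⟩, hab.2.2.2⟩
      · rw [Finset.card_insert_of_notMem hb']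
        have := h4.resolve_right hA
        omega
  obtain ⟨A, F, h1, h2, h3, h4⟩ := key ((cl ω D x).card + 1)
  have hA : A = cl ω D x := by
    refine h4.resolve_left fun hh => ?_
    have := Finset.card_le_card h2
    omega
  exact ⟨F, h3, hA ▸ h1⟩

/-- there is a cluster of size at least `m` in `D` -/
def Good (D : Finset (V d)) (m : ℝ) (ω : Config d) : Prop :=
  ∃ x ∈ D, m ≤ ((cl ω D x).card : ℝ)

theorem bigT_good {N : ℕ} (hN : 1 ≤ N) {ω : Config d} {D : Finset (V d)}
    (h : op (ed D D) ω ∈ bigT N) : Good D ((N : ℝ) + 1) ω := by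
  obtain ⟨v, A, F, h1, h2, h3⟩ := h
  rcases h1.conn h2 with hA | hA
  · rw [hA, Finset.card_singleton] at h3; omega
  · have hv := (hA v h1.root).1
    refine ⟨v, by simpa using hv, ?_⟩
    have : A ⊆ cl ω D v := fun a ha => mem_cl.2 (hA a ha)
    have := Finset.card_le_card this
    exact_mod_cast h3.trans this

theorem cl_eq {ω : Config d} {D : Finset (V d)} {x y : V d} (h : connIn ω D x y) :
    cl ω D x = cl ω D y := by
  ext z; rw [mem_cl, mem_cl]
  exact ⟨fun hh => connIn_trans (connIn_symm h) hh, fun hh => connIn_trans h hh⟩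

open Classical in
/-- number of vertices in big clusters -/
noncomputable def bigW (N : ℕ) (D : Finset (V d)) (ω : Config d) : Finset (V d) :=
  D.filter (fun x => N + 1 ≤ (cl ω D x).card)

theorem bigW_le {N : ℕ} (hN : 1 ≤ N) (ω : Config d) (D : Finset (V d)) :
    ∃ k : ℕ, op (ed D D) ω ∈ djn (bigT N) k ∧ (bigW N D ω).card ≤ 3 * N * k := by
  classical
  set 𝒦 := D.image (cl ω D) with h𝒦
  have hdisj : ∀ K ∈ 𝒦, ∀ K' ∈ 𝒦, K ≠ K' → Disjoint K K' := by
    intro K hK K' hK' hne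
    obtain ⟨x, _, rfl⟩ := Finset.mem_image.1 hK
    obtain ⟨x', _, rfl⟩ := Finset.mem_image.1 hK'
    rw [Finset.disjoint_left]
    intro z hz hz'
    exact hne ((cl_eq (mem_cl.1 hz)).trans (cl_eq (mem_cl.1 hz')).symm)
  have key : ∀ 𝒰 : Finset (Finset (V d)), 𝒰 ⊆ 𝒦 → ∃ (k : ℕ) (I : Finset (Sym2 (V d))),
      I ⊆ op (ed D D) ω ∧ I ∈ djn (bigT N) k ∧ (∀ e ∈ I, ∃ K ∈ 𝒰, e ∈ ed K K) ∧
      ∑ K ∈ 𝒰, (if N + 1 ≤ K.card then K.card else 0) ≤ 3 * N * k := by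
    intro 𝒰
    induction 𝒰 using Finset.induction_on with
    | empty => intro _; exact ⟨0, ∅, by simp, Set.mem_univ _, by simp, by simp⟩
    | insert K 𝒰 hK ih =>
      intro hsub
      obtain ⟨k, I, h1, h2, h3, h4⟩ := ih ((Finset.subset_insert _ _).trans hsub)
      by_cases hc : N + 1 ≤ K.card
      · have hKm : K ∈ 𝒦 := hsub (Finset.mem_insert_self _ _)
        obtain ⟨x, hx, rfl⟩ := Finset.mem_image.1 hKm
        obtain ⟨F, hF, hT⟩ := span_tree ω D hx
        obtain ⟨l, hl, hl'⟩ := hT.count hN hc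
        refine ⟨k + l, I ∪ F, Finset.union_subset h1 hF, ?_, ?_, ?_⟩
        · refine djn_add _ _ _ _ ?_ h2 hl
          rw [Finset.disjoint_left]
          intro e he he'
          obtain ⟨K', hK', heK'⟩ := h3 e he
          have hne : K' ≠ cl ω D x := fun hh => hK (hh ▸ hK')
          exact Finset.disjoint_left.1 (ed_disjoint (hdisj _ (hsub (Finset.mem_insert_of_mem hK'))
            _ hKm hne)) heK' (hT.edges he')
        · intro e he
          rcases Finset.mem_union.1 he with he | he
          · obtain ⟨K', hK', heK'⟩ := h3 e he
            exact ⟨K', Finset.mem_insert_of_mem hK', heK'⟩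
          · exact ⟨_, Finset.mem_insert_self _ _, hT.edges he⟩
        · rw [Finset.sum_insert hK, if_pos hc, mul_add]
          omega
      · refine ⟨k, I, h1, h2, ?_, ?_⟩
        · intro e he
          obtain ⟨K', hK', heK'⟩ := h3 e he
          exact ⟨K', Finset.mem_insert_of_mem hK', heK'⟩
        · rw [Finset.sum_insert hK, if_neg hc, zero_add]; exact h4
  obtain ⟨k, I, h1, h2, _, h4⟩ := key 𝒦 le_rfl
  refine ⟨k, Up.djn k _ _ h1 h2, le_trans ?_ h4⟩
  rw [Finset.card_eq_sum_card_fiberwise (f := cl ω D) (t := 𝒦)]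
  · refine Finset.sum_le_sum fun K hK => ?_
    by_cases hc : N + 1 ≤ K.card
    · rw [if_pos hc]
      refine Finset.card_le_card ?_
      intro y hy
      simp only [bigW, Finset.mem_filter] at hy
      rw [← hy.2, mem_cl]
      exact connIn_refl (by simpa using hy.1.1)
    · rw [if_neg hc, Nat.le_zero, Finset.card_eq_zero, Finset.filter_eq_empty_iff]
      intro y hy hyK
      simp only [bigW, Finset.mem_filter] at hy
      rw [hyK] at hy
      exact hc hy.2
  · intro y hy
    simp only [bigW, Finset.coe_filter, Set.mem_setOf_eq] at hy
    exact Finset.mem_coe.2 (Finset.mem_image_of_mem _ hy.1)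

theorem djn_anti {E : Type} [DecidableEq E] {A : Set (Finset E)} {k l : ℕ} (hkl : k ≤ l) :
    djn A l ⊆ djn A k := by
  induction l generalizing k with
  | zero => obtain rfl : k = 0 := by omega
            exact le_rfl
  | succ l ih =>
    rcases Nat.eq_zero_or_pos k with rfl | hk
    · intro _ _; exact Set.mem_univ _
    obtain ⟨k, rfl⟩ : ∃ j, k = j + 1 := ⟨k - 1, by omega⟩
    rintro I ⟨K, h1, h2, h3⟩
    exact ⟨K, h1, h2, ih (by omega) h3⟩

theorem sum_real_le {Ω ι κ : Type*} [MeasurableSpace Ω] {μ : Measure Ω} [IsFiniteMeasure μ]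
    (s : Finset ι) (t : Finset κ) (A : ι → Set Ω) (B : κ → Set Ω) (b : κ → ℝ)
    (hA : ∀ i ∈ s, MeasurableSet (A i)) (hB : ∀ j ∈ t, MeasurableSet (B j))
    (h : ∀ ω, ∑ i ∈ s, (A i).indicator (fun _ => (1 : ℝ)) ω ≤
      ∑ j ∈ t, b j * (B j).indicator (fun _ => (1 : ℝ)) ω) :
    ∑ i ∈ s, μ.real (A i) ≤ ∑ j ∈ t, b j * μ.real (B j) := by
  have iA : ∀ i ∈ s, Integrable ((A i).indicator (fun _ => (1 : ℝ))) μ := fun i hi =>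
    (integrable_const 1).indicator (hA i hi)
  have iB : ∀ j ∈ t, Integrable (fun ω => b j * (B j).indicator (fun _ => (1 : ℝ)) ω) μ :=
    fun j hj => ((integrable_const 1).indicator (hB j hj)).const_mul _
  have := integral_mono (integrable_finset_sum s iA) (integrable_finset_sum t iB) (by
    intro ω; simpa [Finset.sum_apply] using h ω)
  rw [integral_finset_sum s iA] at this
  simp only at this
  rw [integral_finset_sum t iB] at this
  calc _ = ∑ i ∈ s, ∫ ω, (A i).indicator (fun _ => (1 : ℝ)) ω ∂μ := by
        refine Finset.sum_congr rfl fun i hi => ?_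
        rw [integral_indicator_const _ (hA i hi)]; simp
    _ ≤ _ := this
    _ = _ := by
        refine Finset.sum_congr rfl fun j hj => ?_
        rw [integral_const_mul, integral_indicator_const _ (hB j hj)]; simp

theorem geom_bound {q : ℝ} (h0 : 0 ≤ q) (h1 : q < 1) (M : ℕ) :
    ∑ j ∈ Finset.range M, (2 * (j : ℝ) + 1) * q ^ (j + 1) ≤ 2 / (1 - q) ^ 2 := by
  have key : ∀ M : ℕ, (1 - q) ^ 2 * ∑ j ∈ Finset.range M, ((j : ℝ) + 1) * q ^ j =
      1 - (M + 1) * q ^ M + M * q ^ (M + 1) := by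
    intro M
    induction M with
    | zero => simp
    | succ M ih => rw [Finset.sum_range_succ, mul_add, ih]; push_cast; ring
  have hpos : 0 < (1 - q) ^ 2 := by have : 0 < 1 - q := by linarith
                                    positivity
  have h2 : ∑ j ∈ Finset.range M, ((j : ℝ) + 1) * q ^ j ≤ 1 / (1 - q) ^ 2 := by
    rw [le_div_iff₀ hpos, mul_comm, key]
    have : (M : ℝ) * q ^ (M + 1) ≤ (M + 1) * q ^ M := by
      rw [pow_succ]
      have := pow_nonneg h0 M
      have hM : (0 : ℝ) ≤ M := Nat.cast_nonneg _
      nlinarith [mul_nonneg hM this]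
    linarith
  calc _ ≤ ∑ j ∈ Finset.range M, 2 * (((j : ℝ) + 1) * q ^ j) := by
        refine Finset.sum_le_sum fun j _ => ?_
        have := pow_nonneg h0 j
        have hj : (0 : ℝ) ≤ j := Nat.cast_nonneg _
        rw [pow_succ]
        nlinarith [mul_nonneg hj this, mul_nonneg this h0]
    _ = 2 * ∑ j ∈ Finset.range M, ((j : ℝ) + 1) * q ^ j := by rw [Finset.mul_sum]
    _ ≤ _ := by rw [div_eq_mul_one_div]; linarith

theorem dep_clf (D : Finset (V d)) (x : V d) (Q : Finset (V d) → Prop) :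
    Dep {ω : Config d | Q (cl ω D x)} (ed D D : Set (Sym2 (V d))) := by
  intro ω ω' hh hA
  have : cl ω D x = cl ω' D x := by
    ext y; rw [mem_cl, mem_cl]
    exact ⟨connIn_congr (fun e he => hh e he), connIn_congr (fun e he => (hh e he).symm)⟩
  simpa [← this] using hA

theorem dep_good (D : Finset (V d)) (m : ℝ) :
    Dep {ω : Config d | Good D m ω} (ed D D : Set (Sym2 (V d))) := by
  rintro ω ω' hh ⟨x, hx, hm⟩
  exact ⟨x, hx, dep_clf D x (fun K => m ≤ (K.card : ℝ)) ω ω' hh hm⟩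

theorem meas_good (D : Finset (V d)) (m : ℝ) : MeasurableSet {ω : Config d | Good D m ω} :=
  (dep_good D m).meas (Finset.finite_toSet _)

theorem second_moment_tail (h : IsCyl p μ) (hp : ∀ e, p e ≤ 1) (D : Finset (V d)) {N : ℕ}
    (hN : 1 ≤ N) {q : ℝ} (hq : μ.real {ω | Good D ((N : ℝ) + 1) ω} ≤ q) (hq1 : q < 1) :
    ∑ x ∈ D, ∑ y ∈ D, μ.real {ω | connIn ω D x y ∧ N + 1 ≤ (cl ω D x).card} ≤
      18 * (N : ℝ) ^ 2 / (1 - q) ^ 2 := by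
  classical
  haveI := h.prob
  have hq0 : 0 ≤ q := measureReal_nonneg.trans hq
  set M := D.card
  have hm := sum_real_le (μ := μ) (D ×ˢ D) (Finset.range M)
    (fun q => {ω | connIn ω D q.1 q.2 ∧ N + 1 ≤ (cl ω D q.1).card})
    (fun j => {ω | op (ed D D) ω ∈ djn (bigT N) (j + 1)})
    (fun j => 9 * (N : ℝ) ^ 2 * (2 * (j : ℝ) + 1))
    (fun q _ => (meas_connIn D q.1 q.2).inter
      ((dep_clf D q.1 (fun K => N + 1 ≤ K.card)).meas (Finset.finite_toSet _)))
    (fun j _ => (dep_op _ _).meas (Finset.finite_toSet _)) (by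
      intro ω
      obtain ⟨k, hk1, hk2⟩ := bigW_le hN ω D
      set W := (bigW N D ω).card
      have hWM : W ≤ M := Finset.card_le_card (Finset.filter_subset _ _)
      have hk' : ∃ k, k ≤ M ∧ op (ed D D) ω ∈ djn (bigT N) k ∧ W ≤ 3 * N * k := by
        by_cases hkM : k ≤ M
        · exact ⟨k, hkM, hk1, hk2⟩
        · refine ⟨M, le_rfl, djn_anti (by omega) hk1, hWM.trans ?_⟩
          nlinarith
      obtain ⟨k, hkM, hk1, hk2⟩ := hk'
      have hleft : ∑ q ∈ D ×ˢ D,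
          ({ω | connIn ω D q.1 q.2 ∧ N + 1 ≤ (cl ω D q.1).card} : Set (Config d)).indicator
            (fun _ => (1 : ℝ)) ω ≤ (W : ℝ) * W := by
        have hWW : (W : ℝ) * W = (((bigW N D ω) ×ˢ (bigW N D ω)).card : ℝ) := by
          rw [Finset.card_product]; push_cast; rfl
        rw [hWW]
        simp only [Set.indicator_apply]
        rw [← Finset.sum_filter]
        simp only [Finset.sum_const, nsmul_eq_mul, mul_one]
        norm_cast
        refine Finset.card_le_card ?_
        intro q hq
        simp only [Finset.mem_filter, Finset.mem_product, Set.mem_setOf_eq, bigW] at hq ⊢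
        obtain ⟨⟨h1, h2⟩, h3, h4⟩ := hq
        exact ⟨⟨h1, h4⟩, h2, by rw [← cl_eq h3]; exact h4⟩
      have hright : 9 * (N : ℝ) ^ 2 * (k : ℝ) ^ 2 ≤ ∑ j ∈ Finset.range M,
          9 * (N : ℝ) ^ 2 * (2 * (j : ℝ) + 1) *
          ({ω | op (ed D D) ω ∈ djn (bigT N) (j + 1)} : Set (Config d)).indicator
            (fun _ => (1 : ℝ)) ω := by
        have hs : ∀ k : ℕ, ∑ j ∈ Finset.range k, (2 * (j : ℝ) + 1) = (k : ℝ) ^ 2 := by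
          intro k
          induction k with
          | zero => simp
          | succ k ih => rw [Finset.sum_range_succ, ih]; push_cast; ring
        rw [← hs k, Finset.mul_sum]
        have hsub : Finset.range k ⊆ Finset.range M := by
          intro j hj; simp only [Finset.mem_range] at hj ⊢; omega
        refine le_trans (Finset.sum_le_sum ?_)
          (Finset.sum_le_sum_of_subset_of_nonneg hsub ?_)
        · intro j hj
          have : ω ∈ ({ω | op (ed D D) ω ∈ djn (bigT N) (j + 1)} : Set (Config d)) :=
            djn_anti (by have := Finset.mem_range.1 hj; omega) hk1
          rw [Set.indicator_of_mem this, mul_one]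
        · intro j _ _
          refine mul_nonneg (by positivity) (Set.indicator_nonneg (by intros; norm_num) _)
      refine hleft.trans (le_trans ?_ hright)
      have : (W : ℝ) ≤ 3 * N * k := by exact_mod_cast hk2
      have hW0 : (0 : ℝ) ≤ W := Nat.cast_nonneg _
      nlinarith)
  rw [← Finset.sum_product']
  refine hm.trans ?_
  have hq' : μ.real {ω | op (ed D D) ω ∈ bigT N} ≤ q :=
    (measureReal_mono (fun ω hω => bigT_good hN hω)).trans hq
  calc _ ≤ ∑ j ∈ Finset.range M, 9 * (N : ℝ) ^ 2 * ((2 * (j : ℝ) + 1) * q ^ (j + 1)) := by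
        refine Finset.sum_le_sum fun j _ => ?_
        rw [mul_assoc]
        have := (h.bkn hp (ed D D) (bigT N) (up_bigT N) (j + 1)).trans
          (pow_le_pow_left₀ measureReal_nonneg hq' (j + 1))
        gcongr
    _ = 9 * (N : ℝ) ^ 2 * ∑ j ∈ Finset.range M, (2 * (j : ℝ) + 1) * q ^ (j + 1) := by
        rw [Finset.mul_sum]
    _ ≤ 9 * (N : ℝ) ^ 2 * (2 / (1 - q) ^ 2) := by
        gcongr
        exact geom_bound hq0 hq1 M
    _ = _ := by ring

end trees
end LRP

open MeasureTheory ENNReal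
namespace LRP

theorem rtg_lift {X Y : Type} {r : X → X → Prop} {r' : Y → Y → Prop} (f : X → Y)
    (hr : ∀ a b, r a b → r' (f a) (f b)) {x y : X} (h : Relation.ReflTransGen r x y) :
    Relation.ReflTransGen r' (f x) (f y) := by
  induction h with
  | refl => exact Relation.ReflTransGen.refl
  | tail _ hab ih => exact ih.tail (hr _ _ hab)

section shift
variable {d : ℕ} {p : Sym2 (V d) → ℝ≥0∞} {μ : Measure (Config d)}

/-- shift of a configuration -/
def sh (z : V d) (ω : Config d) : Config d := fun e => ω (e.map (· + z))

theorem meas_sh (z : V d) : Measurable (sh z) := by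
  unfold sh; fun_prop

theorem map_map_add (z w : V d) (e : Sym2 (V d)) : (e.map (· + z)).map (· + w) = e.map (· + (z + w)) := by
  rw [Sym2.map_map]; congr 1; funext x; simp [add_assoc]

theorem map_neg_add (z : V d) (e : Sym2 (V d)) : (e.map (· + z)).map (· + -z) = e := by
  rw [map_map_add]; simp

theorem map_add_neg (z : V d) (e : Sym2 (V d)) : (e.map (· + -z)).map (· + z) = e := by
  rw [map_map_add]; simp

theorem tr_cyl (h : IsCyl p μ) (htr : ∀ e (z : V d), p (e.map (· + z)) = p e) (z : V d) :
    IsCyl p (μ.map (sh z)) := by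
  intro s f
  have hms : MeasurableSet {ω : Config d | ∀ e ∈ s, ω e = f e} := by
    have : Dep {ω : Config d | ∀ e ∈ s, ω e = f e} (s : Set (Sym2 (V d))) := by
      intro ω ω' hh hA e he
      rw [← hh e he]; exact hA e he
    exact this.meas s.finite_toSet
  rw [Measure.map_apply (meas_sh z) hms]
  have := h (s.image (fun e => e.map (· + z))) (fun e => f (e.map (· + -z)))
  rw [Finset.prod_image (by
    intro e _ e' _ hee
    have := congrArg (fun e => e.map (· + -z)) hee
    simpa only [map_neg_add] using this)] at this
  convert this using 1
  · congr 1
    ext ω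
    simp only [Set.mem_preimage, Set.mem_setOf_eq, Finset.forall_mem_image, map_neg_add]
    rfl
  · refine Finset.prod_congr rfl fun e _ => ?_
    simp only [map_neg_add, htr]

theorem tr_inv (h : IsCyl p μ) (hp : ∀ e, p e ≤ 1) (htr : ∀ e (z : V d), p (e.map (· + z)) = p e)
    (z : V d) {A : Set (Config d)} (hA : MeasurableSet A) : μ {ω | sh z ω ∈ A} = μ A := by
  have := (tr_cyl h htr z).unique h hp
  conv_rhs => rw [← this]
  rw [Measure.map_apply (meas_sh z) hA]
  rfl

/-- translate of a finite set -/
def trs (z : V d) (D : Finset (V d)) : Finset (V d) := D.map (addRightEmbedding z)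

theorem mem_trs {z : V d} {D : Finset (V d)} {x : V d} : x ∈ trs z D ↔ x - z ∈ D := by
  simp only [trs, Finset.mem_map, addRightEmbedding_apply]
  constructor
  · rintro ⟨a, ha, rfl⟩; simpa using ha
  · intro hx; exact ⟨x - z, hx, by simp⟩

theorem adj_sh {z : V d} {ω : Config d} {x y : V d} :
    adj (sh z ω) x y ↔ adj ω (x + z) (y + z) := by
  simp [adj, sh]

theorem connIn_sh {z : V d} {ω : Config d} {D : Finset (V d)} {x y : V d} :
    connIn (sh z ω) D x y ↔ connIn ω (trs z D) (x + z) (y + z) := by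
  unfold connIn
  simp only [Finset.mem_coe, mem_trs, add_sub_cancel_right]
  refine and_congr_right fun _ => and_congr_right fun _ => ?_
  constructor
  · intro h
    refine rtg_lift (· + z) ?_ h
    rintro a b ⟨h1, h2, h3⟩
    exact ⟨by simpa using h1, by simpa using h2, adj_sh.1 h3⟩
  · intro h
    have := rtg_lift (r' := fun a b => a ∈ D ∧ b ∈ D ∧ adj (sh z ω) a b)
      (fun u => u - z) ?_ h
    · simpa using this
    · rintro a b ⟨h1, h2, h3⟩
      exact ⟨h1, h2, adj_sh.2 (by simpa using h3)⟩

theorem conn_sh {z : V d} {ω : Config d} {x y : V d} :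
    conn (sh z ω) x y ↔ conn ω (x + z) (y + z) := by
  unfold conn
  constructor
  · intro h
    refine rtg_lift (· + z) ?_ h
    intro a b h3
    exact adj_sh.1 h3
  · intro h
    have := rtg_lift (r' := fun a b => adj (sh z ω) a b)
      (fun u => u - z) ?_ h
    · simpa using this
    · intro a b h3
      exact adj_sh.2 (by simpa using h3)

theorem tau_trs (h : IsCyl p μ) (hp : ∀ e, p e ≤ 1) (htr : ∀ e (z : V d), p (e.map (· + z)) = p e)
    (z : V d) (D : Finset (V d)) (x y : V d) :
    tau μ (trs z D) (x + z) (y + z) = tau μ D x y := by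
  have := tr_inv h hp htr z (meas_connIn D x y)
  simp only [Set.mem_setOf_eq, connIn_sh] at this
  simp only [tau, measureReal_def, this]

theorem cl_sh {z : V d} {ω : Config d} {D : Finset (V d)} {x : V d} :
    trs z (cl (sh z ω) D x) = cl ω (trs z D) (x + z) := by
  ext y
  rw [mem_trs, mem_cl, mem_cl, connIn_sh]; simp

theorem good_sh {z : V d} {ω : Config d} {D : Finset (V d)} {m : ℝ} :
    Good D m (sh z ω) ↔ Good (trs z D) m ω := by
  have hc : ∀ x, (cl (sh z ω) D x).card = (cl ω (trs z D) (x + z)).card := by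
    intro x; rw [← cl_sh]; simp [trs]
  constructor
  · rintro ⟨x, hx, hm⟩
    exact ⟨x + z, by simpa [mem_trs] using hx, by rw [← hc]; exact hm⟩
  · rintro ⟨x, hx, hm⟩
    exact ⟨x - z, mem_trs.1 hx, by rw [hc]; simpa using hm⟩

theorem good_trs (h : IsCyl p μ) (hp : ∀ e, p e ≤ 1)
    (htr : ∀ e (z : V d), p (e.map (· + z)) = p e) (z : V d) (D : Finset (V d)) (m : ℝ) :
    μ {ω | Good (trs z D) m ω} = μ {ω | Good D m ω} := by
  have := tr_inv h hp htr z (meas_good D m)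
  simpa only [Set.mem_setOf_eq, good_sh] using this

/-- box of side `r` with corner `z` -/
noncomputable def bx (z : V d) (r : ℕ) : Finset (V d) := Fintype.piFinset fun i => Finset.Ico (z i) (z i + r)

theorem mem_bx {z : V d} {r : ℕ} {x : V d} : x ∈ bx z r ↔ ∀ i, z i ≤ x i ∧ x i < z i + r := by
  simp [bx]

theorem card_bx (z : V d) (r : ℕ) : (bx z r).card = r ^ d := by
  simp [bx, Fintype.card_piFinset]

theorem trs_bx (z w : V d) (r : ℕ) : trs z (bx w r) = bx (w + z) r := by
  ext x
  simp only [mem_trs, mem_bx, Pi.sub_apply, Pi.add_apply]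
  refine forall_congr' fun i => ?_
  constructor <;> rintro ⟨h1, h2⟩ <;> constructor <;> linarith

theorem normInf_le {x : V d} {r : ℕ} : normInf x ≤ r ↔ ∀ i, (x i).natAbs ≤ r := by
  simp [normInf]

theorem bx_diam {z : V d} {r : ℕ} {x y : V d} (hx : x ∈ bx z r) (hy : y ∈ bx z r) :
    normInf (x - y) ≤ r := by
  rw [normInf_le]
  intro i
  have h1 := mem_bx.1 hx i
  have h2 := mem_bx.1 hy i
  simp only [Pi.sub_apply]
  omega

theorem good_bx (h : IsCyl p μ) (hp : ∀ e, p e ≤ 1)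
    (htr : ∀ e (z : V d), p (e.map (· + z)) = p e) (z : V d) (r : ℕ) (m : ℝ) :
    μ {ω | Good (bx z r) m ω} = μ {ω | Good (bx 0 r) m ω} := by
  rw [← good_trs h hp htr z (bx 0 r) m, trs_bx, zero_add]

end shift

section select
variable {d : ℕ} {p : Sym2 (V d) → ℝ≥0∞} {μ : Measure (Config d)}

open Classical in
/-- selection of a big cluster -/
noncomputable def selF (D : Finset (V d)) (m : ℝ) (f : V d → Finset (V d)) : Finset (V d) :=
  if h : ∃ x ∈ D, m ≤ ((f x).card : ℝ) then f h.choose else ∅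

/-- selection of a big cluster -/
noncomputable def sel (D : Finset (V d)) (m : ℝ) (ω : Config d) : Finset (V d) :=
  selF D m (cl ω D)

theorem sel_spec {D : Finset (V d)} {m : ℝ} {ω : Config d} (h : Good D m ω) :
    ∃ x ∈ D, sel D m ω = cl ω D x ∧ m ≤ ((cl ω D x).card : ℝ) := by
  have h' : ∃ x ∈ D, m ≤ ((cl ω D x).card : ℝ) := h
  refine ⟨h'.choose, h'.choose_spec.1, ?_, h'.choose_spec.2⟩
  rw [sel, selF, dif_pos h']

theorem sel_subset {D : Finset (V d)} {m : ℝ} {ω : Config d} : sel D m ω ⊆ D := by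
  by_cases h : Good D m ω
  · obtain ⟨x, _, h1, _⟩ := sel_spec h
    rw [h1]; exact cl_subset
  · have h' : ¬ ∃ x ∈ D, m ≤ ((cl ω D x).card : ℝ) := h
    rw [sel, selF, dif_neg h']; simp

theorem sel_card {D : Finset (V d)} {m : ℝ} {ω : Config d} (h : Good D m ω) :
    m ≤ ((sel D m ω).card : ℝ) := by
  obtain ⟨x, _, h1, h2⟩ := sel_spec h
  rw [h1]; exact h2

theorem sel_conn {D : Finset (V d)} {m : ℝ} {ω : Config d} {a b : V d}
    (ha : a ∈ sel D m ω) (hb : b ∈ sel D m ω) : connIn ω D a b := by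
  by_cases h : Good D m ω
  · obtain ⟨x, _, h1, _⟩ := sel_spec h
    rw [h1, mem_cl] at ha hb
    exact connIn_trans (connIn_symm ha) hb
  · have h' : ¬ ∃ x ∈ D, m ≤ ((cl ω D x).card : ℝ) := h
    rw [sel, selF, dif_neg h'] at ha; simp at ha

theorem dep_sel (D A : Finset (V d)) (m : ℝ) :
    Dep {ω : Config d | sel D m ω = A} (ed D D : Set (Sym2 (V d))) := by
  intro ω ω' hh hA
  have : cl ω D = cl ω' D := by
    funext x
    ext y; rw [mem_cl, mem_cl]
    exact ⟨connIn_congr (fun e he => hh e he), connIn_congr (fun e he => (hh e he).symm)⟩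
  simpa [sel, ← this] using hA

/-- the selected clusters are joined by an open edge -/
def Joined (X Y : Finset (V d)) (m m' : ℝ) (ω : Config d) : Prop :=
  ∃ a ∈ sel X m ω, ∃ b ∈ sel Y m' ω, ω s(a, b) = true

theorem card_ed {A B : Finset (V d)} (h : Disjoint A B) : (ed A B).card = A.card * B.card := by
  rw [ed, Finset.card_image_of_injOn, Finset.card_product]
  rintro ⟨a, b⟩ hab ⟨a', b'⟩ hab' heq
  simp only [Finset.coe_product, Set.mem_prod, Finset.mem_coe] at hab hab'
  simp only [Sym2.eq_iff] at heq
  rcases heq with ⟨rfl, rfl⟩ | ⟨rfl, rfl⟩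
  · rfl
  · exact absurd hab'.2 (Finset.disjoint_left.1 h hab.1)

theorem ed_disjoint' {X Y : Finset (V d)} (h : Disjoint X Y) :
    Disjoint (ed X X ∪ ed Y Y) (ed X Y) := by
  rw [Finset.disjoint_left]
  intro e he he'
  obtain ⟨u, hu, v, hv, rfl⟩ := mem_ed.1 he'
  rw [Finset.mem_union, mem_ed_self, mem_ed_self] at he
  rcases he with he | he
  · exact Finset.disjoint_left.1 h he.2 hv
  · exact Finset.disjoint_left.1 h hu he.1

theorem connect_bound (h : IsCyl p μ) (hp : ∀ e, p e ≤ 1) {X Y : Finset (V d)}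
    (hXY : Disjoint X Y) {m m' t : ℝ} (hm : 0 ≤ m) (hm' : 0 ≤ m') (ht : 0 ≤ t)
    (hpt : ∀ a ∈ X, ∀ b ∈ Y, 1 - (p s(a, b)).toReal ≤ Real.exp (-t)) :
    μ.real {ω | Good X m ω ∧ Good Y m' ω ∧ ¬ Joined X Y m m' ω} ≤ Real.exp (-(t * (m * m'))) := by
  classical
  haveI := h.prob
  set Q := (X.powerset ×ˢ Y.powerset).filter
    (fun q => m ≤ (q.1.card : ℝ) ∧ m' ≤ (q.2.card : ℝ)) with hQ
  have hsub : {ω | Good X m ω ∧ Good Y m' ω ∧ ¬ Joined X Y m m' ω} ⊆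
      ⋃ q ∈ Q, (({ω | sel X m ω = q.1} ∩ {ω | sel Y m' ω = q.2}) ∩
        {ω : Config d | ∀ e ∈ ed q.1 q.2, ω e = false}) := by
    rintro ω ⟨h1, h2, h3⟩
    simp only [Set.mem_iUnion]
    refine ⟨(sel X m ω, sel Y m' ω), ?_, ⟨rfl, rfl⟩, ?_⟩
    · simp only [hQ, Finset.mem_filter, Finset.mem_product, Finset.mem_powerset]
      exact ⟨⟨sel_subset, sel_subset⟩, sel_card h1, sel_card h2⟩
    · intro e he
      obtain ⟨u, hu, v, hv, rfl⟩ := mem_ed.1 he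
      by_contra hcon
      exact h3 ⟨u, hu, v, hv, by simpa using hcon⟩
  have hpt' : ∀ q ∈ Q, μ.real (({ω | sel X m ω = q.1} ∩ {ω | sel Y m' ω = q.2}) ∩
        {ω : Config d | ∀ e ∈ ed q.1 q.2, ω e = false}) ≤
        μ.real ({ω | sel X m ω = q.1} ∩ {ω | sel Y m' ω = q.2}) *
          Real.exp (-(t * (m * m'))) := by
    rintro ⟨A, B⟩ hq
    simp only [hQ, Finset.mem_filter, Finset.mem_product, Finset.mem_powerset] at hq
    obtain ⟨⟨hA, hB⟩, hmA, hmB⟩ := hq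
    have dAB : Dep {ω : Config d | ∀ e ∈ ed A B, ω e = false} (ed A B : Set (Sym2 (V d))) := by
      intro ω ω' hh hA e he
      rw [← hh e he]; exact hA e he
    have hsubed : ed A B ⊆ ed X Y := by
      intro e he
      obtain ⟨u, hu, v, hv, rfl⟩ := mem_ed.1 he
      exact mem_ed_of (hA hu) (hB hv)
    have hdis : Disjoint ((ed X X : Set (Sym2 (V d))) ∪ ed Y Y) (ed A B : Set (Sym2 (V d))) := by
      have := Finset.disjoint_of_subset_right hsubed (ed_disjoint' hXY)
      exact_mod_cast this
    have i1 := h.indep hp ((dep_sel X A m).inter (dep_sel Y B m')) dAB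
      ((Finset.finite_toSet _).union (Finset.finite_toSet _)) (Finset.finite_toSet _) hdis
    rw [measureReal_def, i1, ENNReal.toReal_mul]
    refine mul_le_mul_of_nonneg_left ?_ ENNReal.toReal_nonneg
    have h2 := h (ed A B) (fun _ => false)
    rw [h2, ENNReal.toReal_prod]
    calc ∏ e ∈ ed A B, (if (false = true) then p e else 1 - p e).toReal
        ≤ ∏ e ∈ ed A B, Real.exp (-t) := by
          refine Finset.prod_le_prod (fun _ _ => ENNReal.toReal_nonneg) fun e he => ?_
          obtain ⟨u, hu, v, hv, rfl⟩ := mem_ed.1 he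
          simp only [Bool.false_eq_true, if_false]
          rw [ENNReal.toReal_sub_of_le (hp _) (by simp)]
          simpa using hpt u (hA hu) v (hB hv)
      _ = Real.exp (-(t * ((A.card : ℝ) * B.card))) := by
          rw [Finset.prod_const, card_ed (Finset.disjoint_of_subset_left hA
            (Finset.disjoint_of_subset_right hB hXY)), ← Real.exp_nat_mul]
          congr 1; push_cast; ring
      _ ≤ _ := by
          apply Real.exp_le_exp.2
          have : m * m' ≤ (A.card : ℝ) * B.card := mul_le_mul hmA hmB hm' (Nat.cast_nonneg _)
          nlinarith
  calc _ ≤ μ.real (⋃ q ∈ Q, (({ω | sel X m ω = q.1} ∩ {ω | sel Y m' ω = q.2}) ∩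
        {ω : Config d | ∀ e ∈ ed q.1 q.2, ω e = false})) := measureReal_mono hsub (measure_ne_top _ _)
    _ ≤ ∑ q ∈ Q, μ.real (({ω | sel X m ω = q.1} ∩ {ω | sel Y m' ω = q.2}) ∩
        {ω : Config d | ∀ e ∈ ed q.1 q.2, ω e = false}) := measureReal_biUnion_finset_le _ _
    _ ≤ ∑ q ∈ Q, μ.real ({ω | sel X m ω = q.1} ∩ {ω | sel Y m' ω = q.2}) *
          Real.exp (-(t * (m * m'))) := Finset.sum_le_sum hpt'
    _ = (∑ q ∈ Q, μ.real ({ω | sel X m ω = q.1} ∩ {ω | sel Y m' ω = q.2})) *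
          Real.exp (-(t * (m * m'))) := by rw [Finset.sum_mul]
    _ ≤ 1 * Real.exp (-(t * (m * m'))) := by
        refine mul_le_mul_of_nonneg_right ?_ (Real.exp_nonneg _)
        rw [← measureReal_biUnion_finset]
        · exact measureReal_le_one
        · intro q _ q' _ hne
          rw [Function.onFun, Set.disjoint_left]
          rintro ω ⟨h1, h2⟩ ⟨h3, h4⟩
          exact hne (Prod.ext (h1.symm.trans h3) (h2.symm.trans h4))
        · intro q _
          exact ((dep_sel X q.1 m).inter (dep_sel Y q.2 m')).meas
            ((Finset.finite_toSet _).union (Finset.finite_toSet _))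
    _ = _ := one_mul _

end select
end LRP

open MeasureTheory ENNReal
namespace LRP

section giant
variable {d : ℕ} {p : Sym2 (V d) → ℝ≥0∞} {μ : Measure (Config d)}

/-- probability that the box is not good -/
noncomputable def pbad (μ : Measure (Config d)) (r : ℕ) (m : ℝ) : ℝ :=
  μ.real {ω | ¬ Good (bx 0 r) m ω}

theorem pbad_bx (h : IsCyl p μ) (hp : ∀ e, p e ≤ 1)
    (htr : ∀ e (z : V d), p (e.map (· + z)) = p e) (z : V d) (r : ℕ) (m : ℝ) :
    μ.real {ω | ¬ Good (bx z r) m ω} = pbad μ r m := by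
  haveI := h.prob
  have e1 : ∀ z : V d, {ω | ¬ Good (bx z r) m ω} = {ω | Good (bx z r) m ω}ᶜ := fun z => rfl
  rw [pbad, e1, e1, measureReal_compl (meas_good _ _), measureReal_compl (meas_good _ _)]
  simp only [measureReal_def, good_bx h hp htr z r m]

/-- children of a box -/
noncomputable def child (r : ℕ) {L : ℕ} (i : Fin d → Fin L) : Finset (V d) :=
  bx (fun j => (r : ℤ) * ((i j : ℕ) : ℤ)) r

theorem child_sub {r L : ℕ} (i : Fin d → Fin L) : child r i ⊆ bx 0 (r * L) := by
  intro x hx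
  rw [child, mem_bx] at hx
  rw [mem_bx]
  intro j
  have := hx j
  have hi := (i j).2
  have h1 : (r : ℤ) * ((i j : ℕ) : ℤ) + r ≤ r * L := by
    have : ((i j : ℕ) : ℤ) + 1 ≤ L := by exact_mod_cast hi
    nlinarith
  have h2 : (0 : ℤ) ≤ (r : ℤ) * ((i j : ℕ) : ℤ) := by positivity
  simp only [Pi.zero_apply, zero_add]
  push_cast
  constructor <;> linarith

theorem child_disj {r L : ℕ} {i i' : Fin d → Fin L} (h : i ≠ i') :
    Disjoint (child (d := d) r i) (child r i') := by
  rw [Finset.disjoint_left]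
  intro x hx hx'
  rw [child, mem_bx] at hx hx'
  apply h
  funext j
  have h1 := hx j
  have h2 := hx' j
  have a1 : (r : ℤ) * ((i j : ℕ) : ℤ) < r * (((i' j : ℕ) : ℤ) + 1) := by linarith
  have a2 : (r : ℤ) * ((i' j : ℕ) : ℤ) < r * (((i j : ℕ) : ℤ) + 1) := by linarith
  have hr : (0 : ℤ) ≤ r := by positivity
  have b1 := lt_of_mul_lt_mul_left a1 hr
  have b2 := lt_of_mul_lt_mul_left a2 hr
  apply Fin.ext
  omega

theorem scale_step (h : IsCyl p μ) (hp : ∀ e, p e ≤ 1)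
    (htr : ∀ e (z : V d), p (e.map (· + z)) = p e) {r L : ℕ} (hN : 2 ≤ L ^ d) {m t : ℝ}
    (hm : 0 < m) (ht : 0 ≤ t)
    (hpt : ∀ a b : V d, a ≠ b → normInf (a - b) ≤ r * L →
      1 - (p s(a, b)).toReal ≤ Real.exp (-t)) :
    pbad μ (r * L) (((L : ℝ) ^ d - 1) * m) ≤
      ((L : ℝ) ^ d) ^ 2 * pbad μ r m ^ 2 + ((L : ℝ) ^ d) ^ 2 * Real.exp (-(t * (m * m))) := by
  classical
  haveI := h.prob
  set Q : Finset ((Fin d → Fin L) × (Fin d → Fin L)) :=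
    Finset.univ.filter (fun q => q.1 ≠ q.2) with hQ
  have hQc : (Q.card : ℝ) ≤ ((L : ℝ) ^ d) ^ 2 := by
    have : Q.card ≤ (Finset.univ : Finset ((Fin d → Fin L) × (Fin d → Fin L))).card :=
      Finset.card_le_card (Finset.filter_subset _ _)
    simp only [Finset.card_univ, Fintype.card_prod, Fintype.card_pi, Fintype.card_fin,
      Finset.prod_const] at this
    have h2 : (Q.card : ℝ) ≤ ((L ^ d * L ^ d : ℕ) : ℝ) := by exact_mod_cast this
    push_cast at h2
    nlinarith
  have hsub : {ω | ¬ Good (bx 0 (r * L)) (((L : ℝ) ^ d - 1) * m) ω} ⊆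
      (⋃ q ∈ Q, ({ω | ¬ Good (child r q.1) m ω} ∩ {ω | ¬ Good (child r q.2) m ω})) ∪
      ⋃ q ∈ Q, {ω | Good (child r q.1) m ω ∧ Good (child r q.2) m ω ∧
        ¬ Joined (child r q.1) (child r q.2) m m ω} := by
    intro ω hω
    by_contra hcon
    apply hω
    simp only [Set.mem_union, Set.mem_iUnion, not_or, not_exists, hQ, Finset.mem_filter,
      Finset.mem_univ, true_and, Prod.forall, Set.mem_inter_iff, Set.mem_setOf_eq, not_and,
      not_not] at hcon
    obtain ⟨hc1, hc2⟩ := hcon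
    set G : Finset (Fin d → Fin L) := Finset.univ.filter (fun i => Good (child r i) m ω) with hG
    have hGc : (Finset.univ.filter (fun i : Fin d → Fin L => ¬ Good (child r i) m ω)).card ≤ 1 := by
      rw [Finset.card_le_one]
      intro i hi j hj
      by_contra hij
      simp only [Finset.mem_filter, Finset.mem_univ, true_and] at hi hj
      exact hj (hc1 i j hij hi)
    have hGN : L ^ d ≤ G.card + 1 := by
      have := Finset.card_filter_add_card_filter_not (s := (Finset.univ : Finset (Fin d → Fin L)))
        (fun i => Good (child r i) m ω)
      simp only [Finset.card_univ, Fintype.card_pi, Fintype.card_fin, Finset.prod_const] at this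
      have e : (Finset.univ.filter (fun i : Fin d → Fin L => Good (child r i) m ω)).card = G.card := by
        rw [hG]
      omega
    obtain ⟨i0, hi0⟩ : G.Nonempty := Finset.card_pos.1 (by omega)
    have hgood : ∀ i ∈ G, Good (child r i) m ω := fun i hi => (Finset.mem_filter.1 hi).2
    have hne : ∀ i ∈ G, ∃ x, x ∈ sel (child r i) m ω := by
      intro i hi
      have := sel_card (hgood i hi)
      have h2 : 0 < (sel (child r i) m ω).card := by
        have : (0 : ℝ) < ((sel (child r i) m ω).card : ℝ) := by linarith
        exact_mod_cast this
      exact Finset.card_pos.1 h2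
    obtain ⟨x, hx⟩ := hne i0 hi0
    have hall : G.biUnion (fun i => sel (child r i) m ω) ⊆ cl ω (bx 0 (r * L)) x := by
      intro y hy
      rw [Finset.mem_biUnion] at hy
      obtain ⟨i, hi, hy⟩ := hy
      rw [mem_cl]
      have hci : ((child r i : Finset (V d)) : Set (V d)) ⊆ (bx 0 (r * L) : Finset (V d)) := by
        exact_mod_cast child_sub i
      have hc0 : ((child r i0 : Finset (V d)) : Set (V d)) ⊆ (bx 0 (r * L) : Finset (V d)) := by
        exact_mod_cast child_sub i0
      by_cases hii : i0 = i
      · subst hii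
        exact connIn_mono hci (sel_conn hx hy)
      · obtain ⟨a, ha, b, hb, hab⟩ := hc2 i0 i hii (hgood _ hi0) (hgood _ hi)
        have haD := sel_subset ha
        have hbD := sel_subset hb
        refine connIn_trans (connIn_mono hc0 (sel_conn hx ha)) (connIn_trans ?_
          (connIn_mono hci (sel_conn hb hy)))
        refine connIn_adj (hc0 (by simpa using haD)) (hci (by simpa using hbD)) ⟨?_, hab⟩
        rintro rfl
        exact Finset.disjoint_left.1 (child_disj hii) haD hbD
    refine ⟨x, child_sub i0 (sel_subset hx), ?_⟩
    have hcard : (G.card : ℝ) * m ≤ ((G.biUnion (fun i => sel (child r i) m ω)).card : ℝ) := by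
      rw [Finset.card_biUnion]
      · push_cast
        rw [← nsmul_eq_mul]
        exact Finset.card_nsmul_le_sum _ _ _ (fun i hi => sel_card (hgood i hi))
      · intro i _ j _ hij
        exact Finset.disjoint_of_subset_left sel_subset
          (Finset.disjoint_of_subset_right sel_subset (child_disj hij))
    have h1 : ((L : ℝ) ^ d - 1) ≤ G.card := by
      have : ((L ^ d : ℕ) : ℝ) ≤ (G.card : ℝ) + 1 := by exact_mod_cast hGN
      push_cast at this; linarith
    have h2 : ((G.biUnion (fun i => sel (child r i) m ω)).card : ℝ) ≤
        ((cl ω (bx 0 (r * L)) x).card : ℝ) := by exact_mod_cast Finset.card_le_card hall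
    have h3 := mul_le_mul_of_nonneg_right h1 hm.le
    linarith
  have hb1 : ∀ q ∈ Q, μ.real ({ω | ¬ Good (child r q.1) m ω} ∩ {ω | ¬ Good (child r q.2) m ω}) ≤
      pbad μ r m ^ 2 := by
    intro q hq
    have hne : q.1 ≠ q.2 := (Finset.mem_filter.1 hq).2
    have := h.indep hp (dep_good (child r q.1) m).compl (dep_good (child r q.2) m).compl
      (Finset.finite_toSet _) (Finset.finite_toSet _)
      (by exact_mod_cast ed_disjoint (child_disj hne))
    have e1 : ∀ D : Finset (V d), {ω | ¬ Good D m ω} = {ω | Good D m ω}ᶜ := fun D => rfl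
    rw [e1, e1, measureReal_def, this, ENNReal.toReal_mul, ← measureReal_def, ← measureReal_def,
      ← e1, ← e1, child, child, pbad_bx h hp htr, pbad_bx h hp htr, sq]
  have hb2 : ∀ q ∈ Q, μ.real {ω | Good (child r q.1) m ω ∧ Good (child r q.2) m ω ∧
        ¬ Joined (child r q.1) (child r q.2) m m ω} ≤ Real.exp (-(t * (m * m))) := by
    intro q hq
    have hne : q.1 ≠ q.2 := (Finset.mem_filter.1 hq).2
    refine connect_bound h hp (child_disj hne) hm.le hm.le ht ?_
    intro a ha b hb
    refine hpt a b ?_ (bx_diam (child_sub _ ha) (child_sub _ hb))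
    rintro rfl
    exact Finset.disjoint_left.1 (child_disj hne) ha hb
  calc pbad μ (r * L) (((L : ℝ) ^ d - 1) * m) ≤ _ := measureReal_mono hsub (measure_ne_top _ _)
    _ ≤ _ := measureReal_union_le _ _
    _ ≤ (∑ q ∈ Q, pbad μ r m ^ 2) + ∑ q ∈ Q, Real.exp (-(t * (m * m))) :=
      add_le_add ((measureReal_biUnion_finset_le _ _).trans (Finset.sum_le_sum hb1))
        ((measureReal_biUnion_finset_le _ _).trans (Finset.sum_le_sum hb2))
    _ ≤ _ := by
      simp only [Finset.sum_const, nsmul_eq_mul]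
      have := Real.exp_nonneg (-(t * (m * m)))
      gcongr

/-- shifted box -/
noncomputable def bx' (R : ℕ) : Finset (V d) := bx (fun _ => (R : ℤ)) R

theorem bx_sub {R R' : ℕ} (h : R ≤ R') : bx (0 : V d) R ⊆ bx 0 R' := by
  intro x hx
  rw [mem_bx] at hx ⊢
  intro i
  have := hx i
  simp only [Pi.zero_apply] at this ⊢
  omega

theorem bx'_sub {R R' : ℕ} (h : 2 * R ≤ R') : bx' (d := d) R ⊆ bx 0 R' := by
  intro x hx
  rw [bx', mem_bx] at hx
  rw [mem_bx]
  intro i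
  have := hx i
  simp only [Pi.zero_apply] at this ⊢
  omega

theorem bx'_disj (hd : 1 ≤ d) {R R' : ℕ} (h : R ≤ R') : Disjoint (bx (0 : V d) R) (bx' R') := by
  rw [Finset.disjoint_left]
  intro x hx hx'
  rw [bx', mem_bx] at hx'
  rw [mem_bx] at hx
  have h1 := hx ⟨0, hd⟩
  have h2 := hx' ⟨0, hd⟩
  simp only [Pi.zero_apply] at h1 h2
  omega

theorem joined_conn {ω : Config d} {X Y : Finset (V d)} (hXY : Disjoint X Y) {m m' : ℝ}
    (h : Joined X Y m m' ω) {x y : V d} (hx : x ∈ sel X m ω) (hy : y ∈ sel Y m' ω) :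
    conn ω x y := by
  obtain ⟨a, ha, b, hb, hab⟩ := h
  have hne : a ≠ b := by
    rintro rfl
    exact Finset.disjoint_left.1 hXY (sel_subset ha) (sel_subset hb)
  have h1 := connIn_conn (sel_conn hx ha)
  have h2 := connIn_conn (sel_conn hb hy)
  exact (h1.tail ⟨hne, hab⟩).trans h2

theorem conn_symm {ω : Config d} {x y : V d} (h : conn ω x y) : conn ω y x := by
  have := Relation.reflTransGen_swap.2 h
  exact rtg_mono this fun a b hab => adj_symm hab

theorem giant (h : IsCyl p μ) (hp : ∀ e, p e ≤ 1)
    (htr : ∀ e (z : V d), p (e.map (· + z)) = p e) (hd : 1 ≤ d) {κ s A : ℝ} (hκ : 0 < κ)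
    (hs : 0 < s)
    (hlow : ∀ (a b : V d) (R : ℕ), a ≠ b → normInf (a - b) ≤ R →
      1 - (p s(a, b)).toReal ≤ Real.exp (-(κ * (R : ℝ) ^ (-s))))
    {L : ℕ} (hL : 2 ≤ L) (hg : 2 * (L : ℝ) ^ s ≤ ((L : ℝ) ^ d - 1) ^ 2) (hA0 : 0 < A)
    (hA : 16 * ((L : ℝ) ^ d) ^ 4 * (L : ℝ) ^ (2 * s) ≤ κ * A ^ 2)
    (hinf : μ {ω | ∃ x, (cluster ω x).Infinite} = 0) {r : ℕ} (hr : 1 ≤ r) :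
    μ.real {ω | Good (bx 0 r) (A * (r : ℝ) ^ (s / 2)) ω} ≤ 1 - 1 / (4 * ((L : ℝ) ^ d) ^ 2) := by
  haveI := h.prob
  by_contra hcon
  push Not at hcon
  set N : ℝ := (L : ℝ) ^ d with hNdef
  set δ : ℝ := 1 / (4 * N ^ 2) with hδ
  have hLR : (2 : ℝ) ≤ L := by exact_mod_cast hL
  have hN2 : 2 ≤ N := by
    calc (2 : ℝ) ≤ L := hLR
      _ = (L : ℝ) ^ 1 := (pow_one _).symm
      _ ≤ N := pow_le_pow_right₀ (by linarith) hd
  have hNn : 2 ≤ L ^ d := by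
    have : ((2 : ℕ) : ℝ) ≤ ((L ^ d : ℕ) : ℝ) := by push_cast; exact hN2
    exact_mod_cast this
  have hrR : (1 : ℝ) ≤ r := by exact_mod_cast hr
  have hLs : 1 ≤ (L : ℝ) ^ s := Real.one_le_rpow (by linarith) hs.le
  have hN1 : 1 < N - 1 := by
    by_contra hh
    push Not at hh
    have : (N - 1) ^ 2 ≤ 1 := by nlinarith
    linarith
  set m : ℕ → ℝ := fun k => A * (r : ℝ) ^ (s / 2) * (N - 1) ^ k with hm
  have hmpos : ∀ k, 0 < m k := fun k => by
    have : 0 < N - 1 := by linarith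
    have : (0 : ℝ) < r := by linarith
    simp only [hm]; positivity
  have hmono : ∀ k, m k ≤ m (k + 1) := fun k => by
    simp only [hm, pow_succ]
    have h1 : 0 ≤ A * (r : ℝ) ^ (s / 2) * (N - 1) ^ k := (hmpos k).le
    nlinarith
  set t : ℕ → ℝ := fun k => κ * ((r * L ^ (k + 2) : ℕ) : ℝ) ^ (-s) with htdef
  have htpos : ∀ k, 0 ≤ t k := fun k => by
    simp only [htdef]; positivity
  have hφ : ∀ k, 16 * N ^ 4 * 2 ^ k ≤ t k * (m k * m k) := by
    intro k
    have hr0 : (0 : ℝ) ≤ r := by linarith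
    have hL0 : (0 : ℝ) ≤ L := by linarith
    have e1 : t k * (m k * m k) =
        κ * A ^ 2 * ((L : ℝ) ^ (2 * s))⁻¹ * ((N - 1) ^ 2 / (L : ℝ) ^ s) ^ k := by
      have x1 : ((r * L ^ (k + 2) : ℕ) : ℝ) ^ (-s) =
          ((r : ℝ) ^ s)⁻¹ * (((L : ℝ) ^ s) ^ (k + 2))⁻¹ := by
        push_cast
        rw [Real.rpow_neg (by positivity), Real.mul_rpow hr0 (by positivity), mul_inv]
        congr 2
        rw [← Real.rpow_natCast, ← Real.rpow_mul hL0, mul_comm, Real.rpow_mul hL0,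
          Real.rpow_natCast]
      have x2 : (r : ℝ) ^ (s / 2) * (r : ℝ) ^ (s / 2) = (r : ℝ) ^ s := by
        rw [← Real.rpow_add (by linarith)]; congr 1; ring
      have x3 : (L : ℝ) ^ (2 * s) = ((L : ℝ) ^ s) ^ 2 := by
        rw [mul_comm, Real.rpow_mul hL0]; norm_cast
      have hrs : (r : ℝ) ^ s ≠ 0 := by positivity
      have hLs0 : (L : ℝ) ^ s ≠ 0 := by positivity
      simp only [htdef, hm, x1, x3, div_pow]
      calc _ = κ * A ^ 2 * (((r : ℝ) ^ (s / 2) * (r : ℝ) ^ (s / 2)) * ((r : ℝ) ^ s)⁻¹) *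
            ((N - 1) ^ 2) ^ k * (((L : ℝ) ^ s) ^ (k + 2))⁻¹ := by generalize N - 1 = n'; ring
        _ = _ := by
            rw [x2, mul_inv_cancel₀ hrs]
            field_simp
            ring
    rw [e1]
    have hLs' : 0 < (L : ℝ) ^ (2 * s) := by positivity
    have y1 : 16 * N ^ 4 ≤ κ * A ^ 2 * ((L : ℝ) ^ (2 * s))⁻¹ := by
      rw [← div_eq_mul_inv, le_div_iff₀ hLs']; exact hA
    have y2 : (2 : ℝ) ≤ (N - 1) ^ 2 / (L : ℝ) ^ s := by
      rw [le_div_iff₀ (by positivity)]; exact hg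
    have y3 : (2 : ℝ) ^ k ≤ ((N - 1) ^ 2 / (L : ℝ) ^ s) ^ k := pow_le_pow_left₀ (by norm_num) y2 k
    exact mul_le_mul y1 y3 (by positivity) (by positivity)
  have hexp : ∀ k (x : ℝ), t k * (m k * m k) ≤ x →
      Real.exp (-x) ≤ 1 / (16 * N ^ 4) * (1 / 2) ^ k := by
    intro k x hx
    have h1 := (hφ k).trans hx
    have h2 : 0 < 16 * N ^ 4 * 2 ^ k := by positivity
    have h3 := Real.add_one_le_exp x
    rw [Real.exp_neg]
    have h4 : 16 * N ^ 4 * 2 ^ k ≤ Real.exp x := by linarith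
    calc (Real.exp x)⁻¹ ≤ (16 * N ^ 4 * 2 ^ k)⁻¹ := inv_anti₀ h2 h4
      _ = _ := by rw [mul_inv, one_div, one_div, inv_pow]
  have hRle : ∀ k, r * L ^ (k + 1) ≤ r * L ^ (k + 2) := fun k =>
    Nat.mul_le_mul_left _ (Nat.pow_le_pow_right (by omega) (by omega))
  have h2R : ∀ k, 2 * (r * L ^ k) ≤ r * L ^ (k + 1) := fun k => by
    rw [pow_succ]
    have : 0 ≤ r * L ^ k := Nat.zero_le _
    nlinarith
  have hpt : ∀ k (a b : V d), a ≠ b → normInf (a - b) ≤ r * L ^ (k + 2) →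
      1 - (p s(a, b)).toReal ≤ Real.exp (-(t k)) := fun k a b hab hn => hlow a b _ hab hn
  have hδpos : 0 < δ := by simp only [hδ]; positivity
  have hbad : ∀ k, pbad μ (r * L ^ k) (m k) ≤ δ * (1 / 2) ^ k := by
    intro k
    induction k with
    | zero =>
      have e1 : {ω | ¬ Good (bx 0 r) (A * (r : ℝ) ^ (s / 2)) ω} =
        {ω : Config d | Good (bx 0 r) (A * (r : ℝ) ^ (s / 2)) ω}ᶜ := rfl
      simp only [pow_zero, mul_one, pbad, hm, e1]
      rw [measureReal_compl (meas_good _ _)]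
      simp only [probReal_univ]
      linarith
    | succ k ih =>
      have := scale_step h hp htr (r := r * L ^ k) (L := L) hNn (hmpos k) (htpos k)
        (fun a b hab hn => hpt k a b hab (hn.trans (by rw [mul_assoc, ← pow_succ]; exact hRle k)))
      rw [show r * L ^ k * L = r * L ^ (k + 1) by rw [pow_succ]; ring,
        show ((L : ℝ) ^ d - 1) * m k = m (k + 1) by simp only [hm, pow_succ, ← hNdef]; ring] at this
      refine this.trans ?_
      have h1 := hexp k _ le_rfl
      have h0 : 0 ≤ pbad μ (r * L ^ k) (m k) := measureReal_nonneg
      have hh : (0 : ℝ) < (1 / 2) ^ k := by positivity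
      have hh1 : ((1 : ℝ) / 2) ^ k ≤ 1 := pow_le_one₀ (by norm_num) (by norm_num)
      have h3 : pbad μ (r * L ^ k) (m k) ^ 2 ≤ δ ^ 2 * (1 / 2) ^ k := by
        calc _ ≤ (δ * (1 / 2) ^ k) ^ 2 := pow_le_pow_left₀ h0 ih 2
          _ = δ ^ 2 * (1 / 2) ^ k * (1 / 2) ^ k := by ring
          _ ≤ δ ^ 2 * (1 / 2) ^ k * 1 := by gcongr
          _ = _ := mul_one _
      have hN0 : N ≠ 0 := by linarith
      have x1 : N ^ 2 * δ ^ 2 = δ / 4 := by simp only [hδ]; field_simp <;> norm_num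
      have x2 : N ^ 2 * (1 / (16 * N ^ 4)) = δ / 4 := by simp only [hδ]; field_simp <;> norm_num
      calc _ ≤ N ^ 2 * (δ ^ 2 * (1 / 2) ^ k) + N ^ 2 * (1 / (16 * N ^ 4) * (1 / 2) ^ k) := by
            gcongr
        _ = (N ^ 2 * δ ^ 2) * (1 / 2) ^ k + (N ^ 2 * (1 / (16 * N ^ 4))) * (1 / 2) ^ k := by ring
        _ = _ := by rw [x1, x2, pow_succ]; ring
  -- chain
  set B : ℕ → Finset (V d) := fun k => bx 0 (r * L ^ k) with hB
  set B' : ℕ → Finset (V d) := fun k => bx' (r * L ^ k) with hB'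
  have hLk : ∀ k, r * L ^ k ≤ r * L ^ (k + 1) := fun k => by have := h2R k; omega
  set bad : ℕ → Set (Config d) := fun k =>
    (({ω | ¬ Good (B k) (m k) ω} ∪ {ω | ¬ Good (B' k) (m k) ω}) ∪
      ({ω | Good (B k) (m k) ω ∧ Good (B' k) (m k) ω ∧ ¬ Joined (B k) (B' k) (m k) (m k) ω} ∪
       {ω | Good (B k) (m k) ω ∧ Good (B' (k + 1)) (m (k + 1)) ω ∧
          ¬ Joined (B k) (B' (k + 1)) (m k) (m (k + 1)) ω})) with hbadset
  have hprob : ∀ k, μ.real (bad k) ≤ 1 / 4 * (1 / 2) ^ k := by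
    intro k
    have g1 : μ.real {ω | ¬ Good (B k) (m k) ω} ≤ δ * (1 / 2) ^ k := hbad k
    have g2 : μ.real {ω | ¬ Good (B' k) (m k) ω} ≤ δ * (1 / 2) ^ k := by
      simp only [hB', bx']
      rw [pbad_bx h hp htr]; exact hbad k
    have g3 : μ.real {ω | Good (B k) (m k) ω ∧ Good (B' k) (m k) ω ∧
        ¬ Joined (B k) (B' k) (m k) (m k) ω} ≤ 1 / (16 * N ^ 4) * (1 / 2) ^ k := by
      refine (connect_bound h hp (bx'_disj hd le_rfl) (hmpos k).le (hmpos k).le (htpos k) ?_).trans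
        (hexp k _ le_rfl)
      intro a ha b hb
      refine hpt k a b ?_ ?_
      · rintro rfl; exact Finset.disjoint_left.1 (bx'_disj hd le_rfl) ha hb
      · exact (bx_diam (bx_sub (hLk k) ha) (bx'_sub (h2R k) hb)).trans (hRle k)
    have g4 : μ.real {ω | Good (B k) (m k) ω ∧ Good (B' (k + 1)) (m (k + 1)) ω ∧
        ¬ Joined (B k) (B' (k + 1)) (m k) (m (k + 1)) ω} ≤ 1 / (16 * N ^ 4) * (1 / 2) ^ k := by
      refine (connect_bound h hp (bx'_disj hd (hLk k)) (hmpos k).le (hmpos (k + 1)).le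
        (htpos k) ?_).trans (hexp k _ ?_)
      · intro a ha b hb
        refine hpt k a b ?_ ?_
        · rintro rfl; exact Finset.disjoint_left.1 (bx'_disj hd (hLk k)) ha hb
        · exact bx_diam (bx_sub ((hLk k).trans (hLk (k + 1))) ha) (bx'_sub (h2R (k + 1)) hb)
      · exact mul_le_mul_of_nonneg_left
          (mul_le_mul_of_nonneg_left (hmono k) (hmpos k).le) (htpos k)
    have hsum : μ.real (bad k) ≤ (δ * (1 / 2) ^ k + δ * (1 / 2) ^ k) +
        (1 / (16 * N ^ 4) * (1 / 2) ^ k + 1 / (16 * N ^ 4) * (1 / 2) ^ k) :=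
      (measureReal_union_le _ _).trans (add_le_add
        ((measureReal_union_le _ _).trans (add_le_add g1 g2))
        ((measureReal_union_le _ _).trans (add_le_add g3 g4)))
    refine hsum.trans ?_
    have hN4 : (4 : ℝ) ≤ N ^ 2 := by nlinarith
    have d1 : δ ≤ 1 / 16 := by
      simp only [hδ]
      apply one_div_le_one_div_of_le <;> linarith
    have d2 : 1 / (16 * N ^ 4) ≤ (1 : ℝ) / 16 := by
      apply one_div_le_one_div_of_le
      · norm_num
      · nlinarith
    have hh : (0 : ℝ) < (1 / 2) ^ k := by positivity
    nlinarith
  have hcover : (Set.univ : Set (Config d)) ⊆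
      (⋃ k, bad k) ∪ {ω | ∃ x, (cluster ω x).Infinite} := by
    intro ω _
    by_cases hω : ω ∈ ⋃ k, bad k
    · exact Or.inl hω
    right
    simp only [hbadset, Set.mem_iUnion, Set.mem_union, Set.mem_setOf_eq, not_exists, not_or,
      not_not, not_and] at hω
    have hsel : ∀ k, ∃ y, y ∈ sel (B k) (m k) ω := by
      intro k
      have h1 := sel_card (hω k).1.1
      have h2 := hmpos k
      have : (0 : ℝ) < ((sel (B k) (m k) ω).card : ℝ) := by linarith
      exact Finset.card_pos.1 (by exact_mod_cast this)
    have hsel' : ∀ k, ∃ y, y ∈ sel (B' k) (m k) ω := by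
      intro k
      have h1 := sel_card (hω k).1.2
      have h2 := hmpos k
      have : (0 : ℝ) < ((sel (B' k) (m k) ω).card : ℝ) := by linarith
      exact Finset.card_pos.1 (by exact_mod_cast this)
    obtain ⟨x0, hx0⟩ := hsel 0
    have hall : ∀ k, ∀ y ∈ sel (B k) (m k) ω, conn ω x0 y := by
      intro k
      induction k with
      | zero => intro y hy; exact connIn_conn (sel_conn hx0 hy)
      | succ k ih =>
        intro y hy
        obtain ⟨u, hu⟩ := hsel k
        obtain ⟨w, hw⟩ := hsel' (k + 1)
        have j1 := (hω k).2.2 (hω k).1.1 (hω (k + 1)).1.2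
        have j2 := (hω (k + 1)).2.1 (hω (k + 1)).1.1 (hω (k + 1)).1.2
        have c1 := joined_conn (bx'_disj hd (hLk k)) j1 hu hw
        have c2 := joined_conn (bx'_disj hd le_rfl) j2 hy hw
        exact ((ih u hu).trans c1).trans (conn_symm c2)
    refine ⟨x0, fun hfin => ?_⟩
    obtain ⟨n, hn⟩ := pow_unbounded_of_one_lt (hfin.toFinset.card / m 0) hN1
    have h1 : sel (B n) (m n) ω ⊆ hfin.toFinset := by
      intro y hy
      simp only [Set.Finite.mem_toFinset]
      exact hall n y hy
    have h2 : ((sel (B n) (m n) ω).card : ℝ) ≤ hfin.toFinset.card := by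
      exact_mod_cast Finset.card_le_card h1
    have h3 := sel_card (hω n).1.1
    rw [div_lt_iff₀ (hmpos 0)] at hn
    have h4 : m n = (N - 1) ^ n * m 0 := by simp only [hm, pow_zero]; ring
    linarith
  have htot : μ (⋃ k, bad k) ≤ ENNReal.ofReal (1 / 2) := by
    refine (measure_iUnion_le _).trans ?_
    calc ∑' k, μ (bad k) ≤ ∑' k : ℕ, ENNReal.ofReal (1 / 4 * (1 / 2) ^ k) := by
          refine ENNReal.tsum_le_tsum fun k => ?_
          rw [← ENNReal.ofReal_toReal (measure_ne_top μ (bad k))]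
          exact ENNReal.ofReal_le_ofReal (hprob k)
      _ = ENNReal.ofReal (∑' k : ℕ, 1 / 4 * (1 / 2) ^ k) := by
          rw [ENNReal.ofReal_tsum_of_nonneg (fun k => by positivity)
            (summable_geometric_two.mul_left _)]
      _ = _ := by rw [tsum_mul_left, tsum_geometric_two]; norm_num
  have h1 : (1 : ℝ≥0∞) ≤ ENNReal.ofReal (1 / 2) := by
    calc (1 : ℝ≥0∞) = μ Set.univ := by simp
      _ ≤ _ := measure_mono hcover
      _ ≤ _ := measure_union_le _ _
      _ ≤ _ := by rw [hinf, add_zero]; exact htot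
  rw [← ENNReal.ofReal_one, ENNReal.ofReal_le_ofReal_iff (by norm_num)] at h1
  norm_num at h1

end giant
end LRP

open MeasureTheory ENNReal
namespace LRP

section inbox
variable {d : ℕ} {p : Sym2 (V d) → ℝ≥0∞} {μ : Measure (Config d)}

noncomputable def rowle (μ : Measure (Config d)) (X : Finset (V d)) (N : ℕ) (x : V d) : ℝ :=
  ∑ y ∈ X, μ.real {ω | connIn ω X x y ∧ (cl ω X x).card ≤ N}

noncomputable def ssum (μ : Measure (Config d)) (X : Finset (V d)) : ℝ :=
  ∑ x ∈ X, ∑ y ∈ X, tau μ X x y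

theorem rowle_nonneg {X : Finset (V d)} {N : ℕ} {x : V d} : 0 ≤ rowle μ X N x :=
  Finset.sum_nonneg fun _ _ => measureReal_nonneg

theorem rowle_le [IsProbabilityMeasure μ] (X : Finset (V d)) (N : ℕ) (x : V d) :
    rowle μ X N x ≤ ∑ A ∈ X.powerset.filter (fun A => A.card ≤ N),
      (A.card : ℝ) * μ.real {ω | cl ω X x = A} := by
  classical
  set Q := X.powerset.filter (fun A => A.card ≤ N) with hQ
  have h1 : ∀ y ∈ X, μ.real {ω | connIn ω X x y ∧ (cl ω X x).card ≤ N} ≤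
      ∑ A ∈ Q, if y ∈ A then μ.real {ω | cl ω X x = A} else 0 := by
    intro y hy
    have hsub : {ω | connIn ω X x y ∧ (cl ω X x).card ≤ N} ⊆
        ⋃ A ∈ Q.filter (fun A => y ∈ A), {ω | cl ω X x = A} := by
      rintro ω ⟨h1, h2⟩
      simp only [Set.mem_iUnion]
      refine ⟨cl ω X x, ?_, rfl⟩
      simp only [hQ, Finset.mem_filter, Finset.mem_powerset]
      exact ⟨⟨cl_subset, h2⟩, mem_cl.2 h1⟩
    refine (measureReal_mono hsub (measure_ne_top _ _)).trans ?_
    refine (measureReal_biUnion_finset_le _ _).trans ?_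
    rw [Finset.sum_filter]
  refine (Finset.sum_le_sum h1).trans ?_
  rw [Finset.sum_comm]
  refine Finset.sum_le_sum fun A hA => ?_
  rw [← Finset.sum_filter, Finset.sum_const, nsmul_eq_mul]
  refine mul_le_mul_of_nonneg_right ?_ measureReal_nonneg
  have : X.filter (fun y => y ∈ A) ⊆ A := fun y hy => (Finset.mem_filter.1 hy).2
  exact_mod_cast Finset.card_le_card this

def dev (X Y : Finset (V d)) (x y : V d) (A B : Finset (V d)) : Set (Config d) :=
  ({ω | cl ω X x = A} ∩ {ω | cl ω Y y = B}) ∩ {ω : Config d | ∀ e ∈ ed A B, ω e = false}ᶜ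

theorem dep_noed (A B : Finset (V d)) :
    Dep {ω : Config d | ∀ e ∈ ed A B, ω e = false} (ed A B : Set (Sym2 (V d))) := by
  intro ω ω' hh hA e he
  rw [← hh e he]; exact hA e he

theorem dep_cleq (X A : Finset (V d)) (x : V d) :
    Dep {ω : Config d | cl ω X x = A} (ed X X : Set (Sym2 (V d))) :=
  dep_clf X x (fun K => K = A)

theorem noed_le (h : IsCyl p μ) (hp : ∀ e, p e ≤ 1) {A B : Finset (V d)}
    (hAB : Disjoint A B) {t : ℝ}
    (hpt : ∀ a ∈ A, ∀ b ∈ B, 1 - (p s(a, b)).toReal ≤ Real.exp (-t)) :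
    μ.real {ω : Config d | ∀ e ∈ ed A B, ω e = false} ≤
        Real.exp (-(t * ((A.card : ℝ) * B.card))) := by
  have h2 := h (ed A B) (fun _ => false)
  rw [measureReal_def, h2, ENNReal.toReal_prod]
  calc ∏ e ∈ ed A B, (if (false = true) then p e else 1 - p e).toReal
      ≤ ∏ e ∈ ed A B, Real.exp (-t) := by
        refine Finset.prod_le_prod (fun _ _ => ENNReal.toReal_nonneg) fun e he => ?_
        obtain ⟨u, hu, v, hv, rfl⟩ := mem_ed.1 he
        simp only [Bool.false_eq_true, if_false]
        rw [ENNReal.toReal_sub_of_le (hp _) (by simp)]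
        simpa using hpt u hu v hv
    _ = Real.exp (-(t * ((A.card : ℝ) * B.card))) := by
        rw [Finset.prod_const, card_ed hAB, ← Real.exp_nat_mul]
        congr 1; push_cast; ring

theorem dev_ge (h : IsCyl p μ) (hp : ∀ e, p e ≤ 1) {X Y : Finset (V d)}
    (hXY : Disjoint X Y) {N : ℕ} {t t0 : ℝ} (ht : 0 ≤ t)
    (ht0 : t * (N : ℝ) ^ 2 ≤ t0)
    (hpt : ∀ a ∈ X, ∀ b ∈ Y, 1 - (p s(a, b)).toReal ≤ Real.exp (-t)) (x y : V d)
    {A B : Finset (V d)} (hA : A ⊆ X) (hB : B ⊆ Y) (hNA : A.card ≤ N) (hNB : B.card ≤ N) :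
    Real.exp (-t0) * t * (((A.card : ℝ) * μ.real {ω | cl ω X x = A}) *
        ((B.card : ℝ) * μ.real {ω | cl ω Y y = B})) ≤ μ.real (dev X Y x y A B) := by
  haveI := h.prob
  have hsubed : ed A B ⊆ ed X Y := by
    intro e he
    obtain ⟨u, hu, v, hv, rfl⟩ := mem_ed.1 he
    exact mem_ed_of (hA hu) (hB hv)
  have hdis : Disjoint ((ed X X : Set (Sym2 (V d))) ∪ ed Y Y) (ed A B : Set (Sym2 (V d))) := by
    have := Finset.disjoint_of_subset_right hsubed (ed_disjoint' hXY)
    exact_mod_cast this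
  have hdis2 : Disjoint (ed X X : Set (Sym2 (V d))) (ed Y Y) := by
    have := ed_disjoint hXY
    exact_mod_cast this
  have i1 := h.indep hp ((dep_cleq X A x).inter (dep_cleq Y B y)) (dep_noed A B).compl
    ((Finset.finite_toSet _).union (Finset.finite_toSet _)) (Finset.finite_toSet _) hdis
  have i2 := h.indep hp (dep_cleq X A x) (dep_cleq Y B y) (Finset.finite_toSet _)
    (Finset.finite_toSet _) hdis2
  have h2 := noed_le h hp (Finset.disjoint_of_subset_left hA
            (Finset.disjoint_of_subset_right hB hXY)) (fun a ha b hb => hpt a (hA ha) b (hB hb))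
  have i3 : μ.real (dev X Y x y A B) = μ.real {ω | cl ω X x = A} *
      μ.real {ω | cl ω Y y = B} * (1 - μ.real {ω : Config d | ∀ e ∈ ed A B, ω e = false}) := by
    rw [← probReal_univ (μ := μ), ← measureReal_compl ((dep_noed A B).meas (Finset.finite_toSet _))]
    simp only [measureReal_def, dev]
    rw [i1, i2, ENNReal.toReal_mul, ENNReal.toReal_mul]
  rw [i3]
  set u : ℝ := t * ((A.card : ℝ) * B.card) with hu
  have hu0 : u ≤ t0 := by
    refine le_trans ?_ ht0
    rw [hu, pow_two]
    gcongr
  have hu1 : 0 ≤ u := by positivity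
  have h3 : u * Real.exp (-t0) ≤ 1 - Real.exp (-u) := by
    have e1 : Real.exp (-t0) ≤ Real.exp (-u) := Real.exp_le_exp.2 (by linarith)
    have e2 := Real.add_one_le_exp u
    have e3 : Real.exp u * Real.exp (-u) = 1 := by rw [← Real.exp_add]; simp
    have e4 := Real.exp_pos (-u)
    nlinarith
  have h4 : u * Real.exp (-t0) ≤ 1 - μ.real {ω : Config d | ∀ e ∈ ed A B, ω e = false} := by
    linarith
  calc _ = (μ.real {ω | cl ω X x = A} * μ.real {ω | cl ω Y y = B}) * (u * Real.exp (-t0)) := by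
        rw [hu]; ring
    _ ≤ _ := mul_le_mul_of_nonneg_left h4 (mul_nonneg measureReal_nonneg measureReal_nonneg)

theorem dev_sub {X Y D : Finset (V d)} (hXY : Disjoint X Y) (hXD : X ⊆ D) (hYD : Y ⊆ D)
    {x y : V d} {A B : Finset (V d)} : dev X Y x y A B ⊆ {ω | connIn ω D x y} := by
  rintro ω ⟨⟨h1, h2⟩, h3⟩
  simp only [Set.mem_setOf_eq] at h1 h2
  simp only [Set.mem_compl_iff, Set.mem_setOf_eq, not_forall] at h3
  obtain ⟨e, he, hne⟩ := h3
  obtain ⟨a, ha, b, hb, rfl⟩ := mem_ed.1 he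
  rw [← h1, mem_cl] at ha
  rw [← h2, mem_cl] at hb
  have hX : ((X : Finset (V d)) : Set (V d)) ⊆ D := by exact_mod_cast hXD
  have hY : ((Y : Finset (V d)) : Set (V d)) ⊆ D := by exact_mod_cast hYD
  have haX : a ∈ X := cl_subset (mem_cl.2 ha)
  have hbY : b ∈ Y := cl_subset (mem_cl.2 hb)
  have hab : a ≠ b := by
    rintro rfl
    exact Finset.disjoint_left.1 hXY haX hbY
  have hab' : adj ω a b := ⟨hab, by simpa using hne⟩
  exact connIn_trans (connIn_mono hX ha) (connIn_trans (connIn_adj (hX haX) (hY hbY)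
    hab') (connIn_mono hY (connIn_symm hb)))

theorem dev_sum [IsProbabilityMeasure μ] {X Y D : Finset (V d)} (hXY : Disjoint X Y) (hXD : X ⊆ D)
    (hYD : Y ⊆ D) (x y : V d) (Q : Finset (Finset (V d) × Finset (V d))) :
    ∑ q ∈ Q, μ.real (dev X Y x y q.1 q.2) ≤ tau μ D x y := by
  rw [← measureReal_biUnion_finset]
  · refine measureReal_mono ?_ (measure_ne_top _ _)
    exact Set.iUnion₂_subset fun q _ => dev_sub hXY hXD hYD
  · intro q _ q' _ hne
    rw [Function.onFun, Set.disjoint_left]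
    rintro ω ⟨⟨h1, h2⟩, _⟩ ⟨⟨h3, h4⟩, _⟩
    exact hne (Prod.ext (h1.symm.trans h3) (h2.symm.trans h4))
  · intro q _
    exact (((dep_cleq X q.1 x).inter (dep_cleq Y q.2 y)).inter (dep_noed q.1 q.2).compl).meas
      (((Finset.finite_toSet _).union (Finset.finite_toSet _)).union (Finset.finite_toSet _))

theorem doubling_pt (h : IsCyl p μ) (hp : ∀ e, p e ≤ 1) {X Y D : Finset (V d)}
    (hXY : Disjoint X Y) (hXD : X ⊆ D) (hYD : Y ⊆ D) {N : ℕ} {t t0 : ℝ} (ht : 0 ≤ t)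
    (ht0 : t * (N : ℝ) ^ 2 ≤ t0)
    (hpt : ∀ a ∈ X, ∀ b ∈ Y, 1 - (p s(a, b)).toReal ≤ Real.exp (-t)) (x y : V d) :
    Real.exp (-t0) * t * (rowle μ X N x * rowle μ Y N y) ≤ tau μ D x y := by
  classical
  haveI := h.prob
  set QX := X.powerset.filter (fun A => A.card ≤ N) with hQX
  set QY := Y.powerset.filter (fun A => A.card ≤ N) with hQY
  have hpt' : ∀ q ∈ QX ×ˢ QY, Real.exp (-t0) * t *
      (((q.1.card : ℝ) * μ.real {ω | cl ω X x = q.1}) *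
        ((q.2.card : ℝ) * μ.real {ω | cl ω Y y = q.2})) ≤ μ.real (dev X Y x y q.1 q.2) := by
    intro q hq
    simp only [hQX, hQY, Finset.mem_filter, Finset.mem_product, Finset.mem_powerset] at hq
    exact dev_ge h hp hXY ht ht0 hpt x y hq.1.1 hq.2.1 hq.1.2 hq.2.2
  refine le_trans ?_ ((Finset.sum_le_sum hpt').trans (dev_sum hXY hXD hYD x y _))
  rw [← Finset.mul_sum, Finset.sum_product]
  dsimp only
  rw [← Finset.sum_mul_sum]
  refine mul_le_mul_of_nonneg_left ?_ (mul_nonneg (Real.exp_nonneg _) ht)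
  exact mul_le_mul (rowle_le X N x) (rowle_le Y N y) rowle_nonneg
    (rowle_nonneg.trans (rowle_le X N x))

theorem doubling (h : IsCyl p μ) (hp : ∀ e, p e ≤ 1) {X Y D : Finset (V d)}
    (hXY : Disjoint X Y) (hXD : X ⊆ D) (hYD : Y ⊆ D) {N : ℕ} {t t0 : ℝ} (ht : 0 ≤ t)
    (ht0 : t * (N : ℝ) ^ 2 ≤ t0)
    (hpt : ∀ a ∈ X, ∀ b ∈ Y, 1 - (p s(a, b)).toReal ≤ Real.exp (-t)) :
    Real.exp (-t0) * t * ((∑ x ∈ X, rowle μ X N x) * (∑ y ∈ Y, rowle μ Y N y)) ≤ ssum μ D := by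
  calc _ = ∑ x ∈ X, ∑ y ∈ Y, Real.exp (-t0) * t * (rowle μ X N x * rowle μ Y N y) := by
        rw [Finset.sum_mul_sum]; simp only [Finset.mul_sum]
    _ ≤ ∑ x ∈ X, ∑ y ∈ Y, tau μ D x y := Finset.sum_le_sum fun x hx => Finset.sum_le_sum
        fun y hy => doubling_pt h hp hXY hXD hYD ht ht0 hpt x y
    _ ≤ ∑ x ∈ X, ∑ y ∈ D, tau μ D x y := Finset.sum_le_sum fun x hx =>
        Finset.sum_le_sum_of_subset_of_nonneg hYD fun _ _ _ => tau_nonneg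
    _ ≤ _ := Finset.sum_le_sum_of_subset_of_nonneg hXD fun _ _ _ =>
        Finset.sum_nonneg fun _ _ => tau_nonneg

theorem rowle_trs (h : IsCyl p μ) (hp : ∀ e, p e ≤ 1)
    (htr : ∀ e (z : V d), p (e.map (· + z)) = p e) (z : V d) (D : Finset (V d)) (N : ℕ) :
    ∑ x ∈ trs z D, rowle μ (trs z D) N x = ∑ x ∈ D, rowle μ D N x := by
  have key : ∀ x y, μ.real {ω | connIn ω (trs z D) (x + z) (y + z) ∧
      (cl ω (trs z D) (x + z)).card ≤ N} = μ.real {ω | connIn ω D x y ∧ (cl ω D x).card ≤ N} := by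
    intro x y
    have := tr_inv h hp htr z (A := {ω | connIn ω D x y ∧ (cl ω D x).card ≤ N})
      (((dep_connIn D x y).inter (dep_clf D x (fun K => K.card ≤ N))).meas
        ((Finset.finite_toSet _).union (Finset.finite_toSet _)))
    rw [measureReal_def, measureReal_def, ← this]
    congr 2
    ext ω
    simp only [Set.mem_setOf_eq]
    rw [connIn_sh, ← cl_sh]
    have : (trs z (cl (sh z ω) D x)).card = (cl (sh z ω) D x).card := Finset.card_map _
    rw [this]
  unfold rowle
  conv_lhs => rw [trs]
  rw [Finset.sum_map]
  refine Finset.sum_congr rfl fun x _ => ?_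
  conv_lhs => rw [show (D.map (addRightEmbedding z)) = trs z D from rfl]
  have : ∀ f : V d → ℝ, ∑ y ∈ trs z D, f y = ∑ y ∈ D, f (y + z) := by
    intro f; rw [trs, Finset.sum_map]; rfl
  rw [this]
  exact Finset.sum_congr rfl fun y _ => key x y

theorem ssum_step (h : IsCyl p μ) (hp : ∀ e, p e ≤ 1)
    (htr : ∀ e (z : V d), p (e.map (· + z)) = p e) (hd : 1 ≤ d) {κ s A : ℝ} (hκ : 0 < κ)
    (hs : 0 < s)
    (hlow : ∀ (a b : V d) (R : ℕ), a ≠ b → normInf (a - b) ≤ R →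
      1 - (p s(a, b)).toReal ≤ Real.exp (-(κ * (R : ℝ) ^ (-s))))
    {L : ℕ} (hL : 2 ≤ L) (hg : 2 * (L : ℝ) ^ s ≤ ((L : ℝ) ^ d - 1) ^ 2) (hA0 : 1 ≤ A)
    (hA : 16 * ((L : ℝ) ^ d) ^ 4 * (L : ℝ) ^ (2 * s) ≤ κ * A ^ 2)
    (hinf : μ {ω | ∃ x, (cluster ω x).Infinite} = 0) {r : ℕ} (hr : 1 ≤ r) :
    ∃ Y : ℝ, 0 ≤ Y ∧ ssum μ (bx 0 r) ≤ Y + 1152 * A ^ 2 * ((L : ℝ) ^ d) ^ 4 * (r : ℝ) ^ s ∧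
      Real.exp (-(4 * κ * A ^ 2)) * (κ * 2 ^ (-s)) * (r : ℝ) ^ (-s) * Y ^ 2 ≤
        ssum μ (bx 0 (2 * r)) := by
  haveI := h.prob
  have hrR : (1 : ℝ) ≤ r := by exact_mod_cast hr
  have hrs : 1 ≤ (r : ℝ) ^ (s / 2) := Real.one_le_rpow hrR (by linarith)
  have hA1 : 1 ≤ A * (r : ℝ) ^ (s / 2) := by nlinarith
  set N : ℕ := ⌈A * (r : ℝ) ^ (s / 2)⌉₊ with hN
  have hN1 : 1 ≤ N := Nat.one_le_ceil_iff.2 (by linarith)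
  have hNle : A * (r : ℝ) ^ (s / 2) ≤ N := Nat.le_ceil _
  have hN2 : (N : ℝ) ≤ 2 * (A * (r : ℝ) ^ (s / 2)) := by
    have := (Nat.ceil_lt_add_one (show 0 ≤ A * (r : ℝ) ^ (s / 2) by linarith)).le
    linarith
  have x2 : ((r : ℝ) ^ (s / 2)) ^ 2 = (r : ℝ) ^ s := by
    rw [pow_two, ← Real.rpow_add (by linarith)]; congr 1; ring
  have hNsq : (N : ℝ) ^ 2 ≤ 4 * A ^ 2 * (r : ℝ) ^ s := by
    calc (N : ℝ) ^ 2 ≤ (2 * (A * (r : ℝ) ^ (s / 2))) ^ 2 := by gcongr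
      _ = _ := by rw [mul_pow, mul_pow, x2]; ring
  have hL0 : (0 : ℝ) < (L : ℝ) ^ d := by positivity
  have hq : μ.real {ω | Good (bx (0 : V d) r) ((N : ℝ) + 1) ω} ≤ 1 - 1 / (4 * ((L : ℝ) ^ d) ^ 2) := by
    refine le_trans (measureReal_mono ?_ (measure_ne_top _ _))
      (giant h hp htr hd hκ hs hlow hL hg (by linarith) hA hinf hr)
    rintro ω ⟨x, hx, hm⟩
    exact ⟨x, hx, by linarith⟩
  have htail := second_moment_tail h hp (bx (0 : V d) r) hN1 hq (by
    have : 0 < 1 / (4 * ((L : ℝ) ^ d) ^ 2) := by positivity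
    linarith)
  refine ⟨∑ x ∈ bx 0 r, rowle μ (bx 0 r) N x, Finset.sum_nonneg fun _ _ => rowle_nonneg, ?_, ?_⟩
  · have h1 : ssum μ (bx 0 r) ≤ (∑ x ∈ bx 0 r, rowle μ (bx 0 r) N x) +
        ∑ x ∈ bx 0 r, ∑ y ∈ bx 0 r,
          μ.real {ω | connIn ω (bx (0 : V d) r) x y ∧ N + 1 ≤ (cl ω (bx 0 r) x).card} := by
      unfold ssum rowle
      rw [← Finset.sum_add_distrib]
      refine Finset.sum_le_sum fun x _ => ?_
      rw [← Finset.sum_add_distrib]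
      refine Finset.sum_le_sum fun y _ => ?_
      refine le_trans (measureReal_mono ?_ (measure_ne_top _ _)) (measureReal_union_le _ _)
      intro ω hω
      by_cases hc : (cl ω (bx 0 r) x).card ≤ N
      · exact Or.inl ⟨hω, hc⟩
      · exact Or.inr ⟨hω, by omega⟩
    refine h1.trans (add_le_add le_rfl (htail.trans ?_))
    have e : 18 * (N : ℝ) ^ 2 / (1 - (1 - 1 / (4 * ((L : ℝ) ^ d) ^ 2))) ^ 2 =
        288 * ((L : ℝ) ^ d) ^ 4 * (N : ℝ) ^ 2 := by
      rw [show (1 : ℝ) - (1 - 1 / (4 * ((L : ℝ) ^ d) ^ 2)) = 1 / (4 * ((L : ℝ) ^ d) ^ 2) by ring]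
      field_simp <;> ring
    rw [e]
    calc _ ≤ 288 * ((L : ℝ) ^ d) ^ 4 * (4 * A ^ 2 * (r : ℝ) ^ s) := by gcongr
      _ = _ := by ring
  · have hr0 : (0 : ℝ) ≤ r := by linarith
    have e2 : ((2 * r : ℕ) : ℝ) ^ (-s) = 2 ^ (-s) * (r : ℝ) ^ (-s) := by
      push_cast; rw [Real.mul_rpow (by norm_num) hr0]
    have h2s : (2 : ℝ) ^ (-s) ≤ 1 := by
      rw [Real.rpow_neg (by norm_num)]
      exact inv_le_one_of_one_le₀ (Real.one_le_rpow (by norm_num) hs.le)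
    have := doubling (D := bx 0 (2 * r)) (N := N) (t := κ * ((2 * r : ℕ) : ℝ) ^ (-s))
      (t0 := 4 * κ * A ^ 2) h hp (bx'_disj (d := d) hd (le_refl r)) (bx_sub (by omega)) (bx'_sub le_rfl)
      (by positivity) (by
        rw [e2]
        have hh : (r : ℝ) ^ (-s) * (r : ℝ) ^ s = 1 := by
          rw [← Real.rpow_add (by linarith)]; simp
        calc κ * (2 ^ (-s) * (r : ℝ) ^ (-s)) * (N : ℝ) ^ 2
            ≤ κ * (1 * (r : ℝ) ^ (-s)) * (4 * A ^ 2 * (r : ℝ) ^ s) := by gcongr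
          _ = 4 * κ * A ^ 2 * ((r : ℝ) ^ (-s) * (r : ℝ) ^ s) := by ring
          _ = _ := by rw [hh, mul_one]) (by
        intro a ha b hb
        refine hlow a b _ ?_ (bx_diam (bx_sub (by omega) ha) (bx'_sub le_rfl hb))
        rintro rfl
        exact Finset.disjoint_left.1 (bx'_disj hd le_rfl) ha hb)
    have e3 : ∑ y ∈ bx' r, rowle μ (bx' r) N y = ∑ y ∈ bx 0 r, rowle μ (bx (0 : V d) r) N y := by
      have := rowle_trs h hp htr (fun _ => (r : ℤ)) (bx (0 : V d) r) N
      rw [trs_bx, zero_add] at this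
      exact this
    rw [e3, e2] at this
    refine le_trans (le_of_eq ?_) this
    ring

theorem ssum_le_sq [IsProbabilityMeasure μ] (r : ℕ) :
    ssum μ (bx (0 : V d) r) ≤ (r : ℝ) ^ (2 * d) := by
  calc ssum μ (bx (0 : V d) r) ≤ ∑ x ∈ bx (0 : V d) r, ∑ y ∈ bx (0 : V d) r, (1 : ℝ) :=
        Finset.sum_le_sum fun _ _ => Finset.sum_le_sum fun _ _ => tau_le_one
    _ = _ := by
      simp only [Finset.sum_const, card_bx, nsmul_eq_mul, mul_one]
      push_cast; ring

theorem exists_L (d : ℕ) {s : ℝ} (hs2 : s < 2 * d) (hd : 1 ≤ d) :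
    ∃ L : ℕ, 2 ≤ L ∧ 2 * (L : ℝ) ^ s ≤ ((L : ℝ) ^ d - 1) ^ 2 := by
  have h1 : Filter.Tendsto (fun n : ℕ => (n : ℝ) ^ (2 * d - s)) Filter.atTop Filter.atTop :=
    (tendsto_rpow_atTop (by linarith)).comp tendsto_natCast_atTop_atTop
  obtain ⟨L, hL2, hL⟩ := ((Filter.eventually_ge_atTop 2).and
    (h1.eventually_ge_atTop 8)).exists
  refine ⟨L, hL2, ?_⟩
  have hLR : (2 : ℝ) ≤ L := by exact_mod_cast hL2
  have hN2 : (2 : ℝ) ≤ (L : ℝ) ^ d := by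
    calc (2 : ℝ) ≤ L := hLR
      _ = (L : ℝ) ^ 1 := (pow_one _).symm
      _ ≤ _ := pow_le_pow_right₀ (by linarith) hd
  have e : ((L : ℝ) ^ d) ^ 2 = (L : ℝ) ^ (2 * d - s) * (L : ℝ) ^ s := by
    rw [← Real.rpow_add (by linarith), ← pow_mul, ← Real.rpow_natCast]
    congr 1; push_cast; ring
  have h0 : 0 ≤ (L : ℝ) ^ s := by positivity
  nlinarith

theorem inbox (d : ℕ) (hd : 1 ≤ d) {κ s : ℝ} (hκ : 0 < κ) (hs : (d : ℝ) < s) (hs2 : s < 2 * d) :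
    ∃ M : ℝ, 0 < M ∧ ∀ (p : Sym2 (V d) → ℝ≥0∞) (μ : Measure (Config d)), IsCyl p μ →
      (∀ e, p e ≤ 1) → (∀ e (z : V d), p (e.map (· + z)) = p e) →
      (∀ (a b : V d) (R : ℕ), a ≠ b → normInf (a - b) ≤ R →
        1 - (p s(a, b)).toReal ≤ Real.exp (-(κ * (R : ℝ) ^ (-s)))) →
      μ {ω | ∃ x, (cluster ω x).Infinite} = 0 →
      ∀ r : ℕ, 1 ≤ r → ssum μ (bx 0 r) ≤ M * (r : ℝ) ^ s := by
  obtain ⟨L, hL, hg⟩ := exists_L d hs2 hd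
  have hs0 : 0 < s := by
    have : (0 : ℝ) ≤ d := Nat.cast_nonneg d
    linarith
  set N : ℝ := (L : ℝ) ^ d with hN
  have hN0 : 0 < N := by positivity
  set A : ℝ := 1 + 16 * N ^ 4 * (L : ℝ) ^ (2 * s) / κ with hAdef
  have hq0 : 0 ≤ 16 * N ^ 4 * (L : ℝ) ^ (2 * s) / κ := by positivity
  have hA1 : 1 ≤ A := by linarith
  have hA : 16 * N ^ 4 * (L : ℝ) ^ (2 * s) ≤ κ * A ^ 2 := by
    have : 16 * N ^ 4 * (L : ℝ) ^ (2 * s) = κ * (16 * N ^ 4 * (L : ℝ) ^ (2 * s) / κ) := by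
      field_simp
    rw [this]
    have h2 : 16 * N ^ 4 * (L : ℝ) ^ (2 * s) / κ ≤ A ^ 2 := by nlinarith
    gcongr
  set K1 : ℝ := 1152 * A ^ 2 * N ^ 4 with hK1
  have hK10 : 0 < K1 := by positivity
  set c0 : ℝ := Real.exp (-(4 * κ * A ^ 2)) * (κ * 2 ^ (-s)) * 2 ^ (-s) with hc0
  have hc00 : 0 < c0 := by positivity
  set M : ℝ := 2 * K1 + 4 * 2 ^ d / c0 with hM
  have hM0 : 0 < M := by positivity
  refine ⟨M, hM0, ?_⟩
  intro p μ h hp htr hlow hinf r hr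
  haveI := h.prob
  by_contra hcon
  push Not at hcon
  have step : ∀ k : ℕ, (2 : ℝ) ^ (d * k) * M * ((2 ^ k * r : ℕ) : ℝ) ^ s ≤
      ssum μ (bx 0 (2 ^ k * r)) := by
    intro k
    induction k with
    | zero => simpa using hcon.le
    | succ k ih =>
      set R := 2 ^ k * r with hR
      have hR1 : 1 ≤ R := Nat.mul_pos (by positivity) hr
      have hRR : (1 : ℝ) ≤ R := by exact_mod_cast hR1
      have hR0 : (0 : ℝ) < R := by linarith
      obtain ⟨Y, hY0, hY1, hY2⟩ := ssum_step h hp htr hd hκ hs0 hlow hL hg hA1 hA hinf hR1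
      rw [show 2 ^ (k + 1) * r = 2 * R by rw [hR, pow_succ]; ring]
      refine le_trans ?_ hY2
      have hRs : 0 < (R : ℝ) ^ s := by positivity
      set T : ℝ := (2 : ℝ) ^ (d * k) with hT
      have hT1 : 1 ≤ T := one_le_pow₀ (by norm_num)
      have hYT : T * M / 2 * (R : ℝ) ^ s ≤ Y := by
        have h1 : K1 ≤ T * M / 2 := by
          have : 2 * K1 ≤ M := by
            have : 0 < 4 * 2 ^ d / c0 := by positivity
            linarith
          nlinarith
        have h2 : K1 * (R : ℝ) ^ s ≤ T * M / 2 * (R : ℝ) ^ s := by gcongr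
        linarith
      have hY3 : (T * M / 2 * (R : ℝ) ^ s) ^ 2 ≤ Y ^ 2 := by gcongr
      have e1 : ((2 * R : ℕ) : ℝ) ^ s = 2 ^ s * (R : ℝ) ^ s := by
        push_cast; rw [Real.mul_rpow (by norm_num) hR0.le]
      have e2 : (R : ℝ) ^ (-s) * (R : ℝ) ^ s = 1 := by
        rw [← Real.rpow_add hR0]; simp
      have e3 : (2 : ℝ) ^ (-s) * (2 : ℝ) ^ s = 1 := by
        rw [← Real.rpow_add (by norm_num)]; simp
      have hMc : 4 * 2 ^ d ≤ c0 * M := by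
        have : c0 * (4 * 2 ^ d / c0) = 4 * 2 ^ d := by field_simp
        rw [hM, mul_add, this]
        have : 0 < c0 * (2 * K1) := by positivity
        linarith
      set E := Real.exp (-(4 * κ * A ^ 2)) * (κ * 2 ^ (-s)) with hE
      have hE0 : 0 < E := by positivity
      have hEc : E = c0 * 2 ^ s := by
        rw [hc0, mul_assoc, e3, mul_one]
      have hR' : 0 < (R : ℝ) ^ (-s) := by positivity
      have h2s : 0 < (2 : ℝ) ^ s := by positivity
      calc (2 : ℝ) ^ (d * (k + 1)) * M * ((2 * R : ℕ) : ℝ) ^ s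
          = (4 * 2 ^ d) * (T * M * 2 ^ s * (R : ℝ) ^ s / 4) := by
            rw [e1, hT, show d * (k + 1) = d * k + d by ring, pow_add]; ring
        _ ≤ (c0 * M) * (T * M * 2 ^ s * (R : ℝ) ^ s / 4) := by gcongr
        _ = 1 * (c0 * M) * (T * M * 2 ^ s * (R : ℝ) ^ s / 4) := by ring
        _ ≤ T * (c0 * M) * (T * M * 2 ^ s * (R : ℝ) ^ s / 4) := by gcongr
        _ = E * ((R : ℝ) ^ (-s) * (R : ℝ) ^ s) * (T * M / 2) ^ 2 * (R : ℝ) ^ s := by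
            rw [e2, hEc]; ring
        _ = E * (R : ℝ) ^ (-s) * (T * M / 2 * (R : ℝ) ^ s) ^ 2 := by ring
        _ ≤ _ := by gcongr
  have hrR : (1 : ℝ) ≤ r := by exact_mod_cast hr
  have hr0 : (0 : ℝ) < r := by linarith
  have h1 : ∀ k : ℕ, ((2 : ℝ) ^ (s - d)) ^ k * M ≤ (r : ℝ) ^ (2 * d) := by
    intro k
    have a1 := (step k).trans (ssum_le_sq _)
    have hrs : 1 ≤ (r : ℝ) ^ s := Real.one_le_rpow hrR hs0.le
    have e1 : ((2 ^ k * r : ℕ) : ℝ) ^ s = ((2 : ℝ) ^ s) ^ k * (r : ℝ) ^ s := by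
      push_cast
      rw [Real.mul_rpow (by positivity) hr0.le, ← Real.rpow_natCast, ← Real.rpow_mul (by norm_num),
        mul_comm, mul_comm (k : ℝ), Real.rpow_mul (by norm_num), Real.rpow_natCast, mul_comm]
    have e2 : (2 : ℝ) ^ s = 2 ^ (s - d) * 2 ^ d := by
      rw [← Real.rpow_natCast, ← Real.rpow_add (by norm_num)]; congr 1; ring
    have e3 : (((2 ^ k * r : ℕ)) : ℝ) ^ (2 * d) = (2 : ℝ) ^ (d * k) * 2 ^ (d * k) * (r : ℝ) ^ (2 * d) := by
      push_cast; rw [mul_pow, ← pow_add, ← pow_mul]; congr 2; ring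
    rw [e1, e3, e2, mul_pow, ← pow_mul 2 d k] at a1
    have hT : 0 < (2 : ℝ) ^ (d * k) * 2 ^ (d * k) := by positivity
    have hx : 0 < ((2 : ℝ) ^ (s - d)) ^ k * M := by positivity
    have a2 : (2 : ℝ) ^ (d * k) * 2 ^ (d * k) * (((2 : ℝ) ^ (s - d)) ^ k * M) ≤
        (2 : ℝ) ^ (d * k) * 2 ^ (d * k) * (r : ℝ) ^ (2 * d) := by
      refine le_trans ?_ a1
      calc _ = (2 : ℝ) ^ (d * k) * 2 ^ (d * k) * (((2 : ℝ) ^ (s - d)) ^ k * M) * 1 := by ring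
        _ ≤ (2 : ℝ) ^ (d * k) * 2 ^ (d * k) * (((2 : ℝ) ^ (s - d)) ^ k * M) * (r : ℝ) ^ s := by
            gcongr
        _ = _ := by ring
    exact le_of_mul_le_mul_left a2 hT
  have h2 : 1 < (2 : ℝ) ^ (s - d) := Real.one_lt_rpow (by norm_num) (by linarith)
  obtain ⟨k, hk⟩ := pow_unbounded_of_one_lt ((r : ℝ) ^ (2 * d) / M) h2
  rw [div_lt_iff₀ hM0] at hk
  exact absurd (h1 k) (not_le.2 hk)

end inbox
end LRP

open MeasureTheory ENNReal
namespace LRP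

section balls
variable {d : ℕ}

noncomputable def bl (z : V d) (r : ℕ) : Finset (V d) := bx (fun i => z i - r) (2 * r + 1)

theorem mem_bl {z x : V d} {r : ℕ} : x ∈ bl z r ↔ normInf (x - z) ≤ r := by
  rw [bl, mem_bx, normInf_le]
  refine forall_congr' fun i => ?_
  simp only [Pi.sub_apply]
  push_cast
  omega

theorem card_bl (z : V d) (r : ℕ) : (bl z r).card = (2 * r + 1) ^ d := card_bx _ _

theorem trs_bl (z w : V d) (r : ℕ) : trs z (bl w r) = bl (w + z) r := by
  ext x
  rw [mem_trs, mem_bl, mem_bl, show x - z - w = x - (w + z) by abel]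

theorem normInf_zero : normInf (0 : V d) = 0 := by
  have : normInf (0 : V d) ≤ 0 := normInf_le.2 (by simp)
  omega

theorem normInf_neg (x : V d) : normInf (-x) = normInf x := by
  unfold normInf; congr 1; ext i; simp

theorem normInf_sub_comm (x y : V d) : normInf (x - y) = normInf (y - x) := by
  rw [← normInf_neg, neg_sub]

theorem normInf_add (x y : V d) : normInf (x + y) ≤ normInf x + normInf y := by
  rw [normInf_le]
  intro i
  have h1 := (normInf_le (x := x)).1 le_rfl i
  have h2 := (normInf_le (x := y)).1 le_rfl i
  simp only [Pi.add_apply]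
  omega

theorem normInf_tri (x y z : V d) : normInf (x - z) ≤ normInf (x - y) + normInf (y - z) := by
  have := normInf_add (x - y) (y - z)
  rwa [sub_add_sub_cancel] at this

theorem normInf_pos {x : V d} (hx : x ≠ 0) : 1 ≤ normInf x := by
  by_contra hcon
  apply hx
  have h1 := (normInf_le (x := x) (r := 0)).1 (by omega)
  ext i
  have := h1 i
  simp only [Pi.zero_apply]
  omega

theorem normInf_sub_pos {x y : V d} (hx : x ≠ y) : 1 ≤ normInf (x - y) :=
  normInf_pos (sub_ne_zero.2 hx)

end balls

section bridge
variable {d : ℕ} {J : V d → V d → ℝ} {α c C : ℝ} {P : ℝ → Measure (Config d)}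

theorem ep_le (β : ℝ) (e : Sym2 (V d)) : edgeProb J β e ≤ 1 := by
  unfold edgeProb
  rw [← ENNReal.ofReal_one]
  apply ENNReal.ofReal_le_ofReal
  have := Real.exp_pos (-β *
    Sym2.lift ⟨fun x y => (J x y + J y x) / 2, fun x y => by dsimp only; rw [add_comm]⟩ e)
  linarith

theorem ep_mk (hJ : KernelHyp d J α c C) (β : ℝ) (x y : V d) :
    edgeProb J β s(x, y) = ENNReal.ofReal (1 - Real.exp (-β * J x y)) := by
  unfold edgeProb
  rw [Sym2.lift_mk]
  dsimp only
  rw [hJ.symm y x, add_self_div_two]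

theorem ep_real (hJ : KernelHyp d J α c C) {β : ℝ} (hβ : 0 ≤ β) (x y : V d) :
    (edgeProb J β s(x, y)).toReal = 1 - Real.exp (-β * J x y) := by
  rw [ep_mk hJ, ENNReal.toReal_ofReal]
  have : Real.exp (-β * J x y) ≤ 1 := Real.exp_le_one_iff.2 (by nlinarith [hJ.nonneg x y])
  linarith

theorem ep_tr (hJ : KernelHyp d J α c C) (β : ℝ) (e : Sym2 (V d)) (z : V d) :
    edgeProb J β (e.map (· + z)) = edgeProb J β e := by
  induction e using Sym2.ind with
  | _ x y =>
    rw [Sym2.map_mk, ep_mk hJ, ep_mk hJ, hJ.transInv]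

theorem ep_low (hJ : KernelHyp d J α c C) {β κ : ℝ} (hβ : 0 ≤ β) (hκ : 0 ≤ κ) (hκβ : κ ≤ β * c)
    (a b : V d) (R : ℕ) (hab : a ≠ b) (hR : normInf (a - b) ≤ R) :
    1 - (edgeProb J β s(a, b)).toReal ≤ Real.exp (-(κ * (R : ℝ) ^ (-((d : ℝ) + α)))) := by
  rw [ep_real hJ hβ, _root_.sub_sub_cancel]
  apply Real.exp_le_exp.2
  have h1 := hJ.lower a b hab
  have h2 : (1 : ℝ) ≤ normInf (a - b) := by exact_mod_cast normInf_sub_pos hab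
  have h3 : (normInf (a - b) : ℝ) ≤ R := by exact_mod_cast hR
  have hs : 0 < (d : ℝ) + α := by
    have := hJ.alpha_pos
    positivity
  have h4 : (R : ℝ) ^ (-((d : ℝ) + α)) ≤ (normInf (a - b) : ℝ) ^ (-((d : ℝ) + α)) :=
    Real.rpow_le_rpow_of_nonpos (by linarith) h3 (by linarith)
  rw [show -(d : ℝ) - α = -((d : ℝ) + α) by ring] at h1
  have h5 : 0 ≤ (R : ℝ) ^ (-((d : ℝ) + α)) := by positivity
  have hc := hJ.c_pos
  have : κ * (R : ℝ) ^ (-((d : ℝ) + α)) ≤ β * J a b := by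
    calc _ ≤ β * c * (R : ℝ) ^ (-((d : ℝ) + α)) := by gcongr
      _ ≤ β * c * (normInf (a - b) : ℝ) ^ (-((d : ℝ) + α)) := by gcongr
      _ = β * (c * (normInf (a - b) : ℝ) ^ (-((d : ℝ) + α))) := by ring
      _ ≤ _ := by gcongr
  linarith

theorem ep_leJ (hJ : KernelHyp d J α c C) {β : ℝ} (hβ : 0 ≤ β) (a b : V d) :
    (edgeProb J β s(a, b)).toReal ≤ β * J a b := by
  rw [ep_real hJ hβ]
  have := Real.add_one_le_exp (-β * J a b)
  linarith

theorem ep_up (hJ : KernelHyp d J α c C) {β : ℝ} (hβ : 0 ≤ β) (a b : V d) (hab : a ≠ b) :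
    (edgeProb J β s(a, b)).toReal ≤ β * C * (normInf (a - b) : ℝ) ^ (-((d : ℝ) + α)) := by
  have h1 := hJ.upper a b hab
  rw [show -(d : ℝ) - α = -((d : ℝ) + α) by ring] at h1
  calc _ ≤ β * J a b := ep_leJ hJ hβ a b
    _ ≤ β * (C * (normInf (a - b) : ℝ) ^ (-((d : ℝ) + α))) := by gcongr
    _ = _ := by ring

theorem cont_op (hP : IsLRP J P) (s : Finset (Sym2 (V d))) : ∀ A : Set (Finset (Sym2 (V d))),
    Continuous fun β => (P β).real {ω | op s ω ∈ A} := by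
  classical
  induction s using Finset.induction_on with
  | empty =>
    intro A
    have : ∀ β, (P β).real {ω | op ∅ ω ∈ A} = if (∅ : Finset (Sym2 (V d))) ∈ A then 1 else 0 := by
      intro β
      haveI : IsProbabilityMeasure (P β) := IsCyl.prob (p := edgeProb J β) (hP β)
      have e : ∀ ω : Config d, op ∅ ω = ∅ := fun ω => by simp [op]
      simp only [e]
      split_ifs with h <;> simp [h]
    simp only [this]
    exact continuous_const
  | insert e s he ih =>
    intro A
    have hsplit : ∀ β, (P β).real {ω | op (insert e s) ω ∈ A} =
      (1 - (edgeProb J β e).toReal) * (P β).real {ω | op s ω ∈ A} +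
        (edgeProb J β e).toReal * (P β).real {ω | op s ω ∈ sec e A} :=
      fun β => IsCyl.split (hP β) (ep_le β) he A
    simp only [hsplit]
    have hc : Continuous fun β => (edgeProb J β e).toReal := by
      unfold edgeProb
      simp only [ENNReal.toReal_ofReal']
      fun_prop
    have h1 := ih A
    have h2 := ih (sec e A)
    fun_prop

theorem cont_dep (hP : IsLRP J P) {s : Finset (Sym2 (V d))} {A : Set (Config d)}
    (hA : Dep A (s : Set (Sym2 (V d)))) : Continuous fun β => (P β).real A := by
  classical
  have : A = {ω | op s ω ∈ {I | (fun e => decide (e ∈ I)) ∈ A}} := by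
    ext ω
    have hag : ∀ e ∈ (s : Set (Sym2 (V d))), ω e = decide (e ∈ op s ω) := by
      intro e he
      have he' : e ∈ s := he
      cases h : ω e <;> simp [op, he', h]
    exact ⟨fun h => hA _ _ hag h, fun h => hA _ _ (fun e he => (hag e he).symm) h⟩
  rw [this]
  exact cont_op hP s _

theorem cont_ssum (hP : IsLRP J P) (D : Finset (V d)) : Continuous fun β => ssum (P β) D := by
  unfold ssum tau
  exact continuous_finset_sum _ fun x _ => continuous_finset_sum _ fun y _ =>
    cont_dep hP (dep_connIn D x y)

theorem sub_crit {β : ℝ} (hβ : 0 ≤ β) (h : β < betaC P) :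
    P β {ω | ∃ x, (cluster ω x).Infinite} = 0 := by
  by_contra hcon
  have : β ∈ {β : ℝ | 0 ≤ β ∧ 0 < P β {ω | ∃ x, (cluster ω x).Infinite}} :=
    ⟨hβ, pos_iff_ne_zero.2 hcon⟩
  exact absurd (csInf_le ⟨0, fun x hx => hx.1⟩ this) (not_le.2 h)

theorem tsum_J (hJ : KernelHyp d J α c C) (z : V d) (D : Finset (V d)) :
    ∑ b ∈ D, J z b ≤ ∑' x, J 0 x := by
  have e : ∀ b, J z b = J 0 (b - z) := fun b => by
    have := hJ.transInv 0 (b - z) z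
    rw [zero_add, sub_add_cancel] at this
    exact this
  calc ∑ b ∈ D, J z b = ∑ x ∈ D.map (addRightEmbedding (-z)), J 0 x := by
        rw [Finset.sum_map]
        refine Finset.sum_congr rfl fun b _ => ?_
        rw [e, sub_eq_add_neg]; rfl
    _ ≤ _ := hJ.integrable.sum_le_tsum _ fun x _ => hJ.nonneg 0 x

theorem small_beta (hJ : KernelHyp d J α c C) (hP : IsLRP J P) {β : ℝ} (hβ : 0 ≤ β)
    (hs : β * ∑' x, J 0 x ≤ 1 / 2) (D : Finset (V d)) (z : V d) :
    ∑ y ∈ D, tau (P β) D z y ≤ 2 := by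
  classical
  have h : IsCyl (edgeProb J β) (P β) := hP β
  haveI := h.prob
  by_cases hD : D.Nonempty
  swap
  · rw [Finset.not_nonempty_iff_eq_empty] at hD
    subst hD; simp
  obtain ⟨w, hw, hmax⟩ := D.exists_max_image (fun w => ∑ y ∈ D, tau (P β) D w y) hD
  set T := ∑ y ∈ D, tau (P β) D w y with hT
  have hT0 : 0 ≤ T := Finset.sum_nonneg fun _ _ => tau_nonneg
  have h1 : T ≤ 1 + 1 / 2 * T := by
    calc T ≤ ∑ x ∈ D, (tau (P β) {w} w x + ∑ a ∈ {w}, ∑ b ∈ D \ {w},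
            tau (P β) {w} w a * (edgeProb J β s(a, b)).toReal * tau (P β) D b x) :=
          Finset.sum_le_sum fun x _ => exit_ineq h (ep_le β) D {w} (Finset.mem_singleton_self w) x
      _ = (∑ x ∈ D, tau (P β) {w} w x) + ∑ b ∈ D \ {w}, (edgeProb J β s(w, b)).toReal *
            ∑ x ∈ D, tau (P β) D b x := by
          rw [Finset.sum_add_distrib]
          congr 1
          simp only [Finset.sum_singleton, tau_self (Finset.mem_singleton_self w), one_mul]
          rw [Finset.sum_comm]
          simp only [Finset.mul_sum]
      _ ≤ 1 + ∑ b ∈ D \ {w}, (β * J w b) * T := by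
          refine add_le_add ?_ (Finset.sum_le_sum fun b hb => ?_)
          · rw [Finset.sum_eq_single w]
            · exact tau_le_one
            · intro x _ hx
              exact tau_eq_zero_right (by simpa using hx)
            · intro hh; exact absurd hw hh
          · exact mul_le_mul (ep_leJ hJ hβ w b) (hmax b (Finset.mem_sdiff.1 hb).1)
              (Finset.sum_nonneg fun _ _ => tau_nonneg) (mul_nonneg hβ (hJ.nonneg _ _))
      _ ≤ 1 + 1 / 2 * T := by
          rw [← Finset.sum_mul, ← Finset.mul_sum]
          have := tsum_J hJ w (D \ {w})
          gcongr
          exact (mul_le_mul_of_nonneg_left this hβ).trans hs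
  have h2 : T ≤ 2 := by linarith
  by_cases hz : z ∈ D
  · exact (hmax z hz).trans h2
  · rw [Finset.sum_eq_zero fun y _ => tau_eq_zero_left hz]; norm_num

theorem centered_of_ssum {p : Sym2 (V d) → ℝ≥0∞} {μ : Measure (Config d)} (h : IsCyl p μ)
    (hp : ∀ e, p e ≤ 1) (htr : ∀ e (z : V d), p (e.map (· + z)) = p e) {M α : ℝ} (hα : 0 < α)
    (hM : 0 < M) (hS : ∀ r : ℕ, 1 ≤ r → ssum μ (bx 0 r) ≤ M * (r : ℝ) ^ ((d : ℝ) + α)) {ρ : ℕ}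
    (hρ : 1 ≤ ρ) :
    ∑ z ∈ bl 0 ρ, tau μ (bl 0 ρ) 0 z ≤ M * 5 ^ ((d : ℝ) + α) * (ρ : ℝ) ^ α := by
  haveI := h.prob
  set t := ∑ z ∈ bl 0 ρ, tau μ (bl 0 ρ) 0 z with ht
  have ht0 : 0 ≤ t := Finset.sum_nonneg fun _ _ => tau_nonneg
  have hρR : (1 : ℝ) ≤ ρ := by exact_mod_cast hρ
  set w0 : V d := fun _ => (2 * ρ : ℤ) with hw0
  have hB : bl w0 (2 * ρ) = bx 0 (4 * ρ + 1) := by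
    unfold bl
    congr 1
    · ext i; simp [hw0]
    · ring
  have hsub : ∀ w ∈ bl w0 ρ, bl w ρ ⊆ bx 0 (4 * ρ + 1) := by
    intro w hw x hx
    rw [← hB, mem_bl]
    rw [mem_bl] at hw hx
    have := normInf_tri x w w0
    omega
  have hself : ∀ (w : V d) (r : ℕ), w ∈ bl w r := fun w r => by
    rw [mem_bl, sub_self, normInf_zero]; omega
  have hrow : ∀ w, ∑ y ∈ bl w ρ, tau μ (bl w ρ) w y = t := by
    intro w
    have e : bl w ρ = trs w (bl 0 ρ) := by rw [trs_bl, zero_add]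
    have e2 : ∀ f : V d → ℝ, ∑ y ∈ trs w (bl 0 ρ), f y = ∑ y ∈ bl 0 ρ, f (y + w) := by
      intro f; rw [trs, Finset.sum_map]; rfl
    rw [e, e2, ht]
    refine Finset.sum_congr rfl fun y _ => ?_
    have := tau_trs h hp htr w (bl 0 ρ) 0 y
    rwa [zero_add] at this
  have h1 : (ρ : ℝ) ^ d * t ≤ ssum μ (bx 0 (4 * ρ + 1)) := by
    calc (ρ : ℝ) ^ d * t ≤ ((bl w0 ρ).card : ℝ) * t := by
          rw [card_bl]
          push_cast
          gcongr
          linarith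
      _ = ∑ w ∈ bl w0 ρ, ∑ y ∈ bl w ρ, tau μ (bl w ρ) w y := by
          simp only [hrow, Finset.sum_const, nsmul_eq_mul]
      _ ≤ ∑ w ∈ bl w0 ρ, ∑ y ∈ bx 0 (4 * ρ + 1), tau μ (bx 0 (4 * ρ + 1)) w y := by
          refine Finset.sum_le_sum fun w hw => ?_
          calc _ ≤ ∑ y ∈ bl w ρ, tau μ (bx 0 (4 * ρ + 1)) w y :=
                Finset.sum_le_sum fun y _ => tau_mono (hsub w hw)
            _ ≤ _ := Finset.sum_le_sum_of_subset_of_nonneg (hsub w hw) fun _ _ _ => tau_nonneg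
      _ ≤ _ := Finset.sum_le_sum_of_subset_of_nonneg
          (fun w hw => hsub w hw (hself w ρ)) fun _ _ _ => Finset.sum_nonneg fun _ _ => tau_nonneg
  have h2 := h1.trans (hS _ (by omega))
  have hs : 0 < (d : ℝ) + α := by positivity
  have h3 : (((4 * ρ + 1 : ℕ)) : ℝ) ^ ((d : ℝ) + α) ≤ 5 ^ ((d : ℝ) + α) * ((ρ : ℝ) ^ d * (ρ : ℝ) ^ α) := by
    calc _ ≤ (5 * (ρ : ℝ)) ^ ((d : ℝ) + α) := by
          apply Real.rpow_le_rpow (by positivity) _ hs.le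
          push_cast; linarith
      _ = _ := by
          rw [Real.mul_rpow (by norm_num) (by linarith), Real.rpow_add (by linarith : (0 : ℝ) < ρ),
            Real.rpow_natCast]
  have h4 : (ρ : ℝ) ^ d * t ≤ (ρ : ℝ) ^ d * (M * 5 ^ ((d : ℝ) + α) * (ρ : ℝ) ^ α) := by
    refine h2.trans ((mul_le_mul_of_nonneg_left h3 hM.le).trans (le_of_eq (by ring)))
  exact le_of_mul_le_mul_left h4 (by positivity)

theorem centered (hJ : KernelHyp d J α c C) (hP : IsLRP J P) :
    ∃ A : ℝ, 1 ≤ A ∧ ∀ β : ℝ, 0 < β → β ≤ betaC P → ∀ ρ : ℕ, 1 ≤ ρ →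
      ∑ z ∈ bl 0 ρ, tau (P β) (bl 0 ρ) 0 z ≤ A * (ρ : ℝ) ^ α := by
  have hα := hJ.alpha_pos
  by_cases hbc : betaC P ≤ 0
  · exact ⟨1, le_rfl, fun β h1 h2 => absurd (h1.trans_le h2) (not_lt.2 hbc)⟩
  push Not at hbc
  set S := ∑' x, J 0 x with hS
  have hS0 : 0 ≤ S := tsum_nonneg fun x => hJ.nonneg 0 x
  set b0 := min (1 / (2 * (S + 1))) (betaC P / 2) with hb0
  have hb0p : 0 < b0 := lt_min (by positivity) (by linarith)
  have hb0c : b0 < betaC P := (min_le_right _ _).trans_lt (by linarith)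
  have hc := hJ.c_pos
  obtain ⟨M, hM, hin⟩ := inbox d hJ.d_pos (κ := b0 * c) (s := (d : ℝ) + α) (by positivity)
    (by linarith) (by have := hJ.alpha_lt_d; linarith)
  refine ⟨2 + M * 5 ^ ((d : ℝ) + α), by have : 0 < M * 5 ^ ((d : ℝ) + α) := by positivity
                                        linarith, ?_⟩
  intro β hβ hβc ρ hρ
  have hρα : 1 ≤ (ρ : ℝ) ^ α := Real.one_le_rpow (by exact_mod_cast hρ) hα.le
  have hM5 : 0 ≤ M * 5 ^ ((d : ℝ) + α) := by positivity
  by_cases hsm : β ≤ b0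
  · refine (small_beta hJ hP hβ.le ?_ _ _).trans (by nlinarith)
    have h1 : β ≤ 1 / (2 * (S + 1)) := hsm.trans (min_le_left _ _)
    rw [le_div_iff₀ (by positivity)] at h1
    nlinarith
  · push Not at hsm
    have key : ∀ β ∈ Set.Icc b0 (betaC P), ∀ r : ℕ, 1 ≤ r →
        ssum (P β) (bx 0 r) ≤ M * (r : ℝ) ^ ((d : ℝ) + α) := by
      intro β hβ r hr
      have hcl : IsClosed {β | ssum (P β) (bx (0 : V d) r) ≤ M * (r : ℝ) ^ ((d : ℝ) + α)} :=
        isClosed_le (cont_ssum hP _) continuous_const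
      have hsub : Set.Ico b0 (betaC P) ⊆
          {β | ssum (P β) (bx (0 : V d) r) ≤ M * (r : ℝ) ^ ((d : ℝ) + α)} := by
        rintro β ⟨h1, h2⟩
        exact hin (edgeProb J β) (P β) (hP β) (ep_le β) (ep_tr hJ β)
          (ep_low hJ (hb0p.le.trans h1) (by positivity) (by gcongr))
          (sub_crit (hb0p.le.trans h1) h2) r hr
      have := closure_minimal hsub hcl
      rw [closure_Ico hb0c.ne] at this
      exact this hβ
    refine (centered_of_ssum (hP β) (ep_le β) (ep_tr hJ β) hα hM (key β ⟨hsm.le, hβc⟩) hρ).trans ?_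
    nlinarith

end bridge
end LRP

open MeasureTheory ENNReal
namespace LRP

structure Setup (d : ℕ) (α A B : ℝ) (p : Sym2 (V d) → ℝ≥0∞) (μ : Measure (Config d)) : Prop where
  cyl : IsCyl p μ
  le1 : ∀ e, p e ≤ 1
  tr : ∀ e (z : V d), p (e.map (· + z)) = p e
  up : ∀ a b : V d, a ≠ b →
    (p s(a, b)).toReal ≤ B * (normInf (a - b) : ℝ) ^ (-((d : ℝ) + α))
  cen : ∀ ρ : ℕ, 1 ≤ ρ → ∑ z ∈ bl 0 ρ, tau μ (bl 0 ρ) 0 z ≤ A * (ρ : ℝ) ^ α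
  a0 : 0 < α
  a1 : α < 1
  ad : α < (d : ℝ)
  A1 : 1 ≤ A
  B0 : 0 < B

section star
variable {d : ℕ} {α A B : ℝ} {p : Sym2 (V d) → ℝ≥0∞} {μ : Measure (Config d)}

noncomputable def wt (d : ℕ) (α B : ℝ) (R n : ℕ) : ℝ :=
  B * (n : ℝ) ^ (-((d : ℝ) + α)) * min 1 ((n : ℝ) / R)

theorem wt_nonneg (hB : 0 ≤ B) {R n : ℕ} : 0 ≤ wt d α B R n := by
  unfold wt; positivity

theorem sum_trs (w : V d) (D : Finset (V d)) (f : V d → ℝ) :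
    ∑ y ∈ trs w D, f y = ∑ y ∈ D, f (y + w) := by
  rw [trs, Finset.sum_map]; rfl

theorem Setup.cen' (h : Setup d α A B p μ) (z : V d) {ρ : ℕ} (hρ : 1 ≤ ρ) :
    ∑ y ∈ bl z ρ, tau μ (bl z ρ) z y ≤ A * (ρ : ℝ) ^ α := by
  refine le_trans (le_of_eq ?_) (h.cen ρ hρ)
  have e : bl z ρ = trs z (bl 0 ρ) := by rw [trs_bl, zero_add]
  rw [e, sum_trs]
  refine Finset.sum_congr rfl fun y _ => ?_
  have := tau_trs h.cyl h.le1 h.tr z (bl 0 ρ) 0 y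
  rwa [zero_add] at this

theorem count_le (R i j k : ℕ) (hijk : j ≤ i + k) :
    (((Finset.Ioc R (2 * R)).filter (fun m => i ≤ m ∧ m < j)).card : ℝ) ≤ min (R : ℝ) k := by
  apply le_min
  · have : ((Finset.Ioc R (2 * R)).filter (fun m => i ≤ m ∧ m < j)).card ≤ R := by
      refine (Finset.card_filter_le _ _).trans ?_
      rw [Nat.card_Ioc]; omega
    exact_mod_cast this
  · have : ((Finset.Ioc R (2 * R)).filter (fun m => i ≤ m ∧ m < j)).card ≤ k := by
      calc _ ≤ (Finset.Ico i j).card := Finset.card_le_card fun m hm => by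
            rw [Finset.mem_filter] at hm
            exact Finset.mem_Ico.2 hm.2
        _ ≤ k := by rw [Nat.card_Ico]; omega
    exact_mod_cast this

theorem bl_mono (z : V d) {r r' : ℕ} (h : r ≤ r') : bl z r ⊆ bl z r' := fun x hx => by
  rw [mem_bl] at hx ⊢; omega

theorem mem_bl_self (z : V d) (r : ℕ) : z ∈ bl z r := by
  rw [mem_bl, sub_self, normInf_zero]; omega

theorem Setup.star (h : Setup d α A B p μ) (D : Finset (V d)) (z x : V d) {R : ℕ} (hR : 1 ≤ R) :
    tau μ D z x ≤ tau μ (bl z (2 * R)) z x + ∑ a ∈ bl z (2 * R), tau μ (bl z (2 * R)) z a *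
      ∑ b ∈ D, wt d α B R (normInf (a - b)) * tau μ D b x := by
  classical
  haveI := h.cyl.prob
  have hRR : (0 : ℝ) < R := by exact_mod_cast hR
  set L := bl z (2 * R) with hL
  have h1 : ∀ m ∈ Finset.Ioc R (2 * R), tau μ D z x ≤ tau μ L z x +
      ∑ a ∈ L, ∑ b ∈ D, (if normInf (a - z) ≤ m ∧ m < normInf (b - z) then (1 : ℝ) else 0) *
        (tau μ L z a * (p s(a, b)).toReal * tau μ D b x) := by
    intro m hm
    rw [Finset.mem_Ioc] at hm
    have hsub : bl z m ⊆ L := bl_mono z hm.2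
    refine (exit_ineq h.cyl h.le1 D (bl z m) (mem_bl_self z m) x).trans ?_
    refine add_le_add (tau_mono hsub) ?_
    calc _ ≤ ∑ a ∈ bl z m, ∑ b ∈ D,
          (if normInf (a - z) ≤ m ∧ m < normInf (b - z) then (1 : ℝ) else 0) *
          (tau μ L z a * (p s(a, b)).toReal * tau μ D b x) := by
          refine Finset.sum_le_sum fun a ha => ?_
          calc _ ≤ ∑ b ∈ D \ bl z m,
              (if normInf (a - z) ≤ m ∧ m < normInf (b - z) then (1 : ℝ) else 0) *
              (tau μ L z a * (p s(a, b)).toReal * tau μ D b x) := by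
                refine Finset.sum_le_sum fun b hb => ?_
                rw [Finset.mem_sdiff, mem_bl] at hb
                rw [mem_bl] at ha
                rw [if_pos ⟨ha, by omega⟩, one_mul]
                have := tau_mono (μ := μ) hsub (x := z) (y := a)
                have := tau_nonneg (μ := μ) (D := D) (x := b) (y := x)
                gcongr
            _ ≤ _ := by
                refine Finset.sum_le_sum_of_subset_of_nonneg Finset.sdiff_subset fun b _ _ => ?_
                have := tau_nonneg (μ := μ) (D := D) (x := b) (y := x)
                have := tau_nonneg (μ := μ) (D := L) (x := z) (y := a)
                split_ifs <;> positivity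
      _ ≤ _ := by
          refine Finset.sum_le_sum_of_subset_of_nonneg hsub fun a _ _ =>
            Finset.sum_nonneg fun b _ => ?_
          have := tau_nonneg (μ := μ) (D := D) (x := b) (y := x)
          have := tau_nonneg (μ := μ) (D := L) (x := z) (y := a)
          split_ifs <;> positivity
  have h2 := Finset.sum_le_sum h1
  rw [Finset.sum_const, Nat.card_Ioc, Finset.sum_add_distrib, Finset.sum_const, Nat.card_Ioc,
    show 2 * R - R = R by omega, nsmul_eq_mul, nsmul_eq_mul] at h2
  have h3 : ∑ m ∈ Finset.Ioc R (2 * R), ∑ a ∈ L, ∑ b ∈ D,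
      (if normInf (a - z) ≤ m ∧ m < normInf (b - z) then (1 : ℝ) else 0) *
        (tau μ L z a * (p s(a, b)).toReal * tau μ D b x) ≤
      R * ∑ a ∈ L, tau μ L z a * ∑ b ∈ D, wt d α B R (normInf (a - b)) * tau μ D b x := by
    rw [Finset.sum_comm, Finset.mul_sum]
    refine Finset.sum_le_sum fun a _ => ?_
    rw [Finset.sum_comm, Finset.mul_sum, Finset.mul_sum]
    refine Finset.sum_le_sum fun b _ => ?_
    rw [← Finset.sum_mul, Finset.sum_boole]
    have hc := count_le R (normInf (a - z)) (normInf (b - z)) (normInf (a - b)) (by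
      have := normInf_tri b a z
      rw [normInf_sub_comm b a] at this
      omega)
    set cnt := (((Finset.Ioc R (2 * R)).filter
      (fun m => normInf (a - z) ≤ m ∧ m < normInf (b - z))).card : ℝ)
    have hcnt : cnt * (p s(a, b)).toReal ≤ R * wt d α B R (normInf (a - b)) := by
      by_cases hab : a = b
      · subst hab
        rw [sub_self, normInf_zero] at hc ⊢
        have h0 : cnt ≤ 0 := hc.trans (by simp)
        have : 0 ≤ (R : ℝ) * wt d α B R 0 := mul_nonneg hRR.le (wt_nonneg h.B0.le)
        have h4 : 0 ≤ (p s(a, a)).toReal := ENNReal.toReal_nonneg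
        nlinarith
      · have hu := h.up a b hab
        have e : (R : ℝ) * wt d α B R (normInf (a - b)) =
            min (R : ℝ) (normInf (a - b)) * (B * (normInf (a - b) : ℝ) ^ (-((d : ℝ) + α))) := by
          have : min (R : ℝ) (normInf (a - b)) = R * min 1 ((normInf (a - b) : ℝ) / R) := by
            rw [mul_min_of_nonneg _ _ hRR.le, mul_one, mul_div_cancel₀ _ hRR.ne']
          rw [this, wt]; ring
        rw [e]
        exact mul_le_mul hc hu ENNReal.toReal_nonneg (by positivity)
    calc _ = (cnt * (p s(a, b)).toReal) * (tau μ L z a * tau μ D b x) := by ring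
      _ ≤ (R * wt d α B R (normInf (a - b))) * (tau μ L z a * tau μ D b x) :=
          mul_le_mul_of_nonneg_right hcnt (mul_nonneg tau_nonneg tau_nonneg)
      _ = _ := by ring
  have h4 : (R : ℝ) * tau μ D z x ≤ R * (tau μ L z x +
      ∑ a ∈ L, tau μ L z a * ∑ b ∈ D, wt d α B R (normInf (a - b)) * tau μ D b x) := by
    rw [mul_add]; exact h2.trans (add_le_add le_rfl h3)
  exact le_of_mul_le_mul_left h4 hRR

end star

section kernel
variable {d : ℕ}

theorem near_sum (σ : ℝ) (hσ0 : 0 ≤ σ) (hσ : σ < d) : ∃ K : ℝ, 0 < K ∧ ∀ (a : V d) (l : ℕ),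
    ∑ b ∈ (bl a l).erase a, (normInf (a - b) : ℝ) ^ (-σ) ≤ K * (l : ℝ) ^ ((d : ℝ) - σ) := by
  classical
  set q : ℝ := 2 ^ (-((d : ℝ) - σ)) with hq
  have hq1 : q < 1 := Real.rpow_lt_one_of_one_lt_of_neg (by norm_num) (by linarith)
  have hq0 : 0 < q := by positivity
  have h1q : 0 < 1 - q := by linarith
  refine ⟨2 ^ σ * 3 ^ d / (1 - q), by positivity, fun a l => ?_⟩
  set K : ℝ := 2 ^ σ * 3 ^ d / (1 - q) with hK
  have hK0 : 0 < K := by positivity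
  have hKe : K * q + 2 ^ σ * 3 ^ d = K := by
    rw [hK]; field_simp; ring
  induction l using Nat.strong_induction_on with
  | _ l ih =>
    by_cases hl : l = 0
    · subst hl
      have : (bl a 0).erase a = ∅ := by
        ext x
        simp only [Finset.mem_erase, mem_bl, Finset.notMem_empty, iff_false, not_and]
        intro hx
        have := normInf_sub_pos hx
        omega
      rw [this, Finset.sum_empty]
      positivity
    have hl1 : 1 ≤ l := by omega
    have hlR : (1 : ℝ) ≤ l := by exact_mod_cast hl1
    have hsub : (bl a l).erase a ⊆ (bl a (l / 2)).erase a ∪ ((bl a l) \ (bl a (l / 2))) := by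
      intro x hx
      rw [Finset.mem_erase] at hx
      rw [Finset.mem_union, Finset.mem_erase, Finset.mem_sdiff]
      by_cases h : x ∈ bl a (l / 2)
      · exact Or.inl ⟨hx.1, h⟩
      · exact Or.inr ⟨hx.2, h⟩
    have i1 := ih (l / 2) (by omega)
    have hl2 : ((l / 2 : ℕ) : ℝ) ≤ l / 2 := Nat.cast_div_le
    have i2 : ((l / 2 : ℕ) : ℝ) ^ ((d : ℝ) - σ) ≤ q * (l : ℝ) ^ ((d : ℝ) - σ) := by
      calc _ ≤ ((l : ℝ) / 2) ^ ((d : ℝ) - σ) :=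
            Real.rpow_le_rpow (by positivity) hl2 (by linarith)
        _ = _ := by
            rw [Real.div_rpow (by positivity) (by norm_num), hq, Real.rpow_neg (by norm_num)]
            ring
    have i3 : ∑ b ∈ (bl a l) \ (bl a (l / 2)), (normInf (a - b) : ℝ) ^ (-σ) ≤
        2 ^ σ * 3 ^ d * (l : ℝ) ^ ((d : ℝ) - σ) := by
      calc _ ≤ ∑ b ∈ (bl a l) \ (bl a (l / 2)), ((l : ℝ) / 2) ^ (-σ) := by
            refine Finset.sum_le_sum fun b hb => ?_
            rw [Finset.mem_sdiff, mem_bl, mem_bl, normInf_sub_comm] at hb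
            have h2 : l ≤ 2 * normInf (a - b) := by omega
            have h3 : (l : ℝ) ≤ 2 * normInf (a - b) := by exact_mod_cast h2
            exact Real.rpow_le_rpow_of_nonpos (by positivity) (by linarith) (by linarith)
        _ = (((bl a l) \ (bl a (l / 2))).card : ℝ) * ((l : ℝ) / 2) ^ (-σ) := by
            rw [Finset.sum_const, nsmul_eq_mul]
        _ ≤ (3 * (l : ℝ)) ^ d * ((l : ℝ) / 2) ^ (-σ) := by
            gcongr
            calc (((bl a l) \ (bl a (l / 2))).card : ℝ) ≤ ((bl a l).card : ℝ) := by
                  exact_mod_cast Finset.card_le_card Finset.sdiff_subset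
              _ = (2 * (l : ℝ) + 1) ^ d := by rw [card_bl]; push_cast; ring
              _ ≤ _ := by gcongr; linarith
        _ = _ := by
            rw [Real.div_rpow (by positivity) (by norm_num), Real.rpow_neg (by norm_num : (0:ℝ) ≤ 2),
              mul_pow, sub_eq_add_neg, Real.rpow_add (by linarith : (0 : ℝ) < l), Real.rpow_natCast]
            field_simp
    calc _ ≤ ∑ b ∈ (bl a (l / 2)).erase a ∪ ((bl a l) \ (bl a (l / 2))),
          (normInf (a - b) : ℝ) ^ (-σ) :=
          Finset.sum_le_sum_of_subset_of_nonneg hsub fun _ _ _ => by positivity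
      _ ≤ ∑ b ∈ (bl a (l / 2)).erase a, (normInf (a - b) : ℝ) ^ (-σ) +
          ∑ b ∈ (bl a l) \ (bl a (l / 2)), (normInf (a - b) : ℝ) ^ (-σ) := by
          rw [← Finset.sum_union_inter]
          exact le_add_of_nonneg_right (Finset.sum_nonneg fun _ _ => by positivity)
      _ ≤ K * (q * (l : ℝ) ^ ((d : ℝ) - σ)) + 2 ^ σ * 3 ^ d * (l : ℝ) ^ ((d : ℝ) - σ) :=
          add_le_add (i1.trans (by gcongr)) i3
      _ = (K * q + 2 ^ σ * 3 ^ d) * (l : ℝ) ^ ((d : ℝ) - σ) := by ring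
      _ = _ := by rw [hKe]

theorem far_sum (s γ : ℝ) (hs : 0 ≤ s) (hγ : γ < s) : ∃ K : ℝ, 0 < K ∧
    ∀ (D : Finset (V d)) (a : V d) (g : V d → ℝ) (F : ℝ), (∀ b, 0 ≤ g b) → 0 ≤ F →
    (∀ ρ : ℕ, 1 ≤ ρ → ∑ b ∈ D.filter (fun b => normInf (a - b) ≤ ρ), g b ≤ F * (ρ : ℝ) ^ γ) →
    ∀ l : ℕ, 1 ≤ l → ∑ b ∈ D.filter (fun b => l < normInf (a - b)),
      (normInf (a - b) : ℝ) ^ (-s) * g b ≤ K * F * (l : ℝ) ^ (γ - s) := by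
  classical
  set q : ℝ := 2 ^ (γ - s) with hq
  have hq1 : q < 1 := Real.rpow_lt_one_of_one_lt_of_neg (by norm_num) (by linarith)
  have hq0 : 0 < q := by positivity
  have h1q : 0 < 1 - q := by linarith
  refine ⟨2 ^ γ / (1 - q), by positivity, fun D a g F hg hF hsum => ?_⟩
  set K : ℝ := 2 ^ γ / (1 - q) with hK
  have hK0 : 0 < K := by positivity
  have hKe : 2 ^ γ + K * q = K := by
    rw [hK]; field_simp; ring
  set M := D.sup (fun b => normInf (a - b)) with hM
  have main : ∀ k l : ℕ, 1 ≤ l → M ≤ 2 ^ k * l → ∑ b ∈ D.filter (fun b => l < normInf (a - b)),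
      (normInf (a - b) : ℝ) ^ (-s) * g b ≤ K * F * (l : ℝ) ^ (γ - s) := by
    intro k
    induction k with
    | zero =>
      intro l hl hM
      rw [Finset.filter_eq_empty_iff.2, Finset.sum_empty]
      · positivity
      · intro b hb
        have := Finset.le_sup (f := fun b => normInf (a - b)) hb
        omega
    | succ k ih =>
      intro l hl hM
      have hlR : (1 : ℝ) ≤ l := by exact_mod_cast hl
      have i1 := ih (2 * l) (by omega) (by rw [pow_succ] at hM; nlinarith)
      have hsub : D.filter (fun b => l < normInf (a - b)) ⊆
          D.filter (fun b => l < normInf (a - b) ∧ normInf (a - b) ≤ 2 * l) ∪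
            D.filter (fun b => 2 * l < normInf (a - b)) := by
        intro b hb
        simp only [Finset.mem_union, Finset.mem_filter] at hb ⊢
        by_cases h : normInf (a - b) ≤ 2 * l
        · exact Or.inl ⟨hb.1, hb.2, h⟩
        · exact Or.inr ⟨hb.1, by omega⟩
      have i2 : ∑ b ∈ D.filter (fun b => l < normInf (a - b) ∧ normInf (a - b) ≤ 2 * l),
          (normInf (a - b) : ℝ) ^ (-s) * g b ≤ 2 ^ γ * F * (l : ℝ) ^ (γ - s) := by
        calc _ ≤ ∑ b ∈ D.filter (fun b => l < normInf (a - b) ∧ normInf (a - b) ≤ 2 * l),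
              (l : ℝ) ^ (-s) * g b := by
              refine Finset.sum_le_sum fun b hb => ?_
              rw [Finset.mem_filter] at hb
              have h2 : (l : ℝ) ≤ normInf (a - b) := by exact_mod_cast hb.2.1.le
              exact mul_le_mul_of_nonneg_right (Real.rpow_le_rpow_of_nonpos (by positivity) h2
                (by linarith)) (hg b)
          _ ≤ (l : ℝ) ^ (-s) * (F * ((2 * l : ℕ) : ℝ) ^ γ) := by
              rw [← Finset.mul_sum]
              refine mul_le_mul_of_nonneg_left ?_ (by positivity)
              refine le_trans (Finset.sum_le_sum_of_subset_of_nonneg ?_ fun _ _ _ => hg _)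
                (hsum (2 * l) (by omega))
              intro b hb
              rw [Finset.mem_filter] at hb ⊢
              exact ⟨hb.1, hb.2.2⟩
          _ = _ := by
              push_cast
              rw [Real.mul_rpow (by norm_num) (by positivity), sub_eq_add_neg,
                Real.rpow_add (by linarith : (0 : ℝ) < l)]
              ring
      have e3 : ((2 * l : ℕ) : ℝ) ^ (γ - s) = q * (l : ℝ) ^ (γ - s) := by
        push_cast
        rw [Real.mul_rpow (by norm_num) (by positivity)]
      rw [e3] at i1
      calc _ ≤ ∑ b ∈ D.filter (fun b => l < normInf (a - b) ∧ normInf (a - b) ≤ 2 * l) ∪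
            D.filter (fun b => 2 * l < normInf (a - b)), (normInf (a - b) : ℝ) ^ (-s) * g b :=
            Finset.sum_le_sum_of_subset_of_nonneg hsub fun b _ _ =>
              mul_nonneg (by positivity) (hg b)
        _ ≤ ∑ b ∈ D.filter (fun b => l < normInf (a - b) ∧ normInf (a - b) ≤ 2 * l),
              (normInf (a - b) : ℝ) ^ (-s) * g b +
            ∑ b ∈ D.filter (fun b => 2 * l < normInf (a - b)),
              (normInf (a - b) : ℝ) ^ (-s) * g b := by
            rw [← Finset.sum_union_inter]
            exact le_add_of_nonneg_right (Finset.sum_nonneg fun b _ =>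
              mul_nonneg (by positivity) (hg b))
        _ ≤ 2 ^ γ * F * (l : ℝ) ^ (γ - s) + K * F * (q * (l : ℝ) ^ (γ - s)) := add_le_add i2 i1
        _ = (2 ^ γ + K * q) * F * (l : ℝ) ^ (γ - s) := by ring
        _ = _ := by rw [hKe]
  intro l hl
  refine main M l hl ?_
  have : M ≤ 2 ^ M := Nat.lt_two_pow_self.le
  nlinarith

/-- near/far splitting of the kernel `wt` -/
theorem split_wt {α : ℝ} (hα0 : 0 < α) (hα1 : α < 1) (hd : 1 ≤ d) : ∃ K : ℝ, 0 < K ∧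
    ∀ (B : ℝ), 0 < B → ∀ (D : Finset (V d)) (a : V d) (f : V d → ℝ) (G : ℝ) (R l : ℕ), 1 ≤ R →
    (∀ b, 0 ≤ f b) → 0 ≤ G → (∀ b, normInf (a - b) ≤ l → f b ≤ G) →
    ∑ b ∈ D, wt d α B R (normInf (a - b)) * f b ≤
      B * K * (l : ℝ) ^ (1 - α) / R * G +
      B * ∑ b ∈ D.filter (fun b => l < normInf (a - b)),
        (normInf (a - b) : ℝ) ^ (-((d : ℝ) + α)) * f b := by
  classical
  have hdR : (1 : ℝ) ≤ d := by exact_mod_cast hd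
  obtain ⟨K, hK, hnear⟩ := near_sum (d := d) ((d : ℝ) + α - 1) (by linarith) (by linarith)
  refine ⟨K, hK, fun B hB D a f G R l hR hf hG hfG => ?_⟩
  have hRR : (0 : ℝ) < R := by exact_mod_cast hR
  have e0 : (d : ℝ) - ((d : ℝ) + α - 1) = 1 - α := by ring
  rw [e0] at hnear
  rw [← Finset.sum_filter_add_sum_filter_not D (fun b => normInf (a - b) ≤ l)]
  refine add_le_add ?_ ?_
  · calc ∑ b ∈ D.filter (fun b => normInf (a - b) ≤ l), wt d α B R (normInf (a - b)) * f b
        ≤ ∑ b ∈ bl a l, wt d α B R (normInf (a - b)) * G := by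
          refine (Finset.sum_le_sum fun b hb => mul_le_mul_of_nonneg_left
            (hfG b (Finset.mem_filter.1 hb).2) (wt_nonneg hB.le)).trans ?_
          refine Finset.sum_le_sum_of_subset_of_nonneg ?_ fun b _ _ =>
            mul_nonneg (wt_nonneg hB.le) hG
          intro b hb
          rw [mem_bl, normInf_sub_comm]
          exact (Finset.mem_filter.1 hb).2
      _ = ∑ b ∈ (bl a l).erase a, wt d α B R (normInf (a - b)) * G := by
          rw [← Finset.sum_erase_add _ _ (mem_bl_self a l)]
          simp [wt, normInf_zero]
      _ ≤ ∑ b ∈ (bl a l).erase a, (B / R * G) *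
          (normInf (a - b) : ℝ) ^ (-((d : ℝ) + α - 1)) := by
          refine Finset.sum_le_sum fun b hb => ?_
          have hne : a ≠ b := (Finset.mem_erase.1 hb).1.symm
          have hn : (0 : ℝ) < normInf (a - b) := by exact_mod_cast normInf_sub_pos hne
          have e : (normInf (a - b) : ℝ) ^ (-((d : ℝ) + α - 1)) =
              (normInf (a - b) : ℝ) ^ (-((d : ℝ) + α)) * normInf (a - b) := by
            rw [show -((d : ℝ) + α - 1) = -((d : ℝ) + α) + 1 by ring, Real.rpow_add hn,
              Real.rpow_one]
          rw [e, wt]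
          calc _ ≤ B * (normInf (a - b) : ℝ) ^ (-((d : ℝ) + α)) * ((normInf (a - b) : ℝ) / R) * G := by
                gcongr
                exact min_le_right _ _
            _ = _ := by ring
      _ ≤ (B / R * G) * (K * (l : ℝ) ^ (1 - α)) := by
          rw [← Finset.mul_sum]
          exact mul_le_mul_of_nonneg_left (hnear a l) (by positivity)
      _ = _ := by ring
  · rw [Finset.mul_sum]
    have e : D.filter (fun b => ¬ normInf (a - b) ≤ l) = D.filter (fun b => l < normInf (a - b)) := by
      ext b; simp
    rw [e]
    refine Finset.sum_le_sum fun b _ => ?_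
    rw [← mul_assoc]
    refine mul_le_mul_of_nonneg_right ?_ (hf b)
    rw [wt]
    exact mul_le_of_le_one_right (by positivity) (min_le_left _ _)

end kernel
end LRP

open MeasureTheory ENNReal
namespace LRP

theorem exists_nat_rpow (c e δ : ℝ) (he : 0 < e) (hδ : 0 < δ) :
    ∃ K : ℕ, 1 ≤ K ∧ c * (K : ℝ) ^ (-e) ≤ δ := by
  have h1 : Filter.Tendsto (fun K : ℕ => c * (K : ℝ) ^ (-e)) Filter.atTop (nhds (c * 0)) :=
    ((tendsto_rpow_neg_atTop he).comp tendsto_natCast_atTop_atTop).const_mul c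
  rw [mul_zero] at h1
  have h2 := (h1.eventually (eventually_le_nhds hδ)).and (Filter.eventually_ge_atTop 1)
  obtain ⟨K, hK⟩ := h2.exists
  exact ⟨K, hK.2, hK.1⟩

section tstep
variable {d : ℕ} {α A B : ℝ} {p : Sym2 (V d) → ℝ≥0∞} {μ : Measure (Config d)}

theorem Setup.star_set (h : Setup d α A B p μ) (D S : Finset (V d)) (z : V d) {R : ℕ} (hR : 1 ≤ R)
    {T Q : ℝ} (hQ0 : 0 ≤ Q)
    (hT : ∑ a ∈ bl z (2 * R), tau μ (bl z (2 * R)) z a ≤ T)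
    (hQ : ∀ a ∈ bl z (2 * R), ∑ b ∈ D, wt d α B R (normInf (a - b)) * ∑ x ∈ S, tau μ D b x ≤ Q) :
    ∑ x ∈ S, tau μ D z x ≤ ∑ x ∈ S, tau μ (bl z (2 * R)) z x + T * Q := by
  haveI := h.cyl.prob
  refine (Finset.sum_le_sum fun x _ => h.star D z x hR).trans ?_
  rw [Finset.sum_add_distrib]
  refine add_le_add le_rfl ?_
  rw [Finset.sum_comm]
  calc _ = ∑ a ∈ bl z (2 * R), tau μ (bl z (2 * R)) z a *
        ∑ b ∈ D, wt d α B R (normInf (a - b)) * ∑ x ∈ S, tau μ D b x := by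
        refine Finset.sum_congr rfl fun a _ => ?_
        rw [← Finset.mul_sum, Finset.sum_comm]
        simp_rw [Finset.mul_sum]
    _ ≤ ∑ a ∈ bl z (2 * R), tau μ (bl z (2 * R)) z a * Q :=
        Finset.sum_le_sum fun a ha => mul_le_mul_of_nonneg_left (hQ a ha) tau_nonneg
    _ ≤ _ := by rw [← Finset.sum_mul]; exact mul_le_mul_of_nonneg_right hT hQ0

theorem Setup.cen2 (h : Setup d α A B p μ) (z : V d) {R : ℕ} (hR : 1 ≤ R) :
    ∑ y ∈ bl z (2 * R), tau μ (bl z (2 * R)) z y ≤ 2 * A * (R : ℝ) ^ α := by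
  refine (h.cen' z (by omega)).trans ?_
  push_cast
  rw [Real.mul_rpow (by norm_num) (by positivity)]
  have h2 : (2 : ℝ) ^ α ≤ 2 := by
    calc (2 : ℝ) ^ α ≤ 2 ^ (1 : ℝ) := Real.rpow_le_rpow_of_exponent_le (by norm_num) h.a1.le
      _ = 2 := Real.rpow_one 2
  have hA := h.A1
  have : (0 : ℝ) ≤ (R : ℝ) ^ α := by positivity
  calc A * (2 ^ α * (R : ℝ) ^ α) ≤ A * (2 * (R : ℝ) ^ α) := by gcongr
    _ = _ := by ring

theorem Setup.sum_out (h : Setup d α A B p μ) (L S : Finset (V d)) (z : V d) :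
    ∑ x ∈ S, tau μ L z x ≤ ∑ x ∈ L, tau μ L z x := by
  classical
  haveI := h.cyl.prob
  calc _ ≤ ∑ x ∈ S ∪ L, tau μ L z x :=
        Finset.sum_le_sum_of_subset_of_nonneg Finset.subset_union_left fun _ _ _ => tau_nonneg
    _ = _ := by
        symm
        refine Finset.sum_subset Finset.subset_union_right fun x _ hx => tau_eq_zero_right hx

theorem one_le_d (h : Setup d α A B p μ) : 1 ≤ d := by
  rcases Nat.eq_zero_or_pos d with h0 | h0
  · have h1 := h.ad; have h2 := h.a0
    rw [h0] at h1; simp at h1; linarith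
  · exact h0

def Val (α : ℝ) (μ : Measure (Config d)) (D : Finset (V d)) (F : ℝ) : Prop :=
  ∀ z w (r : ℕ), 1 ≤ r → ∑ y ∈ bl w r, tau μ D z y ≤ F * (r : ℝ) ^ α

theorem Val.filter [IsProbabilityMeasure μ] {D : Finset (V d)} {F : ℝ} (hF : Val α μ D F) (y a : V d) (ρ : ℕ) (hρ : 1 ≤ ρ) :
    ∑ b ∈ D.filter (fun b => normInf (a - b) ≤ ρ), tau μ D b y ≤ F * (ρ : ℝ) ^ α := by
  refine le_trans ?_ (hF y a ρ hρ)
  calc _ = ∑ b ∈ D.filter (fun b => normInf (a - b) ≤ ρ), tau μ D y b :=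
        Finset.sum_congr rfl fun b _ => tau_symm b y
    _ ≤ _ := by
        refine Finset.sum_le_sum_of_subset_of_nonneg ?_ fun _ _ _ => tau_nonneg
        intro b hb
        rw [mem_bl, normInf_sub_comm]
        exact (Finset.mem_filter.1 hb).2

theorem t_bound (d : ℕ) (α A B : ℝ) : ∃ F₀ : ℝ, 1 ≤ F₀ ∧ ∀ p (μ : Measure (Config d)),
    Setup d α A B p μ → ∀ D : Finset (V d), Val α μ D F₀ := by
  classical
  by_cases hex : ∃ (p : Sym2 (V d) → ℝ≥0∞) (μ : Measure (Config d)), Setup d α A B p μ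
  swap
  · exact ⟨1, le_rfl, fun p μ h => (hex ⟨p, μ, h⟩).elim⟩
  obtain ⟨p₀, μ₀, h₀⟩ := hex
  have a0 := h₀.a0
  have a1 := h₀.a1
  have ad := h₀.ad
  have A1 := h₀.A1
  have B0 := h₀.B0
  obtain ⟨Cn, hCn, hsplit⟩ := split_wt (d := d) a0 a1 (one_le_d h₀)
  obtain ⟨Ca, hCa, hfar⟩ := far_sum (d := d) ((d : ℝ) + α) α (by linarith) (by linarith)
  obtain ⟨K, hK1, hK⟩ := exists_nat_rpow (2 * A * B * Cn) (1 - α) (1 / 4) (by linarith) (by norm_num)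
  obtain ⟨M, hM1, hM⟩ := exists_nat_rpow (2 * A * B * 3 ^ d * Ca * (K : ℝ) ^ α) ((d : ℝ) - α) (1 / 4)
    (by linarith) (by norm_num)
  have hKR : (1 : ℝ) ≤ K := by exact_mod_cast hK1
  have hMR : (1 : ℝ) ≤ M := by exact_mod_cast hM1
  have hKM : (1 : ℝ) ≤ ((K : ℝ) * M) ^ α := Real.one_le_rpow (by nlinarith) a0.le
  refine ⟨4 * A * ((K : ℝ) * M) ^ α, by nlinarith, fun p μ h D => ?_⟩
  haveI := h.cyl.prob
  have step : ∀ F : ℝ, 0 ≤ F → Val α μ D F → Val α μ D (2 * A * ((K : ℝ) * M) ^ α + F / 2) := by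
    intro F hF0 hF z w r hr
    have hrR : (1 : ℝ) ≤ r := by exact_mod_cast hr
    have hl : 1 ≤ M * r := Nat.mul_pos hM1 hr
    have hR : 1 ≤ K * (M * r) := Nat.mul_pos hK1 hl
    set Q1 : ℝ := B * Cn * ((M * r : ℕ) : ℝ) ^ (1 - α) / ((K * (M * r) : ℕ) : ℝ) * (F * (r : ℝ) ^ α)
      with hQ1
    set Q2 : ℝ := B * ((3 * (r : ℝ)) ^ d * (Ca * F * ((M * r : ℕ) : ℝ) ^ (α - ((d : ℝ) + α)))) with hQ2
    have hQ : ∀ a ∈ bl z (2 * (K * (M * r))), ∑ b ∈ D, wt d α B (K * (M * r)) (normInf (a - b)) *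
        ∑ x ∈ bl w r, tau μ D b x ≤ Q1 + Q2 := by
      intro a _
      refine (hsplit B B0 D a (fun b => ∑ x ∈ bl w r, tau μ D b x) (F * (r : ℝ) ^ α) (K * (M * r))
        (M * r) hR (fun b => Finset.sum_nonneg fun _ _ => tau_nonneg) (by positivity)
        (fun b _ => hF b w r hr)).trans ?_
      refine add_le_add le_rfl (mul_le_mul_of_nonneg_left ?_ B0.le)
      simp_rw [Finset.mul_sum]
      rw [Finset.sum_comm]
      calc _ ≤ ∑ y ∈ bl w r, Ca * F * ((M * r : ℕ) : ℝ) ^ (α - ((d : ℝ) + α)) :=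
            Finset.sum_le_sum fun y _ => hfar D a (fun b => tau μ D b y) F (fun b => tau_nonneg) hF0
              (fun ρ hρ => hF.filter y a ρ hρ) (M * r) hl
        _ = (2 * (r : ℝ) + 1) ^ d * (Ca * F * ((M * r : ℕ) : ℝ) ^ (α - ((d : ℝ) + α))) := by
            rw [Finset.sum_const, card_bl, nsmul_eq_mul]; push_cast; ring
        _ ≤ _ := by gcongr; linarith
    have := h.star_set D (bl w r) z hR (by positivity) (h.cen2 z hR) hQ
    refine this.trans ?_
    have t1 := (h.sum_out (bl z (2 * (K * (M * r)))) (bl w r) z).trans (h.cen2 z hR)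
    have r0 : (0 : ℝ) < r := by linarith
    have M0 : (0 : ℝ) < M := by linarith
    have K0 : (0 : ℝ) < K := by linarith
    have eR : ((K * (M * r) : ℕ) : ℝ) ^ α = ((K : ℝ) * M) ^ α * (r : ℝ) ^ α := by
      push_cast
      rw [← mul_assoc, Real.mul_rpow (by positivity) (by positivity)]
    have e1 : 2 * A * ((K * (M * r) : ℕ) : ℝ) ^ α * Q1 =
        (2 * A * B * Cn * (K : ℝ) ^ (-(1 - α))) * (F * (r : ℝ) ^ α) := by
      rw [hQ1]
      push_cast
      rw [Real.mul_rpow (z := α) K0.le (by positivity)]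
      have l0 : (0 : ℝ) < M * r := by positivity
      set l : ℝ := (M : ℝ) * r
      rw [show -(1 - α) = α - 1 by ring, Real.rpow_sub K0, Real.rpow_sub l0, Real.rpow_one,
        Real.rpow_one]
      field_simp
    have e2 : 2 * A * ((K * (M * r) : ℕ) : ℝ) ^ α * Q2 =
        (2 * A * B * 3 ^ d * Ca * (K : ℝ) ^ α * (M : ℝ) ^ (-((d : ℝ) - α))) * (F * (r : ℝ) ^ α) := by
      rw [hQ2]
      push_cast
      rw [Real.mul_rpow (z := α) K0.le (by positivity), Real.mul_rpow (z := α) M0.le r0.le,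
        show α - ((d : ℝ) + α) = -(d : ℝ) by ring, Real.mul_rpow (z := -(d : ℝ)) M0.le r0.le,
        show -((d : ℝ) - α) = α + -(d : ℝ) by ring, Real.rpow_add M0, Real.rpow_neg M0.le,
        Real.rpow_neg r0.le, Real.rpow_natCast, Real.rpow_natCast, mul_pow]
      field_simp
    have hFr : 0 ≤ F * (r : ℝ) ^ α := by positivity
    rw [eR] at t1
    have e3 := mul_le_mul_of_nonneg_right hK hFr
    have e4 := mul_le_mul_of_nonneg_right hM hFr
    rw [mul_add, e1, e2]
    nlinarith
  have iter : ∀ k : ℕ, Val α μ D (4 * A * ((K : ℝ) * M) ^ α + (D.card : ℝ) / 2 ^ k) := by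
    intro k
    induction k with
    | zero =>
      intro z w r hr
      have hrR : (1 : ℝ) ≤ (r : ℝ) ^ α := Real.one_le_rpow (by exact_mod_cast hr) a0.le
      refine (h.sum_out D (bl w r) z).trans ?_
      have : ∑ x ∈ D, tau μ D z x ≤ D.card := by
        refine (Finset.sum_le_sum fun x _ => tau_le_one).trans ?_
        simp
      have h4 : 0 ≤ 4 * A * ((K : ℝ) * M) ^ α := by positivity
      have h5 : (0 : ℝ) ≤ D.card := by positivity
      rw [pow_zero, div_one]
      nlinarith
    | succ k ih =>
      have := step _ (by positivity) ih
      convert this using 1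
      rw [pow_succ]; field_simp; ring
  intro z w r hr
  have hlim : Filter.Tendsto (fun k : ℕ => (4 * A * ((K : ℝ) * M) ^ α + (D.card : ℝ) / 2 ^ k) *
      (r : ℝ) ^ α) Filter.atTop (nhds ((4 * A * ((K : ℝ) * M) ^ α + 0) * (r : ℝ) ^ α)) := by
    refine Filter.Tendsto.mul_const _ (Filter.Tendsto.const_add _ ?_)
    exact tendsto_const_nhds.div_atTop (tendsto_pow_atTop_atTop_of_one_lt (by norm_num))
  rw [add_zero] at hlim
  exact ge_of_tendsto' hlim fun k => iter k z w r hr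

end tstep
end LRP

open MeasureTheory ENNReal
namespace LRP

theorem point_step (d : ℕ) {α : ℝ} (a0 : 0 < α) (a1 : α < 1) (hd : 1 ≤ d) : ∃ Cn : ℝ, 0 < Cn ∧
    ∀ A B p (μ : Measure (Config d)), Setup d α A B p μ → ∀ (D : Finset (V d)) (z x : V d) (K n l : ℕ),
    1 ≤ K → 1 ≤ l → 8 * K * l ≤ n → n ≤ normInf (x - z) → ∀ T G H : ℝ, 0 ≤ G → 0 ≤ H →
    (∑ a ∈ bl z (2 * (K * l)), tau μ (bl z (2 * (K * l))) z a ≤ T) →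
    (∀ b, (n + 1) / 2 ≤ normInf (x - b) → tau μ D b x ≤ G) →
    (∀ a, ∑ b ∈ D.filter (fun b => l < normInf (a - b)),
        (normInf (a - b) : ℝ) ^ (-((d : ℝ) + α)) * tau μ D b x ≤ H) →
    tau μ D z x ≤ T * (B * Cn * (l : ℝ) ^ (1 - α) / ((K * l : ℕ) : ℝ) * G + B * H) := by
  obtain ⟨Cn, hCn, hsplit⟩ := split_wt (d := d) a0 a1 hd
  refine ⟨Cn, hCn, ?_⟩
  intro A B p μ h D z x K n l hK hl hn hx T G H hG hH hT hGb hHb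
  have B0 := h.B0
  have hR : 1 ≤ K * l := Nat.mul_pos hK hl
  have hlR : l ≤ K * l := Nat.le_mul_of_pos_left l hK
  have hn' : 8 * (K * l) ≤ n := by rw [← mul_assoc]; exact hn
  have hQ : ∀ a ∈ bl z (2 * (K * l)), ∑ b ∈ D, wt d α B (K * l) (normInf (a - b)) *
      ∑ y ∈ {x}, tau μ D b y ≤ B * Cn * (l : ℝ) ^ (1 - α) / ((K * l : ℕ) : ℝ) * G + B * H := by
    intro a ha
    rw [mem_bl] at ha
    simp_rw [Finset.sum_singleton]
    refine (hsplit B B0 D a (fun b => tau μ D b x) G (K * l) l hR (fun b => tau_nonneg) hG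
      (fun b hb => hGb b ?_)).trans ?_
    · have t1 := normInf_tri x b z
      have t2 := normInf_tri b a z
      rw [normInf_sub_comm b a] at t2
      omega
    · exact add_le_add le_rfl (mul_le_mul_of_nonneg_left (hHb a) B0.le)
  have := h.star_set D {x} z hR (by positivity) hT hQ
  rw [Finset.sum_singleton, Finset.sum_singleton, tau_eq_zero_right (D := bl z (2 * (K * l))), zero_add] at this
  · exact this
  · rw [mem_bl]; omega

theorem ell_bd {K n : ℕ} (hK : 1 ≤ K) (hn : 16 * K ≤ n) :
    1 ≤ n / (8 * K) ∧ 8 * K * (n / (8 * K)) ≤ n ∧ (n : ℝ) / (16 * K) ≤ ((n / (8 * K) : ℕ) : ℝ) := by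
  have h1 : 1 ≤ n / (8 * K) := by
    rw [Nat.one_le_div_iff (by omega)]; omega
  refine ⟨h1, Nat.mul_div_le _ _, ?_⟩
  have h2 := Nat.lt_mul_div_succ n (show 0 < 8 * K by omega)
  have h3 : n ≤ 16 * K * (n / (8 * K)) := by nlinarith
  have hKR : (0 : ℝ) < 16 * K := by exact_mod_cast (by omega : 0 < 16 * K)
  rw [div_le_iff₀ hKR]
  have : (n : ℝ) ≤ 16 * K * ((n / (8 * K) : ℕ) : ℝ) := by exact_mod_cast h3
  linarith

theorem ell_rpow {K n : ℕ} (hK : 1 ≤ K) (hn : 16 * K ≤ n) {e : ℝ} (he : 0 ≤ e) :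
    ((n / (8 * K) : ℕ) : ℝ) ^ (-e) ≤ (16 * (K : ℝ)) ^ e * (n : ℝ) ^ (-e) := by
  have h := (ell_bd hK hn).2.2
  have hKR : (0 : ℝ) < 16 * K := by exact_mod_cast (by omega : 0 < 16 * K)
  have hnR : (0 : ℝ) < n := by exact_mod_cast (by omega : 0 < n)
  calc _ ≤ ((n : ℝ) / (16 * K)) ^ (-e) :=
        Real.rpow_le_rpow_of_nonpos (by positivity) h (by linarith)
    _ = _ := by
        rw [Real.div_rpow hnR.le hKR.le, Real.rpow_neg hKR.le]; field_simp

theorem half_rpow {n : ℕ} (hn : 1 ≤ n) {e : ℝ} (he : 0 ≤ e) :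
    (((n + 1) / 2 : ℕ) : ℝ) ^ (-e) ≤ 2 ^ e * (n : ℝ) ^ (-e) := by
  have hnR : (0 : ℝ) < n := by exact_mod_cast hn
  have h : (n : ℝ) / 2 ≤ (((n + 1) / 2 : ℕ) : ℝ) := by
    have : n ≤ 2 * ((n + 1) / 2) := by omega
    have : (n : ℝ) ≤ 2 * (((n + 1) / 2 : ℕ) : ℝ) := by exact_mod_cast this
    linarith
  calc _ ≤ ((n : ℝ) / 2) ^ (-e) :=
        Real.rpow_le_rpow_of_nonpos (by positivity) h (by linarith)
    _ = _ := by
        rw [Real.div_rpow hnR.le (by norm_num), Real.rpow_neg (by norm_num : (0:ℝ) ≤ 2)]; field_simp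

theorem one_le_rp {K n : ℕ} (hn : 1 ≤ n) (h : n < 16 * K) {e : ℝ} (he : 0 ≤ e) :
    1 ≤ (16 * (K : ℝ)) ^ e * (n : ℝ) ^ (-e) := by
  have hnR : (0 : ℝ) < n := by exact_mod_cast hn
  have h' : (n : ℝ) ≤ 16 * K := by exact_mod_cast h.le
  rw [Real.rpow_neg hnR.le, ← div_eq_mul_inv, one_le_div (by positivity)]
  exact Real.rpow_le_rpow hnR.le h' he

theorem g_bound (d : ℕ) (α A B : ℝ) : ∃ C₁ : ℝ, 0 < C₁ ∧ ∀ p (μ : Measure (Config d)),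
    Setup d α A B p μ → ∀ (D : Finset (V d)) (n : ℕ), 1 ≤ n → ∀ z x : V d, n ≤ normInf (x - z) →
      tau μ D z x ≤ C₁ * (n : ℝ) ^ (-((d : ℝ) - α)) := by
  classical
  by_cases hex : ∃ (p : Sym2 (V d) → ℝ≥0∞) (μ : Measure (Config d)), Setup d α A B p μ
  swap
  · exact ⟨1, one_pos, fun p μ h => (hex ⟨p, μ, h⟩).elim⟩
  obtain ⟨p₀, μ₀, h₀⟩ := hex
  have a0 := h₀.a0
  have a1 := h₀.a1
  have ad := h₀.ad
  have A1 := h₀.A1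
  have B0 := h₀.B0
  obtain ⟨Cn, hCn, hstep⟩ := point_step d a0 a1 (one_le_d h₀)
  obtain ⟨Ca, hCa, hfar⟩ := far_sum (d := d) ((d : ℝ) + α) α (by linarith) (by linarith)
  obtain ⟨F, hF1, hF⟩ := t_bound d α A B
  obtain ⟨K, hK1, hK⟩ := exists_nat_rpow (2 * A * B * Cn * 2 ^ ((d : ℝ) - α)) (1 - α) (1 / 2)
    (by linarith) (by norm_num)
  have hKR : (0 : ℝ) < K := by exact_mod_cast hK1
  have A0 : 0 < A := by linarith
  have F0 : 0 < F := by linarith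
  set C₁ : ℝ := (16 * (K : ℝ)) ^ ((d : ℝ) - α) * (1 + 4 * A * B * Ca * F * (K : ℝ) ^ α) with hC₁
  have hC0 : 0 < C₁ := by positivity
  refine ⟨C₁, hC0, fun p μ h D n => ?_⟩
  haveI := h.cyl.prob
  induction n using Nat.strong_induction_on with
  | _ n ih =>
    intro hn z x hx
    have hnR : (0 : ℝ) < n := by exact_mod_cast hn
    have he : 0 ≤ (d : ℝ) - α := by linarith
    by_cases hs : n < 16 * K
    · refine tau_le_one.trans ((one_le_rp hn hs he).trans ?_)
      rw [hC₁]
      have : (1 : ℝ) ≤ 1 + 4 * A * B * Ca * F * (K : ℝ) ^ α := le_add_of_nonneg_right (by positivity)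
      refine mul_le_mul_of_nonneg_right ?_ (by positivity)
      exact le_mul_of_one_le_right (by positivity) this
    push Not at hs
    obtain ⟨hl1, hl2, -⟩ := ell_bd hK1 hs
    have hlr := ell_rpow hK1 hs he
    have hhr := half_rpow hn he
    set l := n / (8 * K) with hl
    have hlR : (0 : ℝ) < l := by exact_mod_cast hl1
    have hb := hstep A B p μ h D z x K n l hK1 hl1 hl2 hx (2 * A * ((K * l : ℕ) : ℝ) ^ α)
      (C₁ * (((n + 1) / 2 : ℕ) : ℝ) ^ (-((d : ℝ) - α)))
      (Ca * F * (l : ℝ) ^ (α - ((d : ℝ) + α))) (by positivity) (by positivity)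
      (h.cen2 z (Nat.mul_pos hK1 hl1))
      (fun b hb => ih ((n + 1) / 2) (by omega) (by omega) b x hb)
      (fun a => hfar D a (fun b => tau μ D b x) F (fun b => tau_nonneg) F0.le
        (fun ρ hρ => (hF p μ h D).filter x a ρ hρ) l hl1)
    refine hb.trans ?_
    have e1 : 2 * A * ((K * l : ℕ) : ℝ) ^ α * (B * Cn * (l : ℝ) ^ (1 - α) / ((K * l : ℕ) : ℝ) *
        (C₁ * (((n + 1) / 2 : ℕ) : ℝ) ^ (-((d : ℝ) - α)))) =
        2 * A * B * Cn * (K : ℝ) ^ (-(1 - α)) * C₁ * (((n + 1) / 2 : ℕ) : ℝ) ^ (-((d : ℝ) - α)) := by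
      rw [Nat.cast_mul, Real.mul_rpow (z := α) hKR.le hlR.le, show -(1 - α) = α - 1 by ring,
        Real.rpow_sub hKR, Real.rpow_sub hlR, Real.rpow_one, Real.rpow_one]
      field_simp
    have e2 : 2 * A * ((K * l : ℕ) : ℝ) ^ α * (B * (Ca * F * (l : ℝ) ^ (α - ((d : ℝ) + α)))) =
        2 * A * B * Ca * F * (K : ℝ) ^ α * (l : ℝ) ^ (-((d : ℝ) - α)) := by
      rw [Nat.cast_mul, Real.mul_rpow (z := α) hKR.le hlR.le,
        show α - ((d : ℝ) + α) = -(d : ℝ) by ring,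
        show -((d : ℝ) - α) = α + -(d : ℝ) by ring, Real.rpow_add hlR]
      ring
    rw [mul_add, e1, e2]
    calc _ ≤ 2 * A * B * Cn * (K : ℝ) ^ (-(1 - α)) * C₁ * (2 ^ ((d : ℝ) - α) * (n : ℝ) ^ (-((d : ℝ) - α)))
          + 2 * A * B * Ca * F * (K : ℝ) ^ α * ((16 * (K : ℝ)) ^ ((d : ℝ) - α) * (n : ℝ) ^ (-((d : ℝ) - α))) := by
          gcongr
      _ = (2 * A * B * Cn * 2 ^ ((d : ℝ) - α) * (K : ℝ) ^ (-(1 - α))) * (C₁ * (n : ℝ) ^ (-((d : ℝ) - α)))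
          + 2 * A * B * Ca * F * (K : ℝ) ^ α * (16 * (K : ℝ)) ^ ((d : ℝ) - α) * (n : ℝ) ^ (-((d : ℝ) - α)) := by
          ring
      _ ≤ (1 / 2) * (C₁ * (n : ℝ) ^ (-((d : ℝ) - α))) + 2 * A * B * Ca * F * (K : ℝ) ^ α *
            (16 * (K : ℝ)) ^ ((d : ℝ) - α) * (n : ℝ) ^ (-((d : ℝ) - α)) := by
          gcongr
      _ ≤ _ := by
          have : 0 ≤ (16 * (K : ℝ)) ^ ((d : ℝ) - α) * (n : ℝ) ^ (-((d : ℝ) - α)) := by positivity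
          have e : C₁ * (n : ℝ) ^ (-((d : ℝ) - α)) = (16 * (K : ℝ)) ^ ((d : ℝ) - α) *
            (n : ℝ) ^ (-((d : ℝ) - α)) + 2 * (2 * A * B * Ca * F * (K : ℝ) ^ α *
            (16 * (K : ℝ)) ^ ((d : ℝ) - α) * (n : ℝ) ^ (-((d : ℝ) - α))) := by rw [hC₁]; ring
          linarith

theorem q_bound (d : ℕ) (α A B c1 c2 : ℝ) (hc1 : 0 < c1) (hc2 : 0 < c2) : ∃ C₂ : ℝ, 0 < C₂ ∧
    ∀ p (μ : Measure (Config d)), Setup d α A B p μ → ∀ (X : ℝ) (ξ : ℕ), 1 ≤ X → 1 ≤ ξ →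
    X ≤ c1 * (ξ : ℝ) ^ α → (ξ : ℝ) ^ α ≤ c2 * X →
    (∀ (D : Finset (V d)) (z : V d), ∑ y ∈ D, tau μ D z y ≤ X) →
    ∀ (D : Finset (V d)) (n : ℕ), 1 ≤ n → ∀ z x : V d, n ≤ normInf (x - z) →
      tau μ D z x ≤ C₂ * X ^ 2 * (n : ℝ) ^ (-((d : ℝ) + α)) := by
  classical
  by_cases hex : ∃ (p : Sym2 (V d) → ℝ≥0∞) (μ : Measure (Config d)), Setup d α A B p μ
  swap
  · exact ⟨1, one_pos, fun p μ h => (hex ⟨p, μ, h⟩).elim⟩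
  obtain ⟨p₀, μ₀, h₀⟩ := hex
  have a0 := h₀.a0
  have a1 := h₀.a1
  have ad := h₀.ad
  have B0 := h₀.B0
  obtain ⟨Cn, hCn, hstep⟩ := point_step d a0 a1 (one_le_d h₀)
  obtain ⟨C₁, hC₁, hg⟩ := g_bound d α A B
  obtain ⟨K, hK1, hK⟩ := exists_nat_rpow (c1 * B * Cn * 16 ^ α * 2 ^ ((d : ℝ) + α)) (1 - α) (1 / 2)
    (by linarith) (by norm_num)
  have hKR : (0 : ℝ) < K := by exact_mod_cast hK1
  set C₂ : ℝ := C₁ * c2 ^ 2 + (16 * (K : ℝ)) ^ ((d : ℝ) + α) * (1 + 2 * B) with hC₂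
  have hC0 : 0 < C₂ := by positivity
  refine ⟨C₂, hC0, fun p μ h X ξ hX hξ hX1 hX2 hsum D n => ?_⟩
  haveI := h.cyl.prob
  have X0 : 0 < X := by linarith
  induction n using Nat.strong_induction_on with
  | _ n ih =>
    intro hn z x hx
    have hnR : (0 : ℝ) < n := by exact_mod_cast hn
    have he : 0 ≤ (d : ℝ) + α := by linarith
    by_cases hnξ : n ≤ ξ
    · refine (hg p μ h D n hn z x hx).trans ?_
      have e : (n : ℝ) ^ (-((d : ℝ) - α)) = ((n : ℝ) ^ α) ^ 2 * (n : ℝ) ^ (-((d : ℝ) + α)) := by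
        rw [sq, ← Real.rpow_add hnR, ← Real.rpow_add hnR]; congr 1; ring
      rw [e]
      have h1 : (n : ℝ) ^ α ≤ c2 * X :=
        (Real.rpow_le_rpow hnR.le (by exact_mod_cast hnξ) a0.le).trans hX2
      calc _ ≤ C₁ * ((c2 * X) ^ 2 * (n : ℝ) ^ (-((d : ℝ) + α))) := by gcongr
        _ = C₁ * c2 ^ 2 * X ^ 2 * (n : ℝ) ^ (-((d : ℝ) + α)) := by ring
        _ ≤ _ := by
          gcongr
          rw [hC₂]
          exact le_add_of_nonneg_right (by positivity)
    push Not at hnξ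
    by_cases hs : n < 16 * K
    · refine tau_le_one.trans ((one_le_rp hn hs he).trans ?_)
      refine mul_le_mul_of_nonneg_right ?_ (by positivity)
      have h1 : (1 : ℝ) ≤ X ^ 2 := one_le_pow₀ hX
      have h2 : (16 * (K : ℝ)) ^ ((d : ℝ) + α) ≤ C₂ := by
        have t : 0 < (16 * (K : ℝ)) ^ ((d : ℝ) + α) := by positivity
        have t2 : 0 < C₁ * c2 ^ 2 := by positivity
        rw [hC₂]; nlinarith
      nlinarith
    push Not at hs
    obtain ⟨hl1, hl2, -⟩ := ell_bd hK1 hs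
    have hlr := ell_rpow hK1 hs he
    have hlr2 := ell_rpow hK1 hs a0.le
    have hhr := half_rpow hn he
    set l := n / (8 * K) with hl
    have hlR : (0 : ℝ) < l := by exact_mod_cast hl1
    have hb := hstep A B p μ h D z x K n l hK1 hl1 hl2 hx X
      (C₂ * X ^ 2 * (((n + 1) / 2 : ℕ) : ℝ) ^ (-((d : ℝ) + α)))
      ((l : ℝ) ^ (-((d : ℝ) + α)) * X) (by positivity) (by positivity)
      (hsum _ z)
      (fun b hb => ih ((n + 1) / 2) (by omega) (by omega) b x hb)
      (fun a => by
        calc _ ≤ ∑ b ∈ D.filter (fun b => l < normInf (a - b)),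
              (l : ℝ) ^ (-((d : ℝ) + α)) * tau μ D b x := by
              refine Finset.sum_le_sum fun b hb => ?_
              rw [Finset.mem_filter] at hb
              have h2 : (l : ℝ) ≤ normInf (a - b) := by exact_mod_cast hb.2.le
              exact mul_le_mul_of_nonneg_right (Real.rpow_le_rpow_of_nonpos (by positivity) h2
                (by linarith)) tau_nonneg
          _ ≤ _ := by
              rw [← Finset.mul_sum]
              refine mul_le_mul_of_nonneg_left ?_ (by positivity)
              refine le_trans (Finset.sum_le_sum_of_subset_of_nonneg (Finset.filter_subset _ _)
                fun _ _ _ => tau_nonneg) ?_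
              refine le_trans (le_of_eq (Finset.sum_congr rfl fun b _ => tau_symm b x)) (hsum D x))
    refine hb.trans ?_
    have hXn : X ≤ c1 * (n : ℝ) ^ α := hX1.trans (by
      have : (ξ : ℝ) ≤ n := by exact_mod_cast hnξ.le
      gcongr)
    have e1 : X * (B * Cn * (l : ℝ) ^ (1 - α) / ((K * l : ℕ) : ℝ) *
        (C₂ * X ^ 2 * (((n + 1) / 2 : ℕ) : ℝ) ^ (-((d : ℝ) + α)))) =
        X * B * Cn * (K : ℝ)⁻¹ * (l : ℝ) ^ (-α) * (C₂ * X ^ 2) *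
          (((n + 1) / 2 : ℕ) : ℝ) ^ (-((d : ℝ) + α)) := by
      rw [Nat.cast_mul, Real.rpow_sub hlR, Real.rpow_one, Real.rpow_neg hlR.le]
      field_simp
    rw [mul_add, e1]
    calc _ ≤ (c1 * (n : ℝ) ^ α) * B * Cn * (K : ℝ)⁻¹ * ((16 * (K : ℝ)) ^ α * (n : ℝ) ^ (-α)) *
            (C₂ * X ^ 2) * (2 ^ ((d : ℝ) + α) * (n : ℝ) ^ (-((d : ℝ) + α)))
          + X * (B * (((16 * (K : ℝ)) ^ ((d : ℝ) + α) * (n : ℝ) ^ (-((d : ℝ) + α))) * X)) := by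
          gcongr
      _ = (c1 * B * Cn * 16 ^ α * 2 ^ ((d : ℝ) + α) * (K : ℝ) ^ (-(1 - α))) *
            (C₂ * X ^ 2 * (n : ℝ) ^ (-((d : ℝ) + α)))
          + B * (16 * (K : ℝ)) ^ ((d : ℝ) + α) * X ^ 2 * (n : ℝ) ^ (-((d : ℝ) + α)) := by
          rw [show -(1 - α) = α - 1 by ring, Real.rpow_sub hKR, Real.rpow_one,
            Real.mul_rpow (z := α) (by norm_num) hKR.le, Real.rpow_neg hnR.le α]
          field_simp
      _ ≤ (1 / 2) * (C₂ * X ^ 2 * (n : ℝ) ^ (-((d : ℝ) + α))) +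
            B * (16 * (K : ℝ)) ^ ((d : ℝ) + α) * X ^ 2 * (n : ℝ) ^ (-((d : ℝ) + α)) := by
          gcongr
      _ ≤ _ := by
          have t1 : 0 ≤ C₁ * c2 ^ 2 * (X ^ 2 * (n : ℝ) ^ (-((d : ℝ) + α))) := by positivity
          have t2 : 0 ≤ (16 * (K : ℝ)) ^ ((d : ℝ) + α) * (X ^ 2 * (n : ℝ) ^ (-((d : ℝ) + α))) := by
            positivity
          have e : C₂ * X ^ 2 * (n : ℝ) ^ (-((d : ℝ) + α)) =
              C₁ * c2 ^ 2 * (X ^ 2 * (n : ℝ) ^ (-((d : ℝ) + α))) +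
              (16 * (K : ℝ)) ^ ((d : ℝ) + α) * (X ^ 2 * (n : ℝ) ^ (-((d : ℝ) + α))) +
              2 * (B * (16 * (K : ℝ)) ^ ((d : ℝ) + α) * X ^ 2 * (n : ℝ) ^ (-((d : ℝ) + α))) := by
            rw [hC₂]; ring
          linarith
end LRP

open MeasureTheory ENNReal
namespace LRP

theorem xi_low (d : ℕ) (α A B : ℝ) : ∃ c2 : ℝ, 0 < c2 ∧
    ∀ p (μ : Measure (Config d)), Setup d α A B p μ → ∀ (X : ℝ) (ξ : ℕ), 1 ≤ X → 1 ≤ ξ →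
    (∀ (D : Finset (V d)) (z : V d), ∑ y ∈ D, tau μ D z y ≤ X) →
    (∀ ε : ℝ, 0 < ε → ∃ D : Finset (V d), X - ε ≤ ∑ y ∈ D, tau μ D 0 y) →
    (∀ m : ℕ, 1 ≤ m → m < ξ → ∑ y ∈ bl 0 m, tau μ (bl 0 m) 0 y ≤ X / 2) →
    (ξ : ℝ) ^ α ≤ c2 * X := by
  classical
  by_cases hex : ∃ (p : Sym2 (V d) → ℝ≥0∞) (μ : Measure (Config d)), Setup d α A B p μ
  swap
  · exact ⟨1, one_pos, fun p μ h => (hex ⟨p, μ, h⟩).elim⟩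
  obtain ⟨p₀, μ₀, h₀⟩ := hex
  have a0 := h₀.a0
  have a1 := h₀.a1
  have ad := h₀.ad
  have B0 := h₀.B0
  obtain ⟨Cn, hCn, hsplit⟩ := split_wt (d := d) a0 a1 (one_le_d h₀)
  obtain ⟨Cd, hCd, hfar⟩ := far_sum (d := d) ((d : ℝ) + α) d (by linarith) (by linarith)
  set Cw : ℝ := B * Cn + B * Cd * 3 ^ d with hCw
  have hCw0 : 0 < Cw := by positivity
  refine ⟨4 * (Cw + 1), by positivity, fun p μ h X ξ hX hξ hsum hsup hhalf => ?_⟩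
  haveI := h.cyl.prob
  have X0 : 0 < X := by linarith
  have h4 : (4 : ℝ) ^ α ≤ 4 := by
    calc (4 : ℝ) ^ α ≤ 4 ^ (1 : ℝ) := Real.rpow_le_rpow_of_exponent_le (by norm_num) a1.le
      _ = 4 := Real.rpow_one 4
  by_cases hs : ξ ≤ 4
  · have : (ξ : ℝ) ≤ 4 := by exact_mod_cast hs
    calc (ξ : ℝ) ^ α ≤ 4 ^ α := Real.rpow_le_rpow (by positivity) this a0.le
      _ ≤ 4 := h4
      _ ≤ _ := by nlinarith
  push Not at hs
  set R := (ξ - 1) / 2 with hRd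
  have hR : 1 ≤ R := by omega
  have hRR : (0 : ℝ) < R := by exact_mod_cast hR
  have hξR : ξ ≤ 4 * R := by omega
  have hL := hhalf (2 * R) (by omega) (by omega)
  set W : ℝ := Cw * (R : ℝ) ^ (-α) with hW
  have hW0 : 0 < W := by positivity
  have key : ∀ ε : ℝ, 0 < ε → X - ε ≤ X / 2 + X / 2 * (W * X) := by
    intro ε hε
    obtain ⟨D, hD⟩ := hsup ε hε
    refine hD.trans ?_
    refine (h.star_set D D 0 hR (Q := W * X) (by positivity) hL ?_).trans ?_
    · intro a _
      refine (hsplit B B0 D a (fun b => ∑ x ∈ D, tau μ D b x) X R R hR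
        (fun b => Finset.sum_nonneg fun _ _ => tau_nonneg) X0.le (fun b _ => hsum D b)).trans ?_
      have hf := hfar D a (fun b => ∑ x ∈ D, tau μ D b x) (3 ^ d * X)
        (fun b => Finset.sum_nonneg fun _ _ => tau_nonneg) (by positivity) (fun ρ hρ => by
          have hρR : (1 : ℝ) ≤ ρ := by exact_mod_cast hρ
          calc _ ≤ ∑ b ∈ bl a ρ, X := by
                refine (Finset.sum_le_sum fun b _ => hsum D b).trans ?_
                refine Finset.sum_le_sum_of_subset_of_nonneg ?_ fun _ _ _ => X0.le
                intro b hb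
                rw [mem_bl, normInf_sub_comm]
                exact (Finset.mem_filter.1 hb).2
            _ = (2 * (ρ : ℝ) + 1) ^ d * X := by
                rw [Finset.sum_const, card_bl, nsmul_eq_mul]; push_cast; ring
            _ ≤ (3 * (ρ : ℝ)) ^ d * X := by gcongr; linarith
            _ = _ := by rw [mul_pow, Real.rpow_natCast]; ring) R hR
      refine (add_le_add le_rfl (mul_le_mul_of_nonneg_left hf B0.le)).trans (le_of_eq ?_)
      rw [hW, hCw, show (d : ℝ) - ((d : ℝ) + α) = -α by ring, Real.rpow_sub hRR, Real.rpow_one,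
        Real.rpow_neg hRR.le]
      field_simp
    · exact add_le_add ((h.sum_out _ D 0).trans hL) le_rfl
  have key2 : X ≤ X / 2 + X / 2 * (W * X) := by
    refine le_of_forall_pos_le_add fun ε hε => ?_
    have := key ε hε
    linarith
  have key3 : 1 ≤ W * X := by
    by_contra hc
    push Not at hc
    nlinarith
  have key4 : (R : ℝ) ^ α ≤ Cw * X := by
    have hRa : (0 : ℝ) < (R : ℝ) ^ α := by positivity
    rw [hW, Real.rpow_neg hRR.le] at key3
    calc (R : ℝ) ^ α = (R : ℝ) ^ α * 1 := by ring
      _ ≤ (R : ℝ) ^ α * (Cw * ((R : ℝ) ^ α)⁻¹ * X) := by gcongr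
      _ = _ := by field_simp
  have : (ξ : ℝ) ≤ 4 * R := by exact_mod_cast hξR
  calc (ξ : ℝ) ^ α ≤ (4 * (R : ℝ)) ^ α := Real.rpow_le_rpow (by positivity) this a0.le
    _ = 4 ^ α * (R : ℝ) ^ α := Real.mul_rpow (by norm_num) hRR.le
    _ ≤ 4 * (Cw * X) := by gcongr
    _ ≤ _ := by nlinarith

section lim
variable {d : ℕ} {μ : Measure (Config d)}

theorem conn_ball {ω : Config d} {x y : V d} (h : conn ω x y) :
    ∃ N : ℕ, connIn ω ((bl 0 N : Finset (V d)) : Set (V d)) x y := by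
  induction h with
  | refl => exact ⟨normInf x, connIn_refl (by rw [Finset.mem_coe, mem_bl, sub_zero])⟩
  | @tail b c _ hbc ih =>
    obtain ⟨N, hN⟩ := ih
    refine ⟨max N (normInf c), connIn_trans (connIn_mono ?_ hN) (connIn_adj ?_ ?_ hbc)⟩
    · exact_mod_cast bl_mono 0 (le_max_left _ _)
    · exact bl_mono 0 (le_max_left _ _) hN.2.1
    · rw [Finset.mem_coe, mem_bl, sub_zero]; exact le_max_right _ _

theorem tau_tendsto [IsProbabilityMeasure μ] (x y : V d) :
    Filter.Tendsto (fun N : ℕ => tau μ (bl 0 N) x y) Filter.atTop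
      (nhds (μ.real {ω | conn ω x y})) := by
  have e : {ω : Config d | conn ω x y} = ⋃ N : ℕ, {ω | connIn ω ((bl 0 N : Finset (V d)) : Set (V d)) x y} := by
    ext ω
    simp only [Set.mem_setOf_eq, Set.mem_iUnion]
    exact ⟨conn_ball, fun ⟨N, hN⟩ => connIn_conn hN⟩
  rw [e]
  have hm : Monotone fun N : ℕ => {ω : Config d | connIn ω ((bl 0 N : Finset (V d)) : Set (V d)) x y} :=
    fun N M hNM ω hω => connIn_mono (by exact_mod_cast bl_mono 0 hNM) hω
  exact (ENNReal.tendsto_toReal (measure_ne_top _ _)).comp (tendsto_measure_iUnion_atTop hm)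

theorem tau_le_conn [IsProbabilityMeasure μ] (D : Finset (V d)) (x y : V d) :
    tau μ D x y ≤ μ.real {ω | conn ω x y} := by
  refine measureReal_mono ?_ (measure_ne_top _ _)
  intro ω hω
  exact connIn_conn hω

end lim

section fin
variable {d : ℕ} {α A B β : ℝ} {p : Sym2 (V d) → ℝ≥0∞} {P : ℝ → Measure (Config d)}

theorem tp_ofReal [IsProbabilityMeasure (P β)] (x y : V d) :
    twoPoint P β x y = ENNReal.ofReal ((P β).real {ω | conn ω x y}) := by
  rw [twoPoint, measureReal_def, ENNReal.ofReal_toReal (measure_ne_top _ _)]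

theorem sum_ofReal [IsProbabilityMeasure (P β)] (S : Finset (V d)) :
    ∑ x ∈ S, twoPoint P β 0 x = ENNReal.ofReal (∑ x ∈ S, (P β).real {ω | conn ω 0 x}) := by
  rw [ENNReal.ofReal_sum_of_nonneg fun _ _ => measureReal_nonneg]
  exact Finset.sum_congr rfl fun x _ => tp_ofReal 0 x

theorem boxSum_eq (n : ℕ) : boxSum P β n = ∑ x ∈ bl 0 n, twoPoint P β 0 x := by
  rw [boxSum, tsum_eq_sum (s := bl 0 n)]
  · refine Finset.sum_congr rfl fun x hx => ?_
    rw [mem_bl, sub_zero] at hx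
    rw [if_pos hx]
  · intro x hx
    rw [mem_bl, sub_zero] at hx
    rw [if_neg hx]

theorem sum_le_chi [IsProbabilityMeasure (P β)] (hχ : chi P β ≠ ⊤) (S : Finset (V d)) :
    ∑ x ∈ S, (P β).real {ω | conn ω 0 x} ≤ (chi P β).toReal := by
  have h1 : ∑ x ∈ S, twoPoint P β 0 x ≤ chi P β := ENNReal.sum_le_tsum S
  rw [sum_ofReal] at h1
  exact (ENNReal.ofReal_le_iff_le_toReal hχ).1 h1

theorem Setup.sum_le (h : Setup d α A B p (P β)) (hχ : chi P β ≠ ⊤) (D : Finset (V d)) (z : V d) :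
    ∑ y ∈ D, tau (P β) D z y ≤ (chi P β).toReal := by
  haveI := h.cyl.prob
  have e : D = trs z (trs (-z) D) := by
    ext x
    simp [mem_trs]
  rw [e, sum_trs]
  refine le_trans (Finset.sum_le_sum fun y _ => ?_) (sum_le_chi hχ (trs (-z) D))
  have := tau_trs h.cyl h.le1 h.tr z (trs (-z) D) 0 y
  rw [zero_add] at this
  rw [this]
  exact tau_le_conn _ _ _

theorem Setup.tend (h : Setup d α A B p (P β)) (S : Finset (V d)) :
    Filter.Tendsto (fun N : ℕ => ∑ x ∈ S, tau (P β) (bl 0 N) 0 x) Filter.atTop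
      (nhds (∑ x ∈ S, (P β).real {ω | conn ω 0 x})) := by
  haveI := h.cyl.prob
  exact tendsto_finsetSum _ fun x _ => tau_tendsto 0 x

theorem Setup.sup (h : Setup d α A B p (P β)) (hχ : chi P β ≠ ⊤) {ε : ℝ} (hε : 0 < ε) :
    ∃ D : Finset (V d), (chi P β).toReal - ε ≤ ∑ y ∈ D, tau (P β) D 0 y := by
  haveI := h.cyl.prob
  have hs : HasSum (fun x => twoPoint P β 0 x) (chi P β) := ENNReal.summable.hasSum
  have h1 := (ENNReal.tendsto_toReal hχ).comp hs
  have h2 : ∃ S : Finset (V d), (chi P β).toReal - ε / 2 < ∑ x ∈ S, (P β).real {ω | conn ω 0 x} := by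
    obtain ⟨S, hS⟩ := (h1.eventually (lt_mem_nhds (show (chi P β).toReal - ε / 2 < (chi P β).toReal by
      linarith))).exists
    refine ⟨S, ?_⟩
    simp only [Function.comp] at hS
    rwa [sum_ofReal, ENNReal.toReal_ofReal (Finset.sum_nonneg fun _ _ => measureReal_nonneg)] at hS
  obtain ⟨S, hS⟩ := h2
  obtain ⟨N, hN⟩ := ((h.tend S).eventually (lt_mem_nhds hS)).exists
  refine ⟨bl 0 N, ?_⟩
  have := h.sum_out (bl 0 N) S 0
  linarith

theorem second_bound (d : ℕ) (α A B : ℝ) : ∃ C₂ : ℝ, 0 < C₂ ∧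
    ∀ p (P : ℝ → Measure (Config d)) (β : ℝ), Setup d α A B p (P β) → chi P β ≠ ⊤ →
    xi P β ≠ ⊤ → ∀ (D : Finset (V d)) (n : ℕ), 1 ≤ n → ∀ z x : V d, n ≤ normInf (x - z) →
      tau (P β) D z x ≤ C₂ * (chi P β).toReal ^ 2 * (n : ℝ) ^ (-((d : ℝ) + α)) := by
  classical
  obtain ⟨F, hF1, hF⟩ := t_bound d α A B
  obtain ⟨c2, hc2, hlow⟩ := xi_low d α A B
  obtain ⟨C₂, hC₂, hq⟩ := q_bound d α A B (2 * F) c2 (by linarith) hc2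
  refine ⟨C₂, hC₂, fun p P β h hχ hξ => ?_⟩
  haveI := h.cyl.prob
  have hne : ∃ n : ℕ, 1 ≤ n ∧ chi P β ≤ 2 * boxSum P β n := by
    by_contra hc
    push Not at hc
    apply hξ
    rw [xi, sInf_eq_top]
    rintro r ⟨n, -, h1, h2⟩
    exact absurd h2 (not_le.2 (hc n h1))
  set ξ := Nat.find hne with hξd
  have hspec := Nat.find_spec hne
  rw [← hξd] at hspec
  set X := (chi P β).toReal with hX
  have hXsum := h.sum_le hχ
  have hX1 : 1 ≤ X := by
    have := hXsum {0} 0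
    rw [Finset.sum_singleton, tau_self (by simp)] at this
    exact this
  have hbox : ∑ x ∈ bl 0 ξ, (P β).real {ω | conn ω 0 x} ≤ F * (ξ : ℝ) ^ α :=
    le_of_tendsto' (h.tend (bl 0 ξ)) fun N => hF p (P β) h (bl 0 N) 0 0 ξ hspec.1
  have two : (2 : ℝ≥0∞) = ENNReal.ofReal 2 := by norm_num
  refine hq p (P β) h X ξ hX1 hspec.1 ?_ (hlow p (P β) h X ξ hX1 hspec.1 hXsum
    (fun ε hε => h.sup hχ hε) ?_) hXsum
  · have h2 := hspec.2
    rw [boxSum_eq, sum_ofReal, two, ← ENNReal.ofReal_mul (by norm_num)] at h2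
    have := ENNReal.toReal_le_of_le_ofReal
      (mul_nonneg (by norm_num) (Finset.sum_nonneg fun _ _ => measureReal_nonneg)) h2
    linarith
  · intro m hm1 hm
    have h2 := Nat.find_min hne hm
    have h3 : 2 * boxSum P β m < chi P β := by
      by_contra hc
      exact h2 ⟨hm1, not_lt.1 hc⟩
    rw [boxSum_eq, sum_ofReal, two, ← ENNReal.ofReal_mul (by norm_num)] at h3
    have h4 := (ENNReal.ofReal_le_iff_le_toReal hχ).1 h3.le
    have h5 : ∑ y ∈ bl 0 m, tau (P β) (bl 0 m) 0 y ≤ ∑ x ∈ bl 0 m, (P β).real {ω | conn ω 0 x} :=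
      Finset.sum_le_sum fun y _ => tau_le_conn _ _ _
    linarith
end fin

theorem mk_setup {d : ℕ} {J : V d → V d → ℝ} {α c C : ℝ} (hJ : KernelHyp d J α c C)
    (P : ℝ → Measure (Config d)) (hP : IsLRP J P) (hα : α < 1) :
    ∃ A B : ℝ, ∀ β : ℝ, 0 < β → β ≤ betaC P → Setup d α A B (edgeProb J β) (P β) := by
  obtain ⟨A, hA1, hA⟩ := centered hJ hP
  have hC : 0 < C := hJ.c_pos.trans_le hJ.c_le_C
  refine ⟨A, betaC P * C, fun β h0 h1 => ?_⟩
  exact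
    { cyl := fun s f => hP β s f
      le1 := ep_le β
      tr := ep_tr hJ β
      up := fun a b hab => (ep_up hJ h0.le a b hab).trans (by gcongr)
      cen := hA β h0 h1
      a0 := hJ.alpha_pos
      a1 := hα
      ad := hJ.alpha_lt_d
      A1 := hA1
      B0 := mul_pos (h0.trans_le h1) hC }

theorem main_thm {d : ℕ} {J : V d → V d → ℝ} {α c C : ℝ}
    (hJ : KernelHyp d J α c C)
    (P : ℝ → Measure (Config d)) (hP : IsLRP J P)
    (hα : α < 1) :
    ∃ C₁ : ℝ, 0 < C₁ ∧ ∀ β : ℝ, 0 < β → β ≤ betaC P → ∀ x : V d, x ≠ 0 →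
      ((normInf x : ℝ≥0∞) ≤ xi P β →
        twoPoint P β 0 x ≤ ENNReal.ofReal (C₁ * (normInf x : ℝ) ^ (α - (d : ℝ)))) ∧
      (xi P β < (normInf x : ℝ≥0∞) →
        twoPoint P β 0 x ≤ ENNReal.ofReal C₁ * chi P β ^ 2 *
          ENNReal.ofReal ((normInf x : ℝ) ^ (-(d : ℝ) - α))) := by
  obtain ⟨A, B, hset⟩ := mk_setup hJ P hP hα
  obtain ⟨C₁, hC₁, hg⟩ := g_bound d α A B
  obtain ⟨C₂, hC₂, hs⟩ := second_bound d α A B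
  refine ⟨max C₁ C₂, lt_max_of_lt_left hC₁, fun β h0 h1 x hx => ?_⟩
  have h := hset β h0 h1
  haveI := h.cyl.prob
  have hx1 : 1 ≤ normInf x := by
    have := normInf_sub_pos hx
    rwa [sub_zero] at this
  have hxR : (0 : ℝ) < normInf x := by exact_mod_cast hx1
  have hx2 : normInf x ≤ normInf (x - 0) := by rw [sub_zero]
  constructor
  · intro _
    rw [tp_ofReal]
    refine ENNReal.ofReal_le_ofReal (le_of_tendsto' (tau_tendsto 0 x) fun N => ?_)
    refine (hg _ _ h (bl 0 N) (normInf x) hx1 0 x hx2).trans ?_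
    rw [show -((d : ℝ) - α) = α - d by ring]
    gcongr
    exact le_max_left _ _
  · intro hxi
    have hCp : (0 : ℝ) < max C₁ C₂ := lt_max_of_lt_left hC₁
    by_cases hχ : chi P β = ⊤
    · rw [hχ]
      have e : ENNReal.ofReal (max C₁ C₂) * (⊤ : ℝ≥0∞) ^ 2 *
          ENNReal.ofReal ((normInf x : ℝ) ^ (-(d : ℝ) - α)) = ⊤ := by
        rw [ENNReal.top_pow (by norm_num), ENNReal.mul_top, ENNReal.top_mul]
        · exact (ENNReal.ofReal_pos.2 (by positivity)).ne'
        · exact (ENNReal.ofReal_pos.2 hCp).ne'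
      rw [e]; exact le_top
    · rw [tp_ofReal]
      have e : ENNReal.ofReal (max C₁ C₂) * chi P β ^ 2 *
          ENNReal.ofReal ((normInf x : ℝ) ^ (-(d : ℝ) - α)) =
          ENNReal.ofReal (max C₁ C₂ * (chi P β).toReal ^ 2 * (normInf x : ℝ) ^ (-(d : ℝ) - α)) := by
        rw [ENNReal.ofReal_mul (by positivity), ENNReal.ofReal_mul hCp.le,
          ENNReal.ofReal_pow ENNReal.toReal_nonneg, ENNReal.ofReal_toReal hχ]
      rw [e]
      refine ENNReal.ofReal_le_ofReal (le_of_tendsto' (tau_tendsto 0 x) fun N => ?_)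
      refine (hs _ P β h hχ (ne_top_of_lt hxi) (bl 0 N) (normInf x) hx1 0 x hx2).trans ?_
      rw [show -((d : ℝ) + α) = -(d : ℝ) - α by ring]
      gcongr
      exact le_max_right _ _

end LRP

namespace LRP

/-- Upper bounds on the slightly subcritical two-point function: if `0 < α < d` and
`α < 1` then for all `0 < β ≤ β_c`, `ℙ_β(0↔x) ≤ C₁ ‖x‖^{-d+α}` when `‖x‖ ≤ ξ(β)` and
`ℙ_β(0↔x) ≤ C₁ χ(β)² ‖x‖^{-d-α}` when `‖x‖ > ξ(β)`. -/
theorem subcritical_two_point_upper {d : ℕ} {J : V d → V d → ℝ} {α c C : ℝ}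
    (hJ : KernelHyp d J α c C)
    (P : ℝ → Measure (Config d)) (hP : IsLRP J P)
    (hα : α < 1) :
    ∃ C₁ : ℝ, 0 < C₁ ∧ ∀ β : ℝ, 0 < β → β ≤ betaC P → ∀ x : V d, x ≠ 0 →
      ((normInf x : ℝ≥0∞) ≤ xi P β →
        twoPoint P β 0 x ≤ ENNReal.ofReal (C₁ * (normInf x : ℝ) ^ (α - (d : ℝ)))) ∧
      (xi P β < (normInf x : ℝ≥0∞) →
        twoPoint P β 0 x ≤ ENNReal.ofReal C₁ * chi P β ^ 2 *
          ENNReal.ofReal ((normInf x : ℝ) ^ (-(d : ℝ) - α))) := by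
  exact main_thm hJ P hP hα

end LRP
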